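/- Each formula in the logic for DB-ASMs can be replaced by an equivalent formula not containing any subformula of the form upd(r,X). -/

import Mathlib

set_option maxHeartbeats 1000000

namespace DBASM

/-- A signature of meta-finite states: a finite set `F` of dynamic function
symbols (all unary; arguments are read as tuples), static function symbols
`Stat` and location-operator names `Rho`. -/
structure Sig where
  F : Type
  Stat : Type
  Rho : Type
  [fintypeF : Fintype F]
  [deqF : DecidableEq F]

attribute [instance] Sig.fintypeF Sig.deqF

variable {σ : Sig} {B : Type}

/-- A meta-finite state (interpretation) over the base set `B`: a finite
database part `db`, interpretations of the dynamic and static function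
symbols, and interpretations of the location operators as multiset
functions. -/
structure Interp (σ : Sig) (B : Type) where
  db : Set B
  db_fin : db.Finite
  dyn : σ.F → B → B
  stat : σ.Stat → B → B
  lop : σ.Rho → Multiset B → B

/-- An update `(f, a, b)`: the location `(f, a)` gets the value `b`. -/
abbrev Upd (σ : Sig) (B : Type) := σ.F × B × B

/-- An update set. -/
abbrev USet (σ : Sig) (B : Type) := Set (Upd σ B)

/-- An update multiset, represented by its multiplicity function. -/
abbrev UMul (σ : Sig) (B : Type) := Upd σ B → ℕ

/-- Consistency of an update set. -/
def consistentU (Δ : USet σ B) : Prop :=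
  ∀ (f : σ.F) (a b b' : B), (f, a, b) ∈ Δ → (f, a, b') ∈ Δ → b = b'

open Classical in
/-- The successor state `S + Δ`. -/
noncomputable def Interp.apply (I : Interp σ B) (Δ : USet σ B) : Interp σ B :=
  { I with dyn := fun f a => if h : ∃ b, (f, a, b) ∈ Δ then h.choose else I.dyn f a }

/-- A (first-order) variable assignment: `dbv` interprets the database
variables, `av` the algorithmic variables. -/
structure Asg (B : Type) where
  dbv : ℕ → B
  av : ℕ → B

def Asg.updDb (ζ : Asg B) (x : ℕ) (a : B) : Asg B :=
  { ζ with dbv := Function.update ζ.dbv x a }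

def Asg.updA (ζ : Asg B) (x : ℕ) (a : B) : Asg B :=
  { ζ with av := Function.update ζ.av x a }

/-- Pure terms (terms of the first-order logic of meta-finite states). -/
inductive PTerm (σ : Sig) : Type where
  | var : ℕ → PTerm σ
  | avar : ℕ → PTerm σ
  | dyn : σ.F → PTerm σ → PTerm σ
  | stat : σ.Stat → PTerm σ → PTerm σ

/-- Pure formulae (first-order formulae of meta-finite states). -/
inductive PFml (σ : Sig) : Type where
  | eq : PTerm σ → PTerm σ → PFml σ
  | not : PFml σ → PFml σ
  | and : PFml σ → PFml σ → PFml σ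
  | allDb : ℕ → PFml σ → PFml σ
  | allA : ℕ → PFml σ → PFml σ

/-- DB-ASM rules. -/
inductive Rule (σ : Sig) : Type where
  | assign : σ.F → PTerm σ → PTerm σ → Rule σ
  | cond : PFml σ → Rule σ → Rule σ
  | forall_ : ℕ → PFml σ → Rule σ → Rule σ
  | choose : ℕ → PFml σ → Rule σ → Rule σ
  | par : Rule σ → Rule σ → Rule σ
  | seq : Rule σ → Rule σ → Rule σ
  | letr : σ.F → PTerm σ → σ.Rho → Rule σ → Rule σ

def PTerm.val : PTerm σ → Interp σ B → Asg B → B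
  | .var x, _, ζ => ζ.dbv x
  | .avar x, _, ζ => ζ.av x
  | .dyn f t, I, ζ => I.dyn f (t.val I ζ)
  | .stat g t, I, ζ => I.stat g (t.val I ζ)

def PFml.val : PFml σ → Interp σ B → Asg B → Prop
  | .eq s t, I, ζ => s.val I ζ = t.val I ζ
  | .not φ, I, ζ => ¬ φ.val I ζ
  | .and φ ψ, I, ζ => φ.val I ζ ∧ ψ.val I ζ
  | .allDb x φ, I, ζ => ∀ a ∈ I.db, φ.val I (ζ.updDb x a)
  | .allA x φ, I, ζ => ∀ a : B, φ.val I (ζ.updA x a)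

/-- The update set obtained from an update multiset by forgetting multiplicities. -/
def mulToSet (D : UMul σ B) : USet σ B := { u | D u ≠ 0 }

open Classical in
/-- The multiset of values assigned by an update multiset to the location `(f, a)`. -/
noncomputable def mulVals (D : UMul σ B) (f : σ.F) (a : B) : Multiset B :=
  if h : (Function.support fun b => D (f, a, b)).Finite then
    h.toFinset.val.bind (fun b => Multiset.replicate (D (f, a, b)) b)
  else 0

/-- Sequential composition `Δ₁ ⊘ Δ₂` of update sets. -/
def seqComp (Δ₁ Δ₂ : USet σ B) : USet σ B :=
  Δ₂ ∪ { u | u ∈ Δ₁ ∧ ∀ b : B, (u.1, u.2.1, b) ∉ Δ₂ }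

open Classical in
/-- Sequential composition `Δ̈₁ ⊘ Δ̈₂` of update multisets. -/
noncomputable def mseqComp (D₁ D₂ : UMul σ B) : UMul σ B :=
  fun u => D₂ u + if ∀ b : B, D₂ (u.1, u.2.1, b) = 0 then D₁ u else 0

open Classical in
/-- Collapsing an update multiset to an update set, aggregating the values at
the location `(f, a)` by the location operator `ρ`. -/
noncomputable def scollapse (I : Interp σ B) (f : σ.F) (a : B) (ρ : σ.Rho)
    (D : UMul σ B) : USet σ B :=
  {u | u = (f, a, I.lop ρ (mulVals D f a))} ∪
    { u | D u ≠ 0 ∧ ¬ (u.1 = f ∧ u.2.1 = a) }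

open Classical in
/-- Collapsing inside an update multiset (for the let rule). -/
noncomputable def mcollapse (I : Interp σ B) (f : σ.F) (a : B) (ρ : σ.Rho)
    (D : UMul σ B) : UMul σ B :=
  fun u =>
    if u.1 = f ∧ u.2.1 = a then
      (if u.2.2 = I.lop ρ (mulVals D f a) then 1 else 0)
    else D u

open Classical in
/-- The set `Δ̈(r, S, ζ)` of update multisets yielded by a DB-ASM rule. -/
noncomputable def updMuls : Rule σ → Interp σ B → Asg B → Set (UMul σ B)
  | .assign f t s, I, ζ =>
      { D | D = fun u => if u = (f, t.val I ζ, s.val I ζ) then 1 else 0 }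
  | .cond φ r, I, ζ =>
      if φ.val I ζ then updMuls r I ζ else { D | D = fun _ => 0 }
  | .forall_ x φ r, I, ζ =>
      { D | ∃ g : B → UMul σ B,
          (∀ a ∈ I.db, (φ.val I (ζ.updDb x a)) → g a ∈ updMuls r I (ζ.updDb x a)) ∧
          (∀ a : B, ¬ (a ∈ I.db ∧ φ.val I (ζ.updDb x a)) → g a = fun _ => 0) ∧
          D = fun u => ∑ a ∈ I.db_fin.toFinset, g a u }
  | .choose x φ r, I, ζ =>
      { D | ∃ a ∈ I.db, φ.val I (ζ.updDb x a) ∧ D ∈ updMuls r I (ζ.updDb x a) }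
  | .par r₁ r₂, I, ζ =>
      { D | ∃ D₁ ∈ updMuls r₁ I ζ, ∃ D₂ ∈ updMuls r₂ I ζ,
          D = fun u => D₁ u + D₂ u }
  | .seq r₁ r₂, I, ζ =>
      { D | ∃ D₁ ∈ updMuls r₁ I ζ, consistentU (mulToSet D₁) ∧
            ∃ D₂ ∈ updMuls r₂ (I.apply (mulToSet D₁)) ζ, D = mseqComp D₁ D₂ } ∪
      { D₁ | D₁ ∈ updMuls r₁ I ζ ∧ ¬ consistentU (mulToSet D₁) }
  | .letr f t ρ r, I, ζ =>
      { D | ∃ D' ∈ updMuls r I ζ, D = mcollapse I f (t.val I ζ) ρ D' }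

open Classical in
/-- The set `Δ(r, S, ζ)` of update sets yielded by a DB-ASM rule. -/
noncomputable def updSets : Rule σ → Interp σ B → Asg B → Set (USet σ B)
  | .assign f t s, I, ζ => { Δ | Δ = {(f, t.val I ζ, s.val I ζ)} }
  | .cond φ r, I, ζ =>
      if φ.val I ζ then updSets r I ζ else { Δ | Δ = ∅ }
  | .forall_ x φ r, I, ζ =>
      { Δ | ∃ g : B → USet σ B,
          (∀ a ∈ I.db, (φ.val I (ζ.updDb x a)) → g a ∈ updSets r I (ζ.updDb x a)) ∧
          Δ = ⋃ a ∈ { a ∈ I.db | φ.val I (ζ.updDb x a) }, g a }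
  | .choose x φ r, I, ζ =>
      { Δ | ∃ a ∈ I.db, φ.val I (ζ.updDb x a) ∧ Δ ∈ updSets r I (ζ.updDb x a) }
  | .par r₁ r₂, I, ζ =>
      { Δ | ∃ Δ₁ ∈ updSets r₁ I ζ, ∃ Δ₂ ∈ updSets r₂ I ζ, Δ = Δ₁ ∪ Δ₂ }
  | .seq r₁ r₂, I, ζ =>
      { Δ | ∃ Δ₁ ∈ updSets r₁ I ζ, consistentU Δ₁ ∧
            ∃ Δ₂ ∈ updSets r₂ (I.apply Δ₁) ζ, Δ = seqComp Δ₁ Δ₂ } ∪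
      { Δ₁ | Δ₁ ∈ updSets r₁ I ζ ∧ ¬ consistentU Δ₁ }
  | .letr f t ρ r, I, ζ =>
      { Δ | ∃ D ∈ updMuls r I ζ, Δ = scollapse I f (t.val I ζ) ρ D }


mutual
/-- Terms of the logic for DB-ASMs (including ρ-terms). -/
inductive LTerm (σ : Sig) : Type where
  | var : ℕ → LTerm σ
  | avar : ℕ → LTerm σ
  | dyn : σ.F → LTerm σ → LTerm σ
  | stat : σ.Stat → LTerm σ → LTerm σ
  | rho : σ.Rho → ℕ → LTerm σ → Fml σ → LTerm σ

/-- Formulae of the logic for DB-ASMs. -/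
inductive Fml (σ : Sig) : Type where
  | eq : LTerm σ → LTerm σ → Fml σ
  | not : Fml σ → Fml σ
  | and : Fml σ → Fml σ → Fml σ
  | allDb : ℕ → Fml σ → Fml σ
  | allA : ℕ → Fml σ → Fml σ
  | allM : ℕ → Fml σ → Fml σ
  | allX : ℕ → Fml σ → Fml σ
  | allXc : ℕ → Fml σ → Fml σ
  | allXm : ℕ → Fml σ → Fml σ
  | allXmc : ℕ → Fml σ → Fml σ
  | allF : ℕ → Fml σ → Fml σ
  | allG : ℕ → Fml σ → Fml σ
  | upd : Rule σ → ℕ → Fml σ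
  | upm : Rule σ → ℕ → Fml σ
  | memM : ℕ → LTerm σ → LTerm σ → Fml σ
  | memX : ℕ → σ.F → LTerm σ → LTerm σ → Fml σ
  | memXc : ℕ → σ.F → LTerm σ → LTerm σ → LTerm σ → Fml σ
  | memXm : ℕ → σ.F → LTerm σ → LTerm σ → LTerm σ → Fml σ
  | memXmc : ℕ → σ.F → LTerm σ → LTerm σ → LTerm σ → LTerm σ → Fml σ
  | memF : ℕ → σ.F → LTerm σ → LTerm σ → LTerm σ → LTerm σ → LTerm σ → LTerm σ → LTerm σ → Fml σ
  | memG : ℕ → σ.F → LTerm σ → LTerm σ → LTerm σ → LTerm σ → LTerm σ → LTerm σ → LTerm σ → Fml σ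
  | box : ℕ → Fml σ → Fml σ
end

/-- Second-order variable assignment (one namespace per kind of
second-order variable). -/
structure SOAsg (σ : Sig) (B : Type) where
  m : ℕ → Set (B × B)
  x : ℕ → USet σ B
  xc : ℕ → Set (σ.F × B × B × B)
  xm : ℕ → Set (σ.F × B × B × B)
  xmc : ℕ → Set (σ.F × B × B × B × B)
  fv : ℕ → Set (σ.F × B × B × B × B × B × B × B)
  gv : ℕ → Set (σ.F × B × B × B × B × B × B × B)

/-- A second-order assignment is admissible if all its values are finite sets. -/
def SOAsg.Fin (Ξ : SOAsg σ B) : Prop :=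
  (∀ n, (Ξ.m n).Finite) ∧ (∀ n, (Ξ.x n).Finite) ∧ (∀ n, (Ξ.xc n).Finite) ∧
  (∀ n, (Ξ.xm n).Finite) ∧ (∀ n, (Ξ.xmc n).Finite) ∧ (∀ n, (Ξ.fv n).Finite) ∧
  (∀ n, (Ξ.gv n).Finite)

def SOAsg.uM (Ξ : SOAsg σ B) (n : ℕ) (P : Set (B × B)) : SOAsg σ B :=
  { Ξ with m := Function.update Ξ.m n P }
def SOAsg.uX (Ξ : SOAsg σ B) (n : ℕ) (P : USet σ B) : SOAsg σ B :=
  { Ξ with x := Function.update Ξ.x n P }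
def SOAsg.uXc (Ξ : SOAsg σ B) (n : ℕ) (P : Set (σ.F × B × B × B)) : SOAsg σ B :=
  { Ξ with xc := Function.update Ξ.xc n P }
def SOAsg.uXm (Ξ : SOAsg σ B) (n : ℕ) (P : Set (σ.F × B × B × B)) : SOAsg σ B :=
  { Ξ with xm := Function.update Ξ.xm n P }
def SOAsg.uXmc (Ξ : SOAsg σ B) (n : ℕ) (P : Set (σ.F × B × B × B × B)) : SOAsg σ B :=
  { Ξ with xmc := Function.update Ξ.xmc n P }
def SOAsg.uF (Ξ : SOAsg σ B) (n : ℕ) (P : Set (σ.F × B × B × B × B × B × B × B)) : SOAsg σ B :=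
  { Ξ with fv := Function.update Ξ.fv n P }
def SOAsg.uG (Ξ : SOAsg σ B) (n : ℕ) (P : Set (σ.F × B × B × B × B × B × B × B)) : SOAsg σ B :=
  { Ξ with gv := Function.update Ξ.gv n P }

open Classical in
mutual
/-- Value of a term of the logic for DB-ASMs. -/
noncomputable def lval (I : Interp σ B) (ζ : Asg B) (Ξ : SOAsg σ B) : LTerm σ → B
  | .var x => ζ.dbv x
  | .avar x => ζ.av x
  | .dyn f t => I.dyn f (lval I ζ Ξ t)
  | .stat g t => I.stat g (lval I ζ Ξ t)
  | .rho ρ x t φ =>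
      I.lop ρ (Multiset.map (fun a => lval I (ζ.updDb x a) Ξ t)
        (Multiset.filter (fun a => fval I (ζ.updDb x a) Ξ φ) I.db_fin.toFinset.val))

/-- Truth value of a formula of the logic for DB-ASMs. -/
noncomputable def fval (I : Interp σ B) (ζ : Asg B) (Ξ : SOAsg σ B) : Fml σ → Prop
  | .eq s t => lval I ζ Ξ s = lval I ζ Ξ t
  | .not φ => ¬ fval I ζ Ξ φ
  | .and φ ψ => fval I ζ Ξ φ ∧ fval I ζ Ξ ψ
  | .allDb x φ => ∀ a ∈ I.db, fval I (ζ.updDb x a) Ξ φ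
  | .allA x φ => ∀ a : B, fval I (ζ.updA x a) Ξ φ
  | .allM n φ => ∀ P : Set (B × B), P.Finite → fval I ζ (Ξ.uM n P) φ
  | .allX n φ => ∀ P : USet σ B, P.Finite → fval I ζ (Ξ.uX n P) φ
  | .allXc n φ => ∀ P : Set (σ.F × B × B × B), P.Finite → fval I ζ (Ξ.uXc n P) φ
  | .allXm n φ => ∀ P : Set (σ.F × B × B × B), P.Finite → fval I ζ (Ξ.uXm n P) φ
  | .allXmc n φ => ∀ P : Set (σ.F × B × B × B × B), P.Finite → fval I ζ (Ξ.uXmc n P) φ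
  | .allF n φ => ∀ P : Set (σ.F × B × B × B × B × B × B × B), P.Finite → fval I ζ (Ξ.uF n P) φ
  | .allG n φ => ∀ P : Set (σ.F × B × B × B × B × B × B × B), P.Finite → fval I ζ (Ξ.uG n P) φ
  | .upd r n => Ξ.x n ∈ updSets r I ζ
  | .upm r n =>
      (fun u : Upd σ B => {ta : B | (u.1, u.2.1, u.2.2, ta) ∈ Ξ.xm n}.ncard) ∈ updMuls r I ζ
  | .memM n s t => (lval I ζ Ξ s, lval I ζ Ξ t) ∈ Ξ.m n
  | .memX n f t t0 => (f, lval I ζ Ξ t, lval I ζ Ξ t0) ∈ Ξ.x n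
  | .memXc n f t t0 s => (f, lval I ζ Ξ t, lval I ζ Ξ t0, lval I ζ Ξ s) ∈ Ξ.xc n
  | .memXm n f t t0 ta => (f, lval I ζ Ξ t, lval I ζ Ξ t0, lval I ζ Ξ ta) ∈ Ξ.xm n
  | .memXmc n f t t0 ta s =>
      (f, lval I ζ Ξ t, lval I ζ Ξ t0, lval I ζ Ξ ta, lval I ζ Ξ s) ∈ Ξ.xmc n
  | .memF n f t1 t2 t3 t4 t5 t6 t7 =>
      (f, lval I ζ Ξ t1, lval I ζ Ξ t2, lval I ζ Ξ t3, lval I ζ Ξ t4,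
        lval I ζ Ξ t5, lval I ζ Ξ t6, lval I ζ Ξ t7) ∈ Ξ.fv n
  | .memG n f t1 t2 t3 t4 t5 t6 t7 =>
      (f, lval I ζ Ξ t1, lval I ζ Ξ t2, lval I ζ Ξ t3, lval I ζ Ξ t4,
        lval I ζ Ξ t5, lval I ζ Ξ t6, lval I ζ Ξ t7) ∈ Ξ.gv n
  | .box n φ => ¬ consistentU (Ξ.x n) ∨ fval (I.apply (Ξ.x n)) ζ Ξ φ
end
namespace Fml

def imp (φ ψ : Fml σ) : Fml σ := .not (.and φ (.not ψ))
def or (φ ψ : Fml σ) : Fml σ := .not (.and (.not φ) (.not ψ))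
def iff (φ ψ : Fml σ) : Fml σ := .and (imp φ ψ) (imp ψ φ)
def exDb (x : ℕ) (φ : Fml σ) : Fml σ := .not (.allDb x (.not φ))
def exA (x : ℕ) (φ : Fml σ) : Fml σ := .not (.allA x (.not φ))
def exM (n : ℕ) (φ : Fml σ) : Fml σ := .not (.allM n (.not φ))
def exX (n : ℕ) (φ : Fml σ) : Fml σ := .not (.allX n (.not φ))
def exXc (n : ℕ) (φ : Fml σ) : Fml σ := .not (.allXc n (.not φ))
def exXm (n : ℕ) (φ : Fml σ) : Fml σ := .not (.allXm n (.not φ))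
def exXmc (n : ℕ) (φ : Fml σ) : Fml σ := .not (.allXmc n (.not φ))
def exF (n : ℕ) (φ : Fml σ) : Fml σ := .not (.allF n (.not φ))
def exG (n : ℕ) (φ : Fml σ) : Fml σ := .not (.allG n (.not φ))

def tt : Fml σ := .eq (.var 0) (.var 0)

def bigAnd : List (Fml σ) → Fml σ
  | [] => tt
  | [φ] => φ
  | φ :: l => .and φ (bigAnd l)

/-- Conjunction over all dynamic function symbols. -/
noncomputable def allFdyn (k : σ.F → Fml σ) : Fml σ :=
  bigAnd ((Finset.univ : Finset σ.F).toList.map k)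

/-- Conjunction over all dynamic function symbols different from `f`. -/
noncomputable def allFdynNe (f : σ.F) (k : σ.F → Fml σ) : Fml σ :=
  bigAnd (((Finset.univ : Finset σ.F).erase f).toList.map k)

def allAs (l : List ℕ) (φ : Fml σ) : Fml σ := l.foldr Fml.allA φ
def exAs (l : List ℕ) (φ : Fml σ) : Fml σ := l.foldr exA φ

end Fml

/-- Embedding of pure terms into terms of the logic. -/
def PTerm.toL : PTerm σ → LTerm σ
  | .var x => .var x
  | .avar x => .avar x
  | .dyn f t => .dyn f t.toL
  | .stat g t => .stat g t.toL

/-- Embedding of pure formulae into formulae of the logic. -/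
def PFml.toF : PFml σ → Fml σ
  | .eq s t => .eq s.toL t.toL
  | .not φ => .not φ.toF
  | .and φ ψ => .and φ.toF ψ.toF
  | .allDb x φ => .allDb x φ.toF
  | .allA x φ => .allA x φ.toF

/-- A strict upper bound for the first-order variables occurring in a pure term. -/
def PTerm.bnd : PTerm σ → ℕ
  | .var x => x + 1
  | .avar x => x + 1
  | .dyn _ t => t.bnd
  | .stat _ t => t.bnd

def PFml.bnd : PFml σ → ℕ
  | .eq s t => max s.bnd t.bnd
  | .not φ => φ.bnd
  | .and φ ψ => max φ.bnd ψ.bnd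
  | .allDb x φ => max (x + 1) φ.bnd
  | .allA x φ => max (x + 1) φ.bnd

def Rule.bnd : Rule σ → ℕ
  | .assign _ t s => max t.bnd s.bnd
  | .cond φ r => max φ.bnd r.bnd
  | .forall_ x φ r => max (x + 1) (max φ.bnd r.bnd)
  | .choose x φ r => max (x + 1) (max φ.bnd r.bnd)
  | .par r₁ r₂ => max r₁.bnd r₂.bnd
  | .seq r₁ r₂ => max r₁.bnd r₂.bnd
  | .letr _ t _ r => max t.bnd r.bnd

/-- Renaming of a free database variable `x` into `y` in a pure term. -/
def PTerm.rename (x y : ℕ) : PTerm σ → PTerm σ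
  | .var z => if z = x then .var y else .var z
  | .avar z => .avar z
  | .dyn f t => .dyn f (t.rename x y)
  | .stat g t => .stat g (t.rename x y)

def PFml.rename (x y : ℕ) : PFml σ → PFml σ
  | .eq s t => .eq (s.rename x y) (t.rename x y)
  | .not φ => .not (φ.rename x y)
  | .and φ ψ => .and (φ.rename x y) (ψ.rename x y)
  | .allDb z φ => if z = x then .allDb z φ else .allDb z (φ.rename x y)
  | .allA z φ => .allA z (φ.rename x y)

def Rule.rename (x y : ℕ) : Rule σ → Rule σ
  | .assign f t s => .assign f (t.rename x y) (s.rename x y)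
  | .cond φ r => .cond (φ.rename x y) (r.rename x y)
  | .forall_ z φ r =>
      if z = x then .forall_ z φ r else .forall_ z (φ.rename x y) (r.rename x y)
  | .choose z φ r =>
      if z = x then .choose z φ r else .choose z (φ.rename x y) (r.rename x y)
  | .par r₁ r₂ => .par (r₁.rename x y) (r₂.rename x y)
  | .seq r₁ r₂ => .seq (r₁.rename x y) (r₂.rename x y)
  | .letr f t ρ r => .letr f (t.rename x y) ρ (r.rename x y)

mutual
/-- The free second-order variables of kind `X` (update-set variables) of a term. -/
def LTerm.freeX : LTerm σ → Set ℕ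
  | .var _ => ∅
  | .avar _ => ∅
  | .dyn _ t => t.freeX
  | .stat _ t => t.freeX
  | .rho _ _ t φ => t.freeX ∪ φ.freeX

/-- The free second-order variables of kind `X` (update-set variables) of a formula. -/
def Fml.freeX : Fml σ → Set ℕ
  | .eq s t => s.freeX ∪ t.freeX
  | .not φ => φ.freeX
  | .and φ ψ => φ.freeX ∪ ψ.freeX
  | .allDb _ φ => φ.freeX
  | .allA _ φ => φ.freeX
  | .allM _ φ => φ.freeX
  | .allX n φ => φ.freeX \ {n}
  | .allXc _ φ => φ.freeX
  | .allXm _ φ => φ.freeX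
  | .allXmc _ φ => φ.freeX
  | .allF _ φ => φ.freeX
  | .allG _ φ => φ.freeX
  | .upd _ n => {n}
  | .upm _ _ => ∅
  | .memM _ s t => s.freeX ∪ t.freeX
  | .memX n _ t t0 => {n} ∪ t.freeX ∪ t0.freeX
  | .memXc _ _ t t0 s => t.freeX ∪ t0.freeX ∪ s.freeX
  | .memXm _ _ t t0 ta => t.freeX ∪ t0.freeX ∪ ta.freeX
  | .memXmc _ _ t t0 ta s => t.freeX ∪ t0.freeX ∪ ta.freeX ∪ s.freeX
  | .memF _ _ t1 t2 t3 t4 t5 t6 t7 =>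
      t1.freeX ∪ t2.freeX ∪ t3.freeX ∪ t4.freeX ∪ t5.freeX ∪ t6.freeX ∪ t7.freeX
  | .memG _ _ t1 t2 t3 t4 t5 t6 t7 =>
      t1.freeX ∪ t2.freeX ∪ t3.freeX ∪ t4.freeX ∪ t5.freeX ∪ t6.freeX ∪ t7.freeX
  | .box n φ => {n} ∪ φ.freeX
end

mutual
/-- A strict upper bound for all first-order variables occurring in a term. -/
def LTerm.bndF : LTerm σ → ℕ
  | .var x => x + 1
  | .avar x => x + 1
  | .dyn _ t => t.bndF
  | .stat _ t => t.bndF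
  | .rho _ x t φ => max (x + 1) (max t.bndF φ.bndF)

/-- A strict upper bound for all first-order variables occurring in a formula. -/
def Fml.bndF : Fml σ → ℕ
  | .eq s t => max s.bndF t.bndF
  | .not φ => φ.bndF
  | .and φ ψ => max φ.bndF ψ.bndF
  | .allDb x φ => max (x + 1) φ.bndF
  | .allA x φ => max (x + 1) φ.bndF
  | .allM _ φ => φ.bndF
  | .allX _ φ => φ.bndF
  | .allXc _ φ => φ.bndF
  | .allXm _ φ => φ.bndF
  | .allXmc _ φ => φ.bndF
  | .allF _ φ => φ.bndF
  | .allG _ φ => φ.bndF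
  | .upd r _ => r.bnd
  | .upm r _ => r.bnd
  | .memM _ s t => max s.bndF t.bndF
  | .memX _ _ t t0 => max t.bndF t0.bndF
  | .memXc _ _ t t0 s => max t.bndF (max t0.bndF s.bndF)
  | .memXm _ _ t t0 ta => max t.bndF (max t0.bndF ta.bndF)
  | .memXmc _ _ t t0 ta s => max (max t.bndF t0.bndF) (max ta.bndF s.bndF)
  | .memF _ _ t1 t2 t3 t4 t5 t6 t7 =>
      max (max (max t1.bndF t2.bndF) (max t3.bndF t4.bndF))
        (max (max t5.bndF t6.bndF) t7.bndF)
  | .memG _ _ t1 t2 t3 t4 t5 t6 t7 =>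
      max (max (max t1.bndF t2.bndF) (max t3.bndF t4.bndF))
        (max (max t5.bndF t6.bndF) t7.bndF)
  | .box _ φ => φ.bndF
end

mutual
/-- Purity of a term: no ρ-subterms. -/
def LTerm.isPure : LTerm σ → Prop
  | .var _ => True
  | .avar _ => True
  | .dyn _ t => t.isPure
  | .stat _ t => t.isPure
  | .rho _ _ _ _ => False

/-- A pure formula: built from equations between ρ-free terms by `¬`, `∧`
and first-order quantification only. -/
def Fml.isPure : Fml σ → Prop
  | .eq s t => s.isPure ∧ t.isPure
  | .not φ => φ.isPure
  | .and φ ψ => φ.isPure ∧ ψ.isPure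
  | .allDb _ φ => φ.isPure
  | .allA _ φ => φ.isPure
  | _ => False
end

mutual
/-- A static term: contains no dynamic function symbols. -/
def LTerm.isStatic : LTerm σ → Prop
  | .var _ => True
  | .avar _ => True
  | .dyn _ _ => False
  | .stat _ t => t.isStatic
  | .rho _ _ t φ => t.isStatic ∧ φ.isStatic

/-- A static formula: contains no dynamic function symbols. -/
def Fml.isStatic : Fml σ → Prop
  | .eq s t => s.isStatic ∧ t.isStatic
  | .not φ => φ.isStatic
  | .and φ ψ => φ.isStatic ∧ ψ.isStatic
  | .allDb _ φ => φ.isStatic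
  | .allA _ φ => φ.isStatic
  | _ => False
end

mutual
/-- Whether a term contains a subformula of the form `upd(r, X)`
(flag `true`) or `upm(r, Ẍ)` (flag `false`). -/
def LTerm.hasR (b : Bool) : LTerm σ → Prop
  | .var _ => False
  | .avar _ => False
  | .dyn _ t => t.hasR b
  | .stat _ t => t.hasR b
  | .rho _ _ t φ => t.hasR b ∨ φ.hasR b

/-- Whether a formula contains a subformula of the form `upd(r, X)`
(flag `true`) or `upm(r, Ẍ)` (flag `false`). -/
def Fml.hasR (b : Bool) : Fml σ → Prop
  | .eq s t => s.hasR b ∨ t.hasR b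
  | .not φ => φ.hasR b
  | .and φ ψ => φ.hasR b ∨ ψ.hasR b
  | .allDb _ φ => φ.hasR b
  | .allA _ φ => φ.hasR b
  | .allM _ φ => φ.hasR b
  | .allX _ φ => φ.hasR b
  | .allXc _ φ => φ.hasR b
  | .allXm _ φ => φ.hasR b
  | .allXmc _ φ => φ.hasR b
  | .allF _ φ => φ.hasR b
  | .allG _ φ => φ.hasR b
  | .upd _ _ => b = true
  | .upm _ _ => b = false
  | .memM _ s t => s.hasR b ∨ t.hasR b
  | .memX _ _ t t0 => t.hasR b ∨ t0.hasR b
  | .memXc _ _ t t0 s => t.hasR b ∨ t0.hasR b ∨ s.hasR b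
  | .memXm _ _ t t0 ta => t.hasR b ∨ t0.hasR b ∨ ta.hasR b
  | .memXmc _ _ t t0 ta s => t.hasR b ∨ t0.hasR b ∨ ta.hasR b ∨ s.hasR b
  | .memF _ _ t1 t2 t3 t4 t5 t6 t7 =>
      t1.hasR b ∨ t2.hasR b ∨ t3.hasR b ∨ t4.hasR b ∨ t5.hasR b ∨ t6.hasR b ∨ t7.hasR b
  | .memG _ _ t1 t2 t3 t4 t5 t6 t7 =>
      t1.hasR b ∨ t2.hasR b ∨ t3.hasR b ∨ t4.hasR b ∨ t5.hasR b ∨ t6.hasR b ∨ t7.hasR b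
  | .box _ φ => φ.hasR b
end

/-- Whether a formula contains a subformula of the form `upd(r, X)`. -/
def Fml.hasUpd (φ : Fml σ) : Prop := φ.hasR true
/-- Whether a formula contains a subformula of the form `upm(r, Ẍ)`. -/
def Fml.hasUpm (φ : Fml σ) : Prop := φ.hasR false

mutual
/-- Substitution of the term `u` for the first-order variable `x`
(database namespace if `dbNs`, algorithmic namespace otherwise) in a term. -/
def LTerm.subst (dbNs : Bool) (x : ℕ) (u : LTerm σ) : LTerm σ → LTerm σ
  | .var y => if dbNs && (y == x) then u else .var y
  | .avar y => if !dbNs && (y == x) then u else .avar y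
  | .dyn f t => .dyn f (LTerm.subst dbNs x u t)
  | .stat g t => .stat g (LTerm.subst dbNs x u t)
  | .rho ρ y t φ =>
      if dbNs && (y == x) then .rho ρ y t φ
      else .rho ρ y (LTerm.subst dbNs x u t) (φ.subst dbNs x u)
termination_by t => sizeOf t

/-- Substitution of the term `u` for the first-order variable `x` in a formula. -/
def Fml.subst (dbNs : Bool) (x : ℕ) (u : LTerm σ) : Fml σ → Fml σ
  | .eq s t => .eq (LTerm.subst dbNs x u s) (LTerm.subst dbNs x u t)
  | .not φ => .not (φ.subst dbNs x u)
  | .and φ ψ => .and (φ.subst dbNs x u) (ψ.subst dbNs x u)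
  | .allDb y φ => if dbNs && (y == x) then .allDb y φ else .allDb y (φ.subst dbNs x u)
  | .allA y φ => if !dbNs && (y == x) then .allA y φ else .allA y (φ.subst dbNs x u)
  | .allM n φ => .allM n (φ.subst dbNs x u)
  | .allX n φ => .allX n (φ.subst dbNs x u)
  | .allXc n φ => .allXc n (φ.subst dbNs x u)
  | .allXm n φ => .allXm n (φ.subst dbNs x u)
  | .allXmc n φ => .allXmc n (φ.subst dbNs x u)
  | .allF n φ => .allF n (φ.subst dbNs x u)
  | .allG n φ => .allG n (φ.subst dbNs x u)
  | .upd r n => .upd r n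
  | .upm r n => .upm r n
  | .memM n s t => .memM n (LTerm.subst dbNs x u s) (LTerm.subst dbNs x u t)
  | .memX n f t t0 => .memX n f (LTerm.subst dbNs x u t) (LTerm.subst dbNs x u t0)
  | .memXc n f t t0 s => .memXc n f (LTerm.subst dbNs x u t) (LTerm.subst dbNs x u t0) (LTerm.subst dbNs x u s)
  | .memXm n f t t0 ta => .memXm n f (LTerm.subst dbNs x u t) (LTerm.subst dbNs x u t0) (LTerm.subst dbNs x u ta)
  | .memXmc n f t t0 ta s =>
      .memXmc n f (LTerm.subst dbNs x u t) (LTerm.subst dbNs x u t0) (LTerm.subst dbNs x u ta) (LTerm.subst dbNs x u s)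
  | .memF n f t1 t2 t3 t4 t5 t6 t7 =>
      .memF n f (LTerm.subst dbNs x u t1) (LTerm.subst dbNs x u t2) (LTerm.subst dbNs x u t3)
        (LTerm.subst dbNs x u t4) (LTerm.subst dbNs x u t5) (LTerm.subst dbNs x u t6) (LTerm.subst dbNs x u t7)
  | .memG n f t1 t2 t3 t4 t5 t6 t7 =>
      .memG n f (LTerm.subst dbNs x u t1) (LTerm.subst dbNs x u t2) (LTerm.subst dbNs x u t3)
        (LTerm.subst dbNs x u t4) (LTerm.subst dbNs x u t5) (LTerm.subst dbNs x u t6) (LTerm.subst dbNs x u t7)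
  | .box n φ => .box n (φ.subst dbNs x u)
termination_by φ => sizeOf φ
end

/-- Substitution `φ[t/x]` for a database variable. -/
def Fml.substDb (x : ℕ) (u : LTerm σ) (φ : Fml σ) : Fml σ := φ.subst true x u
/-- Substitution `φ[t/x]` for an algorithmic variable. -/
def Fml.substA (x : ℕ) (u : LTerm σ) (φ : Fml σ) : Fml σ := φ.subst false x u
/-- The formula `conUSet(X)` expressing consistency of the update set
represented by the variable `X` (with name `n`). -/
noncomputable def conUSetF (n : ℕ) : Fml σ :=
  Fml.allFdyn fun f =>
    Fml.allA 0 (Fml.allA 1 (Fml.allA 2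
      (Fml.imp
        (Fml.and (Fml.memX n f (.avar 0) (.avar 1)) (Fml.memX n f (.avar 0) (.avar 2)))
        (Fml.eq (.avar 1) (.avar 2)))))

/-- The formula `con(r, X) ≡ upd(r, X) ∧ conUSet(X)`. -/
noncomputable def conF (r : Rule σ) (n : ℕ) : Fml σ := Fml.and (.upd r n) (conUSetF n)

/-- `wcon(r) ≡ ∃X con(r,X)`, with a chosen index for the bound variable. -/
noncomputable def wconN (n : ℕ) (r : Rule σ) : Fml σ := Fml.exX n (conF r n)

/-- Weak consistency `wcon(r)` of a rule. -/
noncomputable def wconF (r : Rule σ) : Fml σ := wconN 0 r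

/-- Strong consistency `scon(r)` of a rule. -/
noncomputable def sconF (r : Rule σ) : Fml σ := Fml.allX 0 (Fml.imp (.upd r 0) (conUSetF 0))

/-- The formula expressing that the update set `X` is empty. -/
noncomputable def emptyXF (n : ℕ) : Fml σ :=
  Fml.allFdyn fun f =>
    Fml.allA 0 (Fml.allA 1 (Fml.not (Fml.memX n f (.avar 0) (.avar 1))))

/-- The formula expressing that the update multiset `Ẍ` is empty. -/
noncomputable def emptyXmF (n : ℕ) : Fml σ :=
  Fml.allFdyn fun f =>
    Fml.allA 0 (Fml.allA 1 (Fml.allA 2 (Fml.not (Fml.memXm n f (.avar 0) (.avar 1) (.avar 2)))))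

/-- The formula expressing that the update set `X` (name `xn`) is the
projection of the update multiset `Ẍ` (name `xmn`). -/
noncomputable def projEq (xn xmn : ℕ) : Fml σ :=
  Fml.allFdyn fun f =>
    Fml.allA 0 (Fml.allA 1
      (Fml.iff (Fml.memX xn f (.avar 0) (.avar 1))
        (Fml.exA 2 (Fml.memXm xmn f (.avar 0) (.avar 1) (.avar 2)))))

/-- `joinable(r₁, r₂)`. -/
noncomputable def joinableF (r₁ r₂ : Rule σ) : Fml σ :=
  Fml.exX 0 (Fml.exX 1 (Fml.and (Fml.and (.upd r₁ 0) (.upd r₂ 1))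
    (Fml.allFdyn fun f =>
      Fml.allA 0 (Fml.allA 1 (Fml.allA 2
        (Fml.imp
          (Fml.and (Fml.memX 0 f (.avar 0) (.avar 1)) (Fml.memX 1 f (.avar 0) (.avar 2)))
          (Fml.eq (.avar 1) (.avar 2))))))))

/-- "`F_f` is a bijection from `Ẍ|_f` to `𝒳̈|_f`" (used in Axiom UM3). -/
def bijF (nXm nXmc nF : ℕ) (f : σ.F) : Fml σ :=
  let X3 : ℕ → ℕ → ℕ → Fml σ := fun a b c =>
    Fml.memXm nXm f (.avar a) (.avar b) (.avar c)
  let Xc4 : ℕ → ℕ → ℕ → ℕ → Fml σ := fun a b c d =>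
    Fml.memXmc nXmc f (.avar a) (.avar b) (.avar c) (.avar d)
  let Ff : ℕ → ℕ → ℕ → ℕ → ℕ → ℕ → ℕ → Fml σ := fun a b c d e g h =>
    Fml.memF nF f (.avar a) (.avar b) (.avar c) (.avar d) (.avar e) (.avar g) (.avar h)
  Fml.allAs [0,1,2,3,4,5,6,7,8,9,10] (Fml.bigAnd [
    Fml.imp (Ff 0 1 2 3 4 5 6) (Fml.and (X3 0 1 2) (Xc4 3 4 5 6)),
    Fml.imp (Fml.and (Ff 0 1 2 3 4 5 6) (Ff 0 1 2 7 8 9 10))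
      (Fml.bigAnd [Fml.eq (.avar 3) (.avar 7), Fml.eq (.avar 4) (.avar 8),
        Fml.eq (.avar 5) (.avar 9), Fml.eq (.avar 6) (.avar 10)]),
    Fml.imp (X3 0 1 2) (Fml.exAs [3,4,5,6] (Ff 0 1 2 3 4 5 6)),
    Fml.imp (Fml.and (Ff 0 1 2 7 8 9 10) (Ff 3 4 5 7 8 9 10))
      (Fml.bigAnd [Fml.eq (.avar 0) (.avar 3), Fml.eq (.avar 1) (.avar 4),
        Fml.eq (.avar 2) (.avar 5)]),
    Fml.imp (Xc4 3 4 5 6) (Fml.exAs [0,1,2] (Ff 0 1 2 3 4 5 6))])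

/-- "`G_f` is a bijection from `Ẍ|_f` to `(Ẏ₁ ⊎ Ẏ₂)|_f`" (used in Axiom UM4). -/
def bijG (nXm nY1 nY2 nG : ℕ) (f : σ.F) : Fml σ :=
  let X3 : ℕ → ℕ → ℕ → Fml σ := fun a b c =>
    Fml.memXm nXm f (.avar a) (.avar b) (.avar c)
  let Y1 : ℕ → ℕ → ℕ → Fml σ := fun a b c =>
    Fml.memXm nY1 f (.avar a) (.avar b) (.avar c)
  let Y2 : ℕ → ℕ → ℕ → Fml σ := fun a b c =>
    Fml.memXm nY2 f (.avar a) (.avar b) (.avar c)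
  let Y : ℕ → ℕ → ℕ → Fml σ := fun a b c => Fml.or (Y1 a b c) (Y2 a b c)
  let Gf : ℕ → ℕ → ℕ → ℕ → ℕ → ℕ → ℕ → Fml σ := fun a b c d e g h =>
    Fml.memG nG f (.avar a) (.avar b) (.avar c) (.avar d) (.avar e) (.avar g) (.avar h)
  Fml.allAs [0,1,2,3,4,5,6,7,8,9,10] (Fml.bigAnd [
    Fml.imp (Gf 0 1 2 3 4 5 6) (Fml.and (X3 0 1 2) (Y 3 4 5)),
    Fml.imp (Fml.and (Gf 0 1 2 3 4 5 6) (Gf 0 1 2 7 8 9 10))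
      (Fml.bigAnd [Fml.eq (.avar 3) (.avar 7), Fml.eq (.avar 4) (.avar 8),
        Fml.eq (.avar 5) (.avar 9), Fml.eq (.avar 6) (.avar 10)]),
    Fml.imp (X3 0 1 2) (Fml.exAs [3,4,5,6] (Gf 0 1 2 3 4 5 6)),
    Fml.imp (Fml.and (Gf 0 1 2 7 8 9 10) (Gf 3 4 5 7 8 9 10))
      (Fml.bigAnd [Fml.eq (.avar 0) (.avar 3), Fml.eq (.avar 1) (.avar 4),
        Fml.eq (.avar 2) (.avar 5)]),
    Fml.imp (Y 3 4 5) (Fml.exAs [0,1,2,6] (Gf 0 1 2 3 4 5 6)),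
    Fml.imp (Fml.and (Y1 3 4 5) (Y2 3 4 5))
      (Fml.exAs [0,1,2,6,7,8,9,10] (Fml.bigAnd [
        Fml.not (Fml.bigAnd [Fml.eq (.avar 0) (.avar 7), Fml.eq (.avar 1) (.avar 8),
          Fml.eq (.avar 2) (.avar 9)]),
        Fml.not (Fml.eq (.avar 6) (.avar 10)),
        Gf 0 1 2 3 4 5 6, Gf 7 8 9 3 4 5 10]))])

/-- The right-hand sides of Axioms U1–U7 for the predicate `upd(r, X)`. -/
noncomputable def updAxRHS : Rule σ → ℕ → Fml σ
  | .assign f t s, n =>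
      let i := max t.bnd s.bnd
      Fml.and (Fml.memX n f t.toL s.toL)
        (Fml.and
          (Fml.allA i (Fml.allA (i+1)
            (Fml.imp (Fml.memX n f (.avar i) (.avar (i+1)))
              (Fml.and (Fml.eq (.avar i) t.toL) (Fml.eq (.avar (i+1)) s.toL)))))
          (Fml.allFdynNe f fun f' =>
            Fml.allA 0 (Fml.allA 1 (Fml.not (Fml.memX n f' (.avar 0) (.avar 1))))))
  | .cond φ r, n =>
      Fml.or (Fml.and φ.toF (.upd r n)) (Fml.and (Fml.not φ.toF) (emptyXF n))
  | .forall_ x φ r, n =>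
      let j := max (max φ.bnd r.bnd) (x+1)
      Fml.exXc 0 (Fml.and
        (Fml.allDb x (Fml.and
          (Fml.imp φ.toF (Fml.exX (n+1) (Fml.and (.upd r (n+1))
            (Fml.allFdyn fun f =>
              Fml.allDb j (Fml.allA (j+1)
                (Fml.iff (Fml.memX (n+1) f (.var j) (.avar (j+1)))
                  (Fml.memXc 0 f (.var j) (.avar (j+1)) (.var x))))))))
          (Fml.imp (Fml.not φ.toF)
            (Fml.allFdyn fun f =>
              Fml.allDb j (Fml.allA (j+1)
                (Fml.not (Fml.memXc 0 f (.var j) (.avar (j+1)) (.var x))))))))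
        (Fml.allFdyn fun f =>
          Fml.allDb j (Fml.allA (j+1)
            (Fml.iff (Fml.memX n f (.var j) (.avar (j+1)))
              (Fml.exDb (j+2) (Fml.memXc 0 f (.var j) (.avar (j+1)) (.var (j+2))))))))
  | .par r₁ r₂, n =>
      Fml.exX (n+1) (Fml.exX (n+2)
        (Fml.and (Fml.and (.upd r₁ (n+1)) (.upd r₂ (n+2)))
          (Fml.allFdyn fun f =>
            Fml.allDb 0 (Fml.allA 1
              (Fml.iff (Fml.memX n f (.var 0) (.avar 1))
                (Fml.or (Fml.memX (n+1) f (.var 0) (.avar 1))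
                  (Fml.memX (n+2) f (.var 0) (.avar 1))))))))
  | .choose x φ r, n => Fml.exDb x (Fml.and φ.toF (.upd r n))
  | .seq r₁ r₂, n =>
      Fml.or (Fml.and (.upd r₁ n) (Fml.not (conUSetF n)))
        (Fml.exX (n+1) (Fml.exX (n+2)
          (Fml.and
            (Fml.and (Fml.and (.upd r₁ (n+1)) (conUSetF (n+1)))
              (.box (n+1) (.upd r₂ (n+2))))
            (Fml.allFdyn fun f =>
              Fml.allDb 0 (Fml.allA 1
                (Fml.iff (Fml.memX n f (.var 0) (.avar 1))
                  (Fml.or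
                    (Fml.and (Fml.memX (n+1) f (.var 0) (.avar 1))
                      (Fml.allA 2 (Fml.not (Fml.memX (n+2) f (.var 0) (.avar 2)))))
                    (Fml.memX (n+2) f (.var 0) (.avar 1)))))))))
  | .letr f t ρ r, n =>
      let j := max t.bnd r.bnd
      Fml.exXm 0 (Fml.and (.upm r 0)
        (Fml.and
          (Fml.allDb j (Fml.allA (j+1)
            (Fml.iff (Fml.memX n f (.var j) (.avar (j+1)))
              (Fml.or
                (Fml.and (Fml.eq t.toL (.var j))
                  (Fml.eq (.avar (j+1))
                    (.rho ρ (j+2) (LTerm.var (j+2))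
                      (Fml.exA (j+3)
                        (Fml.memXm 0 f (.var j) (.var (j+2)) (.avar (j+3)))))))
                (Fml.and (Fml.not (Fml.eq t.toL (.var j)))
                  (Fml.exA (j+3) (Fml.memXm 0 f (.var j) (.avar (j+1)) (.avar (j+3)))))))))
          (Fml.allFdynNe f fun f' =>
            Fml.allDb j (Fml.allA (j+1)
              (Fml.iff (Fml.memX n f' (.var j) (.avar (j+1)))
                (Fml.exA (j+3) (Fml.memXm 0 f' (.var j) (.avar (j+1)) (.avar (j+3)))))))))

/-- The right-hand sides of Axioms UM1–UM7 for the predicate `upm(r, Ẍ)`. -/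
noncomputable def upmAxRHS : Rule σ → ℕ → Fml σ
  | .assign f t s, n =>
      let i := max t.bnd s.bnd
      Fml.and
        (Fml.exA i (Fml.and (Fml.memXm n f t.toL s.toL (.avar i))
          (Fml.allDb (i+1) (Fml.allA (i+2) (Fml.allA (i+3)
            (Fml.imp (Fml.memXm n f (.var (i+1)) (.avar (i+2)) (.avar (i+3)))
              (Fml.bigAnd [Fml.eq (.var (i+1)) t.toL, Fml.eq (.avar (i+2)) s.toL,
                Fml.eq (.avar i) (.avar (i+3))])))))))
        (Fml.allFdynNe f fun f' =>
          Fml.allA 0 (Fml.allA 1 (Fml.allA 2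
            (Fml.not (Fml.memXm n f' (.avar 0) (.avar 1) (.avar 2))))))
  | .cond φ r, n =>
      Fml.or (Fml.and φ.toF (.upm r n)) (Fml.and (Fml.not φ.toF) (emptyXmF n))
  | .forall_ x φ r, n =>
      let j := max (max φ.bnd r.bnd) (x+1)
      Fml.exXmc 0 (Fml.and
        (Fml.allDb x (Fml.and
          (Fml.imp φ.toF (Fml.exXm (n+1) (Fml.and (.upm r (n+1))
            (Fml.allFdyn fun f =>
              Fml.allAs [j, j+1, j+2]
                (Fml.iff (Fml.memXm (n+1) f (.avar j) (.avar (j+1)) (.avar (j+2)))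
                  (Fml.memXmc 0 f (.avar j) (.avar (j+1)) (.avar (j+2)) (.var x)))))))
          (Fml.imp (Fml.not φ.toF)
            (Fml.allFdyn fun f =>
              Fml.allAs [j, j+1, j+2]
                (Fml.not (Fml.memXmc 0 f (.avar j) (.avar (j+1)) (.avar (j+2)) (.var x)))))))
        (Fml.allFdyn fun f =>
          Fml.exF 0 (Fml.and (bijF n 0 0 f)
            (Fml.allAs [0,1,2]
              (Fml.iff (Fml.memXm n f (.avar 0) (.avar 1) (.avar 2))
                (Fml.exAs [3,4]
                  (Fml.memF 0 f (.avar 0) (.avar 1) (.avar 2) (.avar 0) (.avar 1)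
                    (.avar 3) (.avar 4))))))))
  | .par r₁ r₂, n =>
      Fml.exXm (n+1) (Fml.exXm (n+2)
        (Fml.and (Fml.and (.upm r₁ (n+1)) (.upm r₂ (n+2)))
          (Fml.allFdyn fun f =>
            Fml.exG 0 (Fml.and (bijG n (n+1) (n+2) 0 f)
              (Fml.allAs [0,1,2]
                (Fml.iff (Fml.memXm n f (.avar 0) (.avar 1) (.avar 2))
                  (Fml.exAs [3,4]
                    (Fml.memG 0 f (.avar 0) (.avar 1) (.avar 2) (.avar 0) (.avar 1)
                      (.avar 3) (.avar 4)))))))))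
  | .choose x φ r, n => Fml.exDb x (Fml.and φ.toF (.upm r n))
  | .seq r₁ r₂, n =>
      Fml.or
        (Fml.and (.upm r₁ n)
          (Fml.allX n (Fml.imp (projEq n n) (Fml.not (conUSetF n)))))
        (Fml.exXm (n+1) (Fml.exXm (n+2)
          (Fml.and
            (Fml.and (.upm r₁ (n+1))
              (Fml.allX n (Fml.imp (projEq n (n+1))
                (Fml.and (conUSetF n) (.box n (.upm r₂ (n+2)))))))
            (Fml.allFdyn fun f =>
              Fml.allAs [0,1,2]
                (Fml.iff (Fml.memXm n f (.avar 0) (.avar 1) (.avar 2))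
                  (Fml.or (Fml.memXm (n+2) f (.avar 0) (.avar 1) (.avar 2))
                    (Fml.and (Fml.memXm (n+1) f (.avar 0) (.avar 1) (.avar 2))
                      (Fml.allAs [3,4]
                        (Fml.not (Fml.memXm (n+2) f (.avar 0) (.avar 3) (.avar 4)))))))))))
  | .letr f t ρ r, n =>
      let j := max t.bnd r.bnd
      Fml.exXm (n+1) (Fml.exA j (Fml.and (.upm r (n+1))
        (Fml.and
          (Fml.allAs [j+1, j+2, j+3]
            (Fml.iff (Fml.memXm n f (.avar (j+1)) (.avar (j+2)) (.avar (j+3)))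
              (Fml.or
                (Fml.and (Fml.not (Fml.eq t.toL (.avar (j+1))))
                  (Fml.memXm (n+1) f (.avar (j+1)) (.avar (j+2)) (.avar (j+3))))
                (Fml.and (Fml.eq t.toL (.avar (j+1)))
                  (Fml.and
                    (Fml.eq (.avar (j+2))
                      (.rho ρ (j+4) (LTerm.var (j+4))
                        (Fml.exA (j+5)
                          (Fml.memXm (n+1) f (.avar (j+1)) (.var (j+4)) (.avar (j+5))))))
                    (Fml.eq (.avar (j+3)) (.avar j)))))))
          (Fml.allFdynNe f fun f' =>
            Fml.allAs [j+1, j+2, j+3]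
              (Fml.iff (Fml.memXm n f' (.avar (j+1)) (.avar (j+2)) (.avar (j+3)))
                (Fml.memXm (n+1) f' (.avar (j+1)) (.avar (j+2)) (.avar (j+3))))))))

/-- `[r]φ ≡ ∀X(upd(r, X) → [X]φ)`, with a chosen name `n` for the bound
variable `X` (to be chosen not free in `φ`). -/
def boxR (r : Rule σ) (n : ℕ) (φ : Fml σ) : Fml σ :=
  Fml.allX n (Fml.imp (.upd r n) (.box n φ))

/-- `⟨r⟩φ ≡ ∃X(upd(r, X) ∧ [X]φ)`. -/
def diaR (r : Rule σ) (n : ℕ) (φ : Fml σ) : Fml σ :=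
  Fml.exX n (Fml.and (.upd r n) (.box n φ))

/-- A state models a formula: the formula is true under every first-order
variable assignment and every (finite) second-order variable assignment. -/
def Satisfies (I : Interp σ B) (φ : Fml σ) : Prop :=
  ∀ (ζ : Asg B) (Ξ : SOAsg σ B), Ξ.Fin → fval I ζ Ξ φ

/-- Logical consequence `Φ ⊨ φ`. -/
def Conseq (Φ : Set (Fml σ)) (φ : Fml σ) : Prop :=
  ∀ (B : Type) (I : Interp σ B), (∀ ψ ∈ Φ, Satisfies I ψ) → Satisfies I φ

/-- Logical equivalence of formulae: same truth value in every state under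
every variable assignment. -/
def FmlEquiv (φ ψ : Fml σ) : Prop :=
  ∀ (B : Type) (I : Interp σ B) (ζ : Asg B) (Ξ : SOAsg σ B), Ξ.Fin →
    (fval I ζ Ξ φ ↔ fval I ζ Ξ ψ)

/-- Equivalence of DB-ASM rules: `S ⊨ ∀X(upd(r₁,X) ↔ upd(r₂,X))` for every
state `S`. -/
def RuleEquiv (r₁ r₂ : Rule σ) : Prop :=
  ∀ (B : Type) (I : Interp σ B),
    Satisfies I (Fml.allX 0 (Fml.iff (.upd r₁ 0) (.upd r₂ 0)))

/-- A rule is defined if it yields at least one update set in every state. -/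
def RuleDefined (r : Rule σ) : Prop :=
  ∀ (B : Type) (I : Interp σ B) (ζ : Asg B), (updSets r I ζ).Nonempty

/-- A rule is deterministic if it yields exactly one update set in every
state under every variable assignment. -/
def RuleDeterministic (r : Rule σ) : Prop :=
  ∀ (B : Type) (I : Interp σ B) (ζ : Asg B), ∃! Δ, Δ ∈ updSets r I ζ
/-- The proof system 𝔑 of the logic for DB-ASMs: Axioms U1–U7 for
`upd(r, X)`, Axioms UM1–UM7 for `upm(r, Ẍ)`, the modal axioms and rules
M1–M8, Axioms A1–A3, the classical axiom schemes P1–P3 with modus ponens,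
the quantifier rules UI, EG, UG, EI, the equality axioms EQ1–EQ3, the
dynamic-logic axiom DY1 and the extensionality axiom E.
`Deriv Φ φ` expresses derivability `Φ ⊢ φ`. -/
inductive Deriv (Φ : Set (Fml σ)) : Fml σ → Prop where
  | hyp {φ : Fml σ} : φ ∈ Φ → Deriv Φ φ
  -- Axioms U1–U7
  | updAx (r : Rule σ) (n : ℕ) : Deriv Φ (Fml.iff (.upd r n) (updAxRHS r n))
  -- Axioms UM1–UM7
  | upmAx (r : Rule σ) (n : ℕ) : Deriv Φ (Fml.iff (.upm r n) (upmAxRHS r n))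
  -- M1 (Distribution Axiom of K)
  | m1 (n : ℕ) (φ ψ : Fml σ) :
      Deriv Φ (Fml.imp (.box n (Fml.imp φ ψ)) (Fml.imp (.box n φ) (.box n ψ)))
  -- M2 (Necessitation)
  | m2 (n : ℕ) {φ : Fml σ} : Deriv Φ φ → Deriv Φ (.box n φ)
  -- M3 (Modus Ponens)
  | m3 {φ ψ : Fml σ} : Deriv Φ φ → Deriv Φ (Fml.imp φ ψ) → Deriv Φ ψ
  -- M4
  | m4 (n : ℕ) (φ : Fml σ) : Deriv Φ (Fml.imp (Fml.not (conUSetF n)) (.box n φ))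
  -- M5
  | m5 (n : ℕ) (φ : Fml σ) : Deriv Φ (Fml.imp (Fml.not (.box n φ)) (.box n (Fml.not φ)))
  -- M6 (Barcan axioms, for first- and second-order quantifiers)
  | m6db (n x : ℕ) (φ : Fml σ) :
      Deriv Φ (Fml.imp (.allDb x (.box n φ)) (.box n (.allDb x φ)))
  | m6a (n x : ℕ) (φ : Fml σ) :
      Deriv Φ (Fml.imp (.allA x (.box n φ)) (.box n (.allA x φ)))
  | m6m (n k : ℕ) (φ : Fml σ) :
      Deriv Φ (Fml.imp (.allM k (.box n φ)) (.box n (.allM k φ)))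
  | m6x (n k : ℕ) (φ : Fml σ) : k ≠ n →
      Deriv Φ (Fml.imp (.allX k (.box n φ)) (.box n (.allX k φ)))
  | m6xc (n k : ℕ) (φ : Fml σ) :
      Deriv Φ (Fml.imp (.allXc k (.box n φ)) (.box n (.allXc k φ)))
  | m6xm (n k : ℕ) (φ : Fml σ) :
      Deriv Φ (Fml.imp (.allXm k (.box n φ)) (.box n (.allXm k φ)))
  | m6xmc (n k : ℕ) (φ : Fml σ) :
      Deriv Φ (Fml.imp (.allXmc k (.box n φ)) (.box n (.allXmc k φ)))
  | m6f (n k : ℕ) (φ : Fml σ) :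
      Deriv Φ (Fml.imp (.allF k (.box n φ)) (.box n (.allF k φ)))
  | m6g (n k : ℕ) (φ : Fml σ) :
      Deriv Φ (Fml.imp (.allG k (.box n φ)) (.box n (.allG k φ)))
  -- M7 and M8 (static and pure formulae)
  | m7 (r : Rule σ) (n : ℕ) {φ : Fml σ} : φ.isStatic → φ.isPure →
      Deriv Φ (Fml.imp (Fml.and (conF r n) φ) (.box n φ))
  | m8 (r : Rule σ) (n : ℕ) {φ : Fml σ} : φ.isStatic → φ.isPure →
      Deriv Φ (Fml.imp (Fml.and (conF r n) (.box n φ)) φ)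
  -- A1, A2, A3
  | a1 (n : ℕ) (f : σ.F) (x y : ℕ) :
      Deriv Φ (Fml.imp
        (Fml.and (conUSetF n)
          (Fml.and
            (Fml.allA (max x y + 1)
              (Fml.not (Fml.memX n f (.avar x) (.avar (max x y + 1)))))
            (Fml.eq (.dyn f (.avar x)) (.avar y))))
        (.box n (Fml.eq (.dyn f (.avar x)) (.avar y))))
  | a2 (n : ℕ) (f : σ.F) (x y : ℕ) :
      Deriv Φ (Fml.imp (Fml.and (conUSetF n) (Fml.memX n f (.avar x) (.avar y)))
        (.box n (Fml.eq (.dyn f (.avar x)) (.avar y))))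
  | a3 (r : Rule σ) (m n : ℕ) :
      Deriv Φ (Fml.imp (.upm r m) (Fml.exX n (.upd r n)))
  -- P1–P3
  | p1 (φ ψ : Fml σ) : Deriv Φ (Fml.imp φ (Fml.imp ψ φ))
  | p2 (φ ψ χ : Fml σ) :
      Deriv Φ (Fml.imp (Fml.imp φ (Fml.imp ψ χ))
        (Fml.imp (Fml.imp φ ψ) (Fml.imp φ χ)))
  | p3 (φ ψ : Fml σ) :
      Deriv Φ (Fml.imp (Fml.imp (Fml.not φ) (Fml.not ψ)) (Fml.imp ψ φ))
  -- UI (Universal Instantiation)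
  | uiDb {φ : Fml σ} (x : ℕ) (t : LTerm σ) : (φ.isPure ∨ t.isStatic) →
      Deriv Φ (.allDb x φ) → Deriv Φ (φ.substDb x t)
  | uiA {φ : Fml σ} (x : ℕ) (t : LTerm σ) : (φ.isPure ∨ t.isStatic) →
      Deriv Φ (.allA x φ) → Deriv Φ (φ.substA x t)
  -- EG (Existential Generalisation)
  | egDb {φ : Fml σ} (x : ℕ) (t : LTerm σ) : (φ.isPure ∨ t.isStatic) →
      Deriv Φ (φ.substDb x t) → Deriv Φ (Fml.exDb x φ)
  | egA {φ : Fml σ} (x : ℕ) (t : LTerm σ) : (φ.isPure ∨ t.isStatic) →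
      Deriv Φ (φ.substA x t) → Deriv Φ (Fml.exA x φ)
  -- UG (Universal Generalisation, an ω-rule over static terms)
  | ugDb {φ : Fml σ} (x : ℕ) :
      (∀ t : LTerm σ, t.isStatic → Deriv Φ (φ.substDb x t)) →
      Deriv Φ (.allDb x φ)
  | ugA {φ : Fml σ} (x : ℕ) :
      (∀ t : LTerm σ, t.isStatic → Deriv Φ (φ.substA x t)) →
      Deriv Φ (.allA x φ)
  -- EI (Existential Instantiation: `t` represents a valuation for `x`
  -- satisfying `φ`)
  | eiDb {φ : Fml σ} (x : ℕ) (t : LTerm σ) : (φ.isPure ∨ t.isStatic) →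
      (∀ (B : Type) (I : Interp σ B) (ζ : Asg B) (Ξ : SOAsg σ B), Ξ.Fin →
        (∀ ψ ∈ Φ, fval I ζ Ξ ψ) → fval I ζ Ξ (Fml.exDb x φ) →
        fval I ζ Ξ (φ.substDb x t)) →
      Deriv Φ (Fml.exDb x φ) → Deriv Φ (φ.substDb x t)
  | eiA {φ : Fml σ} (x : ℕ) (t : LTerm σ) : (φ.isPure ∨ t.isStatic) →
      (∀ (B : Type) (I : Interp σ B) (ζ : Asg B) (Ξ : SOAsg σ B), Ξ.Fin →
        (∀ ψ ∈ Φ, fval I ζ Ξ ψ) → fval I ζ Ξ (Fml.exA x φ) →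
        fval I ζ Ξ (φ.substA x t)) →
      Deriv Φ (Fml.exA x φ) → Deriv Φ (φ.substA x t)
  -- EQ1–EQ3 (equality axioms, restricted to static terms)
  | eqRefl (t : LTerm σ) : t.isStatic → Deriv Φ (.eq t t)
  | eqFunD (f : σ.F) (t₁ t₂ : LTerm σ) : t₁.isStatic → t₂.isStatic →
      Deriv Φ (Fml.imp (.eq t₁ t₂) (.eq (.dyn f t₁) (.dyn f t₂)))
  | eqFunS (g : σ.Stat) (t₁ t₂ : LTerm σ) : t₁.isStatic → t₂.isStatic →
      Deriv Φ (Fml.imp (.eq t₁ t₂) (.eq (.stat g t₁) (.stat g t₂)))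
  | eqRho (ρ : σ.Rho) (x : ℕ) (t₁ t₂ : LTerm σ) (φ₁ φ₂ : Fml σ) :
      t₁.isStatic → t₂.isStatic → φ₁.isPure → φ₂.isPure →
      Deriv Φ (Fml.imp (Fml.and (.eq t₁ t₂) (Fml.iff φ₁ φ₂))
        (.eq (.rho ρ x t₁ φ₁) (.rho ρ x t₂ φ₂)))
  -- DY1 (dynamic-logic axiom for sequence rules)
  | dy1 (r₁ r₂ : Rule σ) (φ : Fml σ) (n n₁ n₂ : ℕ) :
      n ∉ φ.freeX → n₁ ∉ φ.freeX → n₂ ∉ φ.freeX → n₁ ≠ n₂ →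
      Deriv Φ (Fml.iff
        (Fml.exX n (Fml.and (.upd (.seq r₁ r₂) n) (.box n φ)))
        (Fml.exX n₁ (Fml.and (.upd r₁ n₁)
          (.box n₁ (Fml.exX n₂ (Fml.and (.upd r₂ n₂) (.box n₂ φ)))))))
  -- E (extensionality axiom)
  | ext (r₁ r₂ : Rule σ) (φ : Fml σ) (n₁ n₂ : ℕ) :
      n₁ ≠ n₂ → n₁ ∉ φ.freeX → n₂ ∉ φ.freeX → RuleEquiv r₁ r₂ →
      Deriv Φ (Fml.exX n₁ (Fml.exX n₂ (Fml.iff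
        (Fml.and (.upd r₁ n₁) (.box n₁ φ))
        (Fml.and (.upd r₂ n₂) (.box n₂ φ)))))
section Semantics

variable (I : Interp σ B) (ζ : Asg B) (Ξ : SOAsg σ B)

@[simp] theorem Asg.updA_av (k j : ℕ) (a : B) :
    (ζ.updA k a).av j = if j = k then a else ζ.av j := by
  simp [Asg.updA, Function.update_apply]

@[simp] theorem Asg.updA_dbv (k : ℕ) (a : B) : (ζ.updA k a).dbv = ζ.dbv := rfl

@[simp] theorem Asg.updDb_dbv (k j : ℕ) (a : B) :
    (ζ.updDb k a).dbv j = if j = k then a else ζ.dbv j := by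
  simp [Asg.updDb, Function.update_apply]

@[simp] theorem Asg.updDb_av (k : ℕ) (a : B) : (ζ.updDb k a).av = ζ.av := rfl

@[simp] theorem SOAsg.uM_m (k j : ℕ) (P : Set (B × B)) :
    (Ξ.uM k P).m j = if j = k then P else Ξ.m j := by
  simp [SOAsg.uM, Function.update_apply]

@[simp] theorem SOAsg.uM_x (k : ℕ) (P : Set (B × B)) : (Ξ.uM k P).x = Ξ.x := rfl
@[simp] theorem SOAsg.uM_xm (k : ℕ) (P : Set (B × B)) : (Ξ.uM k P).xm = Ξ.xm := rfl
@[simp] theorem SOAsg.uM_xmc (k : ℕ) (P : Set (B × B)) : (Ξ.uM k P).xmc = Ξ.xmc := rfl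

@[simp] theorem SOAsg.uX_x (k j : ℕ) (P : USet σ B) :
    (Ξ.uX k P).x j = if j = k then P else Ξ.x j := by
  simp [SOAsg.uX, Function.update_apply]

@[simp] theorem SOAsg.uX_m (k : ℕ) (P : USet σ B) : (Ξ.uX k P).m = Ξ.m := rfl
@[simp] theorem SOAsg.uX_xm (k : ℕ) (P : USet σ B) : (Ξ.uX k P).xm = Ξ.xm := rfl
@[simp] theorem SOAsg.uX_xmc (k : ℕ) (P : USet σ B) : (Ξ.uX k P).xmc = Ξ.xmc := rfl

@[simp] theorem SOAsg.uXm_xm (k j : ℕ) (P : Set (σ.F × B × B × B)) :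
    (Ξ.uXm k P).xm j = if j = k then P else Ξ.xm j := by
  simp [SOAsg.uXm, Function.update_apply]

@[simp] theorem SOAsg.uXm_m (k : ℕ) (P : Set (σ.F × B × B × B)) : (Ξ.uXm k P).m = Ξ.m := rfl
@[simp] theorem SOAsg.uXm_x (k : ℕ) (P : Set (σ.F × B × B × B)) : (Ξ.uXm k P).x = Ξ.x := rfl
@[simp] theorem SOAsg.uXm_xmc (k : ℕ) (P : Set (σ.F × B × B × B)) :
    (Ξ.uXm k P).xmc = Ξ.xmc := rfl

@[simp] theorem SOAsg.uXmc_xmc (k j : ℕ) (P : Set (σ.F × B × B × B × B)) :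
    (Ξ.uXmc k P).xmc j = if j = k then P else Ξ.xmc j := by
  simp [SOAsg.uXmc, Function.update_apply]

@[simp] theorem SOAsg.uXmc_m (k : ℕ) (P : Set (σ.F × B × B × B × B)) :
    (Ξ.uXmc k P).m = Ξ.m := rfl
@[simp] theorem SOAsg.uXmc_x (k : ℕ) (P : Set (σ.F × B × B × B × B)) :
    (Ξ.uXmc k P).x = Ξ.x := rfl
@[simp] theorem SOAsg.uXmc_xm (k : ℕ) (P : Set (σ.F × B × B × B × B)) :
    (Ξ.uXmc k P).xm = Ξ.xm := rfl

theorem SOAsg.Fin.uM {Ξ : SOAsg σ B} (h : Ξ.Fin) (n : ℕ) {P : Set (B × B)} (hP : P.Finite) :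
    (Ξ.uM n P).Fin := by
  refine ⟨fun j => ?_, h.2⟩
  rw [SOAsg.uM_m]; split_ifs <;> [exact hP; exact h.1 j]

theorem SOAsg.Fin.uX {Ξ : SOAsg σ B} (h : Ξ.Fin) (n : ℕ) {P : USet σ B} (hP : P.Finite) :
    (Ξ.uX n P).Fin := by
  refine ⟨h.1, fun j => ?_, h.2.2⟩
  rw [SOAsg.uX_x]; split_ifs <;> [exact hP; exact h.2.1 j]

theorem SOAsg.Fin.uXc {Ξ : SOAsg σ B} (h : Ξ.Fin) (n : ℕ) {P : Set (σ.F × B × B × B)}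
    (hP : P.Finite) : (Ξ.uXc n P).Fin := by
  refine ⟨h.1, h.2.1, fun j => ?_, h.2.2.2⟩
  simp only [SOAsg.uXc, Function.update_apply]
  split_ifs <;> [exact hP; exact h.2.2.1 j]

theorem SOAsg.Fin.uXm {Ξ : SOAsg σ B} (h : Ξ.Fin) (n : ℕ) {P : Set (σ.F × B × B × B)}
    (hP : P.Finite) : (Ξ.uXm n P).Fin := by
  refine ⟨h.1, h.2.1, h.2.2.1, fun j => ?_, h.2.2.2.2⟩
  rw [SOAsg.uXm_xm]; split_ifs <;> [exact hP; exact h.2.2.2.1 j]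

theorem SOAsg.Fin.uXmc {Ξ : SOAsg σ B} (h : Ξ.Fin) (n : ℕ) {P : Set (σ.F × B × B × B × B)}
    (hP : P.Finite) : (Ξ.uXmc n P).Fin := by
  refine ⟨h.1, h.2.1, h.2.2.1, h.2.2.2.1, fun j => ?_, h.2.2.2.2.2⟩
  rw [SOAsg.uXmc_xmc]; split_ifs <;> [exact hP; exact h.2.2.2.2.1 j]

theorem SOAsg.Fin.uF {Ξ : SOAsg σ B} (h : Ξ.Fin) (n : ℕ)
    {P : Set (σ.F × B × B × B × B × B × B × B)} (hP : P.Finite) : (Ξ.uF n P).Fin := by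
  refine ⟨h.1, h.2.1, h.2.2.1, h.2.2.2.1, h.2.2.2.2.1, fun j => ?_, h.2.2.2.2.2.2⟩
  simp only [SOAsg.uF, Function.update_apply]
  split_ifs <;> [exact hP; exact h.2.2.2.2.2.1 j]

theorem SOAsg.Fin.uG {Ξ : SOAsg σ B} (h : Ξ.Fin) (n : ℕ)
    {P : Set (σ.F × B × B × B × B × B × B × B)} (hP : P.Finite) : (Ξ.uG n P).Fin := by
  refine ⟨h.1, h.2.1, h.2.2.1, h.2.2.2.1, h.2.2.2.2.1, h.2.2.2.2.2.1, fun j => ?_⟩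
  simp only [SOAsg.uG, Function.update_apply]
  split_ifs <;> [exact hP; exact h.2.2.2.2.2.2 j]

@[simp] theorem fval_imp (φ ψ : Fml σ) :
    fval I ζ Ξ (.imp φ ψ) ↔ (fval I ζ Ξ φ → fval I ζ Ξ ψ) := by
  simp [Fml.imp, fval]

@[simp] theorem fval_or (φ ψ : Fml σ) :
    fval I ζ Ξ (.or φ ψ) ↔ (fval I ζ Ξ φ ∨ fval I ζ Ξ ψ) := by
  simp only [Fml.or, fval]; tauto

@[simp] theorem fval_iff (φ ψ : Fml σ) :
    fval I ζ Ξ (.iff φ ψ) ↔ (fval I ζ Ξ φ ↔ fval I ζ Ξ ψ) := by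
  simp only [Fml.iff, fval, fval_imp]; tauto

@[simp] theorem fval_exDb (x : ℕ) (φ : Fml σ) :
    fval I ζ Ξ (.exDb x φ) ↔ ∃ a ∈ I.db, fval I (ζ.updDb x a) Ξ φ := by
  simp [Fml.exDb, fval]

@[simp] theorem fval_exA (x : ℕ) (φ : Fml σ) :
    fval I ζ Ξ (.exA x φ) ↔ ∃ a, fval I (ζ.updA x a) Ξ φ := by
  simp [Fml.exA, fval]

@[simp] theorem fval_exM (n : ℕ) (φ : Fml σ) :
    fval I ζ Ξ (.exM n φ) ↔ ∃ P : Set (B × B), P.Finite ∧ fval I ζ (Ξ.uM n P) φ := by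
  simp [Fml.exM, fval]

@[simp] theorem fval_exX (n : ℕ) (φ : Fml σ) :
    fval I ζ Ξ (.exX n φ) ↔ ∃ P : USet σ B, P.Finite ∧ fval I ζ (Ξ.uX n P) φ := by
  simp [Fml.exX, fval]

@[simp] theorem fval_exXm (n : ℕ) (φ : Fml σ) :
    fval I ζ Ξ (.exXm n φ) ↔
      ∃ P : Set (σ.F × B × B × B), P.Finite ∧ fval I ζ (Ξ.uXm n P) φ := by
  simp [Fml.exXm, fval]

@[simp] theorem fval_exXmc (n : ℕ) (φ : Fml σ) :
    fval I ζ Ξ (.exXmc n φ) ↔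
      ∃ P : Set (σ.F × B × B × B × B), P.Finite ∧ fval I ζ (Ξ.uXmc n P) φ := by
  simp [Fml.exXmc, fval]

@[simp] theorem fval_tt : fval I ζ Ξ (.tt) ↔ True := by simp [Fml.tt, fval]

@[simp] theorem fval_bigAnd (l : List (Fml σ)) :
    fval I ζ Ξ (.bigAnd l) ↔ ∀ φ ∈ l, fval I ζ Ξ φ := by
  induction l using Fml.bigAnd.induct <;> simp_all [Fml.bigAnd, fval]

@[simp] theorem fval_allFdyn (k : σ.F → Fml σ) :
    fval I ζ Ξ (.allFdyn k) ↔ ∀ f, fval I ζ Ξ (k f) := by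
  simp [Fml.allFdyn]

theorem lval_toL (t : PTerm σ) : lval I ζ Ξ t.toL = t.val I ζ := by
  induction t <;> simp_all [PTerm.toL, lval, PTerm.val]

@[simp] theorem fval_toF (φ : PFml σ) : fval I ζ Ξ φ.toF ↔ φ.val I ζ := by
  induction φ generalizing ζ <;> simp_all [PFml.toF, fval, PFml.val, lval_toL]

@[simp] theorem fval_conUSetF (n : ℕ) :
    fval I ζ Ξ (conUSetF n) ↔ consistentU (Ξ.x n) := by
  simp [conUSetF, fval, lval, consistentU]

@[simp] theorem fval_projEq (n k : ℕ) :
    fval I ζ Ξ (projEq n k) ↔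
      ∀ f a b, ((f, a, b) ∈ Ξ.x n ↔ ∃ p, (f, a, b, p) ∈ Ξ.xm k) := by
  simp [projEq, fval, lval]

end Semantics

section NoUpd

variable (b : Bool)

@[simp] theorem hasR_imp (φ ψ : Fml σ) : (Fml.imp φ ψ).hasR b ↔ φ.hasR b ∨ ψ.hasR b := by
  simp [Fml.imp, Fml.hasR]

@[simp] theorem hasR_or (φ ψ : Fml σ) : (Fml.or φ ψ).hasR b ↔ φ.hasR b ∨ ψ.hasR b := by
  simp [Fml.or, Fml.hasR]

@[simp] theorem hasR_iff (φ ψ : Fml σ) : (Fml.iff φ ψ).hasR b ↔ φ.hasR b ∨ ψ.hasR b := by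
  simp only [Fml.iff, Fml.hasR, hasR_imp]; tauto

@[simp] theorem hasR_exDb (x : ℕ) (φ : Fml σ) : (Fml.exDb x φ).hasR b ↔ φ.hasR b := by
  simp [Fml.exDb, Fml.hasR]

@[simp] theorem hasR_exA (x : ℕ) (φ : Fml σ) : (Fml.exA x φ).hasR b ↔ φ.hasR b := by
  simp [Fml.exA, Fml.hasR]

@[simp] theorem hasR_exM (x : ℕ) (φ : Fml σ) : (Fml.exM x φ).hasR b ↔ φ.hasR b := by
  simp [Fml.exM, Fml.hasR]

@[simp] theorem hasR_exX (x : ℕ) (φ : Fml σ) : (Fml.exX x φ).hasR b ↔ φ.hasR b := by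
  simp [Fml.exX, Fml.hasR]

@[simp] theorem hasR_exXm (x : ℕ) (φ : Fml σ) : (Fml.exXm x φ).hasR b ↔ φ.hasR b := by
  simp [Fml.exXm, Fml.hasR]

@[simp] theorem hasR_exXmc (x : ℕ) (φ : Fml σ) : (Fml.exXmc x φ).hasR b ↔ φ.hasR b := by
  simp [Fml.exXmc, Fml.hasR]

@[simp] theorem hasR_tt : ¬ (Fml.tt : Fml σ).hasR b := by
  simp [Fml.tt, Fml.hasR, LTerm.hasR]

@[simp] theorem hasR_bigAnd (l : List (Fml σ)) :
    (Fml.bigAnd l).hasR b ↔ ∃ φ ∈ l, φ.hasR b := by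
  induction l using Fml.bigAnd.induct <;> simp_all [Fml.bigAnd, Fml.hasR]

@[simp] theorem hasR_allFdyn (k : σ.F → Fml σ) :
    (Fml.allFdyn k).hasR b ↔ ∃ f, (k f).hasR b := by
  simp [Fml.allFdyn]

@[simp] theorem hasR_toL (t : PTerm σ) : ¬ t.toL.hasR b := by
  induction t <;> simp_all [PTerm.toL, LTerm.hasR]

@[simp] theorem hasR_toF (φ : PFml σ) : ¬ φ.toF.hasR b := by
  induction φ <;> simp_all [PFml.toF, Fml.hasR]

@[simp] theorem hasR_conUSetF (n : ℕ) : ¬ (conUSetF n : Fml σ).hasR b := by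
  simp [conUSetF, Fml.hasR, LTerm.hasR]

@[simp] theorem hasR_projEq (n k : ℕ) : ¬ (projEq n k : Fml σ).hasR b := by
  simp [projEq, Fml.hasR, LTerm.hasR]

end NoUpd

/-- The disjunction of a list of formulae. -/
def Fml.bigOr (l : List (Fml σ)) : Fml σ := .not (.bigAnd (l.map .not))

@[simp] theorem fval_bigOr (I : Interp σ B) (ζ : Asg B) (Ξ : SOAsg σ B) (l : List (Fml σ)) :
    fval I ζ Ξ (.bigOr l) ↔ ∃ φ ∈ l, fval I ζ Ξ φ := by
  simp [Fml.bigOr, fval]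

@[simp] theorem hasR_bigOr (b : Bool) (l : List (Fml σ)) :
    (Fml.bigOr l).hasR b ↔ ∃ φ ∈ l, φ.hasR b := by
  simp [Fml.bigOr, Fml.hasR]

/-- The update sets yielded by a rule are the supports of the update multisets it yields. -/
theorem mem_updSets_iff (r : Rule σ) (I : Interp σ B) (ζ : Asg B) (Δ : USet σ B) :
    Δ ∈ updSets r I ζ ↔ ∃ D ∈ updMuls r I ζ, mulToSet D = Δ := by
  classical
  induction r generalizing I ζ Δ with
  | assign f t s =>
    have : mulToSet (fun u : Upd σ B => if u = (f, t.val I ζ, s.val I ζ) then 1 else 0) =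
        {(f, t.val I ζ, s.val I ζ)} := by
      ext u; simp [mulToSet]
    simp [updSets, updMuls, this, eq_comm]
  | cond φ r ih =>
    simp only [updSets, updMuls]
    split_ifs
    · exact ih I ζ Δ
    · simp [mulToSet, eq_comm]
  | forall_ x φ r ih =>
    simp only [updSets, updMuls, Set.mem_ofPred_eq]
    constructor
    · rintro ⟨g, hg, rfl⟩
      have key : ∀ a, ∃ D : UMul σ B, (a ∈ I.db ∧ φ.val I (ζ.updDb x a) →
          D ∈ updMuls r I (ζ.updDb x a) ∧ mulToSet D = g a) ∧
          (¬ (a ∈ I.db ∧ φ.val I (ζ.updDb x a)) → D = fun _ => 0) := by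
        intro a
        by_cases h : a ∈ I.db ∧ φ.val I (ζ.updDb x a)
        · obtain ⟨D, hD⟩ := (ih I _ _).1 (hg a h.1 h.2)
          exact ⟨D, fun _ => hD, fun h' => absurd h h'⟩
        · exact ⟨fun _ => 0, fun h' => absurd h' h, fun _ => rfl⟩
      choose G hG hG0 using key
      refine ⟨_, ⟨G, fun a ha hφ => (hG a ⟨ha, hφ⟩).1, hG0, rfl⟩, ?_⟩
      ext u
      simp only [mulToSet, Set.mem_ofPred_eq, ne_eq, Finset.sum_eq_zero_iff,
        Set.Finite.mem_toFinset,
        not_forall, Set.mem_iUnion, exists_prop]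
      constructor
      · rintro ⟨a, ha, hu⟩
        by_cases h : φ.val I (ζ.updDb x a)
        · exact ⟨a, ⟨ha, h⟩, (hG a ⟨ha, h⟩).2 ▸ hu⟩
        · rw [hG0 a (fun h' => h h'.2)] at hu; simp at hu
      · rintro ⟨a, ha, hu⟩
        exact ⟨a, ha.1, by rw [← (hG a ha).2] at hu; exact hu⟩
    · rintro ⟨_, ⟨G, hG, hG0, rfl⟩, rfl⟩
      refine ⟨fun a => mulToSet (G a), fun a ha hφ => (ih I _ _).2 ⟨_, hG a ha hφ, rfl⟩, ?_⟩
      ext u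
      simp only [mulToSet, Set.mem_ofPred_eq, ne_eq, Finset.sum_eq_zero_iff,
        Set.Finite.mem_toFinset,
        not_forall, Set.mem_iUnion, exists_prop]
      constructor
      · rintro ⟨a, ha, hu⟩
        by_cases h : φ.val I (ζ.updDb x a)
        · exact ⟨a, ⟨ha, h⟩, hu⟩
        · rw [hG0 a (fun h' => h h'.2)] at hu; simp at hu
      · rintro ⟨a, ha, hu⟩
        exact ⟨a, ha.1, hu⟩
  | choose x φ r ih =>
    simp only [updSets, updMuls, Set.mem_ofPred_eq, ih]
    constructor
    · rintro ⟨a, ha, hφ, D, hD, h⟩; exact ⟨D, ⟨a, ha, hφ, hD⟩, h⟩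
    · rintro ⟨D, ⟨a, ha, hφ, hD⟩, h⟩; exact ⟨a, ha, hφ, D, hD, h⟩
  | par r₁ r₂ ih₁ ih₂ =>
    have key : ∀ D₁ D₂ : UMul σ B,
        mulToSet (fun u => D₁ u + D₂ u) = mulToSet D₁ ∪ mulToSet D₂ := by
      intro D₁ D₂; ext u; simp only [mulToSet, Set.mem_ofPred_eq, Set.mem_union]; omega
    simp only [updSets, updMuls, Set.mem_ofPred_eq, ih₁, ih₂]
    constructor
    · rintro ⟨_, ⟨D₁, h₁, rfl⟩, _, ⟨D₂, h₂, rfl⟩, rfl⟩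
      exact ⟨_, ⟨D₁, h₁, D₂, h₂, rfl⟩, key _ _⟩
    · rintro ⟨_, ⟨D₁, h₁, D₂, h₂, rfl⟩, rfl⟩
      exact ⟨_, ⟨D₁, h₁, rfl⟩, _, ⟨D₂, h₂, rfl⟩, key _ _⟩
  | seq r₁ r₂ ih₁ ih₂ =>
    have key : ∀ D₁ D₂ : UMul σ B,
        mulToSet (mseqComp D₁ D₂) = seqComp (mulToSet D₁) (mulToSet D₂) := by
      intro D₁ D₂; ext u
      simp only [mulToSet, mseqComp, seqComp, Set.mem_ofPred_eq, Set.mem_union, not_not]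
      split_ifs with h
      · have := h u.2.2
        simp only [Prod.mk.eta] at this
        simp only [this, h]; simp
      · simp only [h]; simp
    simp only [updSets, updMuls, Set.mem_union, Set.mem_ofPred_eq, ih₁, ih₂]
    constructor
    · rintro (⟨_, ⟨D₁, h₁, rfl⟩, hc, _, ⟨D₂, h₂, rfl⟩, rfl⟩ | ⟨⟨D₁, h₁, rfl⟩, hc⟩)
      · exact ⟨_, .inl ⟨D₁, h₁, hc, D₂, h₂, rfl⟩, key _ _⟩
      · exact ⟨D₁, .inr ⟨h₁, hc⟩, rfl⟩
    · rintro ⟨_, ⟨D₁, h₁, hc, D₂, h₂, rfl⟩ | ⟨h₁, hc⟩, rfl⟩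
      · exact .inl ⟨_, ⟨D₁, h₁, rfl⟩, hc, _, ⟨D₂, h₂, rfl⟩, key _ _⟩
      · exact .inr ⟨⟨_, h₁, rfl⟩, hc⟩
  | letr f t ρ r ih =>
    have key : ∀ D : UMul σ B, mulToSet (mcollapse I f (t.val I ζ) ρ D) =
        scollapse I f (t.val I ζ) ρ D := by
      rintro D
      ext ⟨f', a, b⟩
      simp only [mulToSet, mcollapse, scollapse, Set.mem_ofPred_eq, Set.mem_union, Prod.mk.injEq]
      split_ifs <;> simp_all
    simp only [updSets, updMuls, Set.mem_ofPred_eq]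
    constructor
    · rintro ⟨D, h, rfl⟩; exact ⟨_, ⟨D, h, rfl⟩, key D⟩
    · rintro ⟨_, ⟨D, h, rfl⟩, rfl⟩; exact ⟨D, h, key D⟩

/-- Replacing every atom `upd(r, X)` by an equivalent formula. -/
theorem exists_noUpd_of_atoms
    (h : ∀ (r : Rule σ) (n : ℕ), ∃ ψ : Fml σ, FmlEquiv (.upd r n) ψ ∧ ¬ ψ.hasR true) :
    (∀ φ : Fml σ, ∃ ψ : Fml σ, FmlEquiv φ ψ ∧ ¬ ψ.hasR true) := by
  classical
  intro φ
  refine Fml.rec (σ := σ)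
    (motive_1 := fun t => ∃ s : LTerm σ, (∀ (B : Type) (I : Interp σ B) (ζ : Asg B)
      (Ξ : SOAsg σ B), Ξ.Fin → lval I ζ Ξ t = lval I ζ Ξ s) ∧ ¬ s.hasR true)
    (motive_2 := fun φ => ∃ ψ : Fml σ, (∀ (B : Type) (I : Interp σ B) (ζ : Asg B)
      (Ξ : SOAsg σ B), Ξ.Fin → (fval I ζ Ξ φ ↔ fval I ζ Ξ ψ)) ∧ ¬ ψ.hasR true)
    ?_ ?_ ?_ ?_ ?_ ?_ ?_ ?_ ?_ ?_ ?_ ?_ ?_ ?_ ?_ ?_ ?_ ?_ ?_ ?_ ?_ ?_ ?_ ?_ ?_ ?_ ?_ φ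
  · exact fun x => ⟨.var x, by simp [LTerm.hasR]⟩
  · exact fun x => ⟨.avar x, by simp [LTerm.hasR]⟩
  · rintro f t ⟨s, hs, hn⟩
    exact ⟨.dyn f s, fun B I ζ Ξ hf => by simp only [lval, hs B I ζ Ξ hf], hn⟩
  · rintro f t ⟨s, hs, hn⟩
    exact ⟨.stat f s, fun B I ζ Ξ hf => by simp only [lval, hs B I ζ Ξ hf], hn⟩
  · rintro ρ x t φ ⟨s, hs, hn⟩ ⟨ψ, hψ, hn'⟩
    refine ⟨.rho ρ x s ψ, fun B I ζ Ξ hf => ?_, by simp [LTerm.hasR, hn, hn']⟩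
    simp only [lval]
    congr 1
    rw [Multiset.filter_congr (fun a _ => hψ B I (ζ.updDb x a) Ξ hf)]
    exact Multiset.map_congr rfl fun a _ => hs B I _ Ξ hf
  · rintro s t ⟨s', hs, hn⟩ ⟨t', ht, hn'⟩
    exact ⟨.eq s' t', fun B I ζ Ξ hf => by simp only [fval, hs B I ζ Ξ hf, ht B I ζ Ξ hf],
      by simp [Fml.hasR, hn, hn']⟩
  · rintro φ ⟨ψ, hψ, hn⟩
    exact ⟨.not ψ, fun B I ζ Ξ hf => by simp only [fval, hψ B I ζ Ξ hf], hn⟩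
  · rintro s t ⟨s', hs, hn⟩ ⟨t', ht, hn'⟩
    exact ⟨.and s' t', fun B I ζ Ξ hf => by simp only [fval, hs B I ζ Ξ hf, ht B I ζ Ξ hf],
      by simp [Fml.hasR, hn, hn']⟩
  · rintro x φ ⟨ψ, hψ, hn⟩
    exact ⟨.allDb x ψ, fun B I ζ Ξ hf => by simp only [fval, hψ B I _ Ξ hf], hn⟩
  · rintro x φ ⟨ψ, hψ, hn⟩
    exact ⟨.allA x ψ, fun B I ζ Ξ hf => by simp only [fval, hψ B I _ Ξ hf], hn⟩
  · rintro x φ ⟨ψ, hψ, hn⟩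
    exact ⟨.allM x ψ, fun B I ζ Ξ hf =>
      forall₂_congr fun P hP => hψ B I ζ _ (hf.uM x hP), hn⟩
  · rintro x φ ⟨ψ, hψ, hn⟩
    exact ⟨.allX x ψ, fun B I ζ Ξ hf =>
      forall₂_congr fun P hP => hψ B I ζ _ (hf.uX x hP), hn⟩
  · rintro x φ ⟨ψ, hψ, hn⟩
    exact ⟨.allXc x ψ, fun B I ζ Ξ hf =>
      forall₂_congr fun P hP => hψ B I ζ _ (hf.uXc x hP), hn⟩
  · rintro x φ ⟨ψ, hψ, hn⟩
    exact ⟨.allXm x ψ, fun B I ζ Ξ hf =>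
      forall₂_congr fun P hP => hψ B I ζ _ (hf.uXm x hP), hn⟩
  · rintro x φ ⟨ψ, hψ, hn⟩
    exact ⟨.allXmc x ψ, fun B I ζ Ξ hf =>
      forall₂_congr fun P hP => hψ B I ζ _ (hf.uXmc x hP), hn⟩
  · rintro x φ ⟨ψ, hψ, hn⟩
    exact ⟨.allF x ψ, fun B I ζ Ξ hf =>
      forall₂_congr fun P hP => hψ B I ζ _ (hf.uF x hP), hn⟩
  · rintro x φ ⟨ψ, hψ, hn⟩
    exact ⟨.allG x ψ, fun B I ζ Ξ hf =>
      forall₂_congr fun P hP => hψ B I ζ _ (hf.uG x hP), hn⟩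
  · exact fun r n => h r n
  · exact fun r n => ⟨.upm r n, by simp [Fml.hasR]⟩
  · rintro n s t ⟨s', hs, hn⟩ ⟨t', ht, hn'⟩
    exact ⟨.memM n s' t', fun B I ζ Ξ hf => by simp only [fval, hs B I ζ Ξ hf, ht B I ζ Ξ hf],
      by simp [Fml.hasR, hn, hn']⟩
  · rintro n f s t ⟨s', hs, hn⟩ ⟨t', ht, hn'⟩
    exact ⟨.memX n f s' t', fun B I ζ Ξ hf => by simp only [fval, hs B I ζ Ξ hf, ht B I ζ Ξ hf],
      by simp [Fml.hasR, hn, hn']⟩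
  · rintro n f s t u ⟨s', hs, hn⟩ ⟨t', ht, hn'⟩ ⟨u', hu, hn''⟩
    exact ⟨.memXc n f s' t' u', fun B I ζ Ξ hf => by
      simp only [fval, hs B I ζ Ξ hf, ht B I ζ Ξ hf, hu B I ζ Ξ hf],
      by simp [Fml.hasR, hn, hn', hn'']⟩
  · rintro n f s t u ⟨s', hs, hn⟩ ⟨t', ht, hn'⟩ ⟨u', hu, hn''⟩
    exact ⟨.memXm n f s' t' u', fun B I ζ Ξ hf => by
      simp only [fval, hs B I ζ Ξ hf, ht B I ζ Ξ hf, hu B I ζ Ξ hf],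
      by simp [Fml.hasR, hn, hn', hn'']⟩
  · rintro n f s t u v ⟨s', hs, hn⟩ ⟨t', ht, hn'⟩ ⟨u', hu, hn''⟩ ⟨v', hv, hn3⟩
    exact ⟨.memXmc n f s' t' u' v', fun B I ζ Ξ hf => by
      simp only [fval, hs B I ζ Ξ hf, ht B I ζ Ξ hf, hu B I ζ Ξ hf, hv B I ζ Ξ hf],
      by simp [Fml.hasR, hn, hn', hn'', hn3]⟩
  · rintro n f t1 t2 t3 t4 t5 t6 t7 ⟨s1, h1, n1⟩ ⟨s2, h2, n2⟩ ⟨s3, h3, n3⟩ ⟨s4, h4, n4⟩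
      ⟨s5, h5, n5⟩ ⟨s6, h6, n6⟩ ⟨s7, h7, n7⟩
    exact ⟨.memF n f s1 s2 s3 s4 s5 s6 s7, fun B I ζ Ξ hf => by
      simp only [fval, h1 B I ζ Ξ hf, h2 B I ζ Ξ hf, h3 B I ζ Ξ hf, h4 B I ζ Ξ hf,
        h5 B I ζ Ξ hf, h6 B I ζ Ξ hf, h7 B I ζ Ξ hf],
      by simp [Fml.hasR, n1, n2, n3, n4, n5, n6, n7]⟩
  · rintro n f t1 t2 t3 t4 t5 t6 t7 ⟨s1, h1, n1⟩ ⟨s2, h2, n2⟩ ⟨s3, h3, n3⟩ ⟨s4, h4, n4⟩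
      ⟨s5, h5, n5⟩ ⟨s6, h6, n6⟩ ⟨s7, h7, n7⟩
    exact ⟨.memG n f s1 s2 s3 s4 s5 s6 s7, fun B I ζ Ξ hf => by
      simp only [fval, h1 B I ζ Ξ hf, h2 B I ζ Ξ hf, h3 B I ζ Ξ hf, h4 B I ζ Ξ hf,
        h5 B I ζ Ξ hf, h6 B I ζ Ξ hf, h7 B I ζ Ξ hf],
      by simp [Fml.hasR, n1, n2, n3, n4, n5, n6, n7]⟩
  · rintro x φ ⟨ψ, hψ, hn⟩
    exact ⟨.box x ψ, fun B I ζ Ξ hf => by simp only [fval, hψ B _ ζ Ξ hf], hn⟩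

/-- The total multiplicity of an update multiset is at most `T`. -/
def FinBound (D : UMul σ B) (T : ℕ) : Prop := ∀ s : Finset (Upd σ B), ∑ u ∈ s, D u ≤ T

theorem FinBound.le {D : UMul σ B} {T : ℕ} (h : FinBound D T) (u : Upd σ B) : D u ≤ T := by
  simpa using h {u}

theorem FinBound.finite_support {D : UMul σ B} {T : ℕ} (h : FinBound D T) :
    (Function.support D).Finite := by
  classical
  by_contra hinf
  obtain ⟨s, hs, hc⟩ := Set.Infinite.exists_subset_card_eq hinf (T + 1)
  have h1 := h s
  have h2 : s.card • 1 ≤ ∑ u ∈ s, D u := by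
    refine Finset.card_nsmul_le_sum s _ 1 fun u hu => ?_
    have : D u ≠ 0 := hs hu
    omega
  rw [hc] at h2
  simp at h2
  omega

theorem FinBound.finite_support_loc {D : UMul σ B} {T : ℕ} (h : FinBound D T) (f : σ.F) (a : B) :
    (Function.support fun b => D (f, a, b)).Finite :=
  (h.finite_support.preimage (f := fun b => (f, a, b)) (by intro x _ y _; simp))

theorem count_mulVals [DecidableEq B] {D : UMul σ B} {f : σ.F} {a : B}
    (h : (Function.support fun b => D (f, a, b)).Finite) (b : B) :
    (mulVals D f a).count b = D (f, a, b) := by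
  classical
  rw [mulVals, dif_pos h, Multiset.count_bind]
  simp only [Multiset.count_replicate]
  rw [← Finset.sum_eq_multiset_sum, Finset.sum_ite_eq' h.toFinset b (fun b => D (f, a, b))]
  simp
  exact fun h => h.symm

theorem FinBound.card_mulVals {D : UMul σ B} {T : ℕ} (h : FinBound D T) (f : σ.F) (a : B) :
    (mulVals D f a).card ≤ T := by
  classical
  have hf := h.finite_support_loc f a
  rw [mulVals, dif_pos hf, Multiset.card_bind]
  have := h (hf.toFinset.map ⟨fun b => (f, a, b), by intro x y; simp⟩)
  rw [Finset.sum_map] at this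
  simp only [Function.comp_def, Multiset.card_replicate]
  exact this

theorem mem_mulVals {D : UMul σ B} {f : σ.F} {a b : B} (h : b ∈ mulVals D f a) :
    D (f, a, b) ≠ 0 := by
  classical
  rw [mulVals] at h
  split_ifs at h with hf
  · rw [Multiset.mem_bind] at h
    obtain ⟨c, -, hc⟩ := h
    rw [Multiset.mem_replicate] at hc
    exact hc.2 ▸ hc.1
  · simp at h

/-- The exponent in the bound on the size of the update multisets of a rule. -/
def Rule.deg : Rule σ → ℕ
  | .assign _ _ _ => 0
  | .cond _ r => r.deg
  | .forall_ _ _ r => r.deg + 1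
  | .choose _ _ r => r.deg
  | .par r₁ r₂ => max r₁.deg r₂.deg + 1
  | .seq r₁ r₂ => max r₁.deg r₂.deg + 1
  | .letr _ _ _ r => r.deg + 1

theorem pow_add_pow_le {d : ℕ} (hd : 2 ≤ d) (j k : ℕ) :
    d ^ j + d ^ k ≤ d ^ (max j k + 1) := by
  have h1 : d ^ j ≤ d ^ max j k := Nat.pow_le_pow_right (by omega) (le_max_left _ _)
  have h2 : d ^ k ≤ d ^ max j k := Nat.pow_le_pow_right (by omega) (le_max_right _ _)
  calc d ^ j + d ^ k ≤ d ^ max j k * 2 := by omega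
    _ ≤ d ^ (max j k + 1) := by rw [pow_succ]; exact Nat.mul_le_mul_left _ hd

theorem finBound_of_mem_updMuls (r : Rule σ) {I : Interp σ B} {ζ : Asg B} {D : UMul σ B} {d : ℕ}
    (hd : 2 ≤ d) (hdb : I.db.ncard ≤ d) (h : D ∈ updMuls r I ζ) : FinBound D (d ^ r.deg) := by
  classical
  induction r generalizing I ζ D with
  | assign f t u =>
    obtain rfl := h
    intro s
    rw [Finset.sum_ite_eq']
    simp only [Rule.deg, pow_zero]
    split_ifs <;> simp
  | cond φ r ih =>
    simp only [updMuls] at h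
    split_ifs at h
    · exact ih hdb h
    · obtain rfl := h
      intro s; simp
  | forall_ x φ r ih =>
    obtain ⟨g, hg, hg0, rfl⟩ := h
    intro s
    rw [Finset.sum_comm]
    calc _ ≤ ∑ a ∈ I.db_fin.toFinset, d ^ r.deg := by
          refine Finset.sum_le_sum fun a ha => ?_
          rw [Set.Finite.mem_toFinset] at ha
          by_cases hφ : φ.val I (ζ.updDb x a)
          · exact ih hdb (hg a ha hφ) s
          · rw [hg0 a (fun h => hφ h.2)]; simp
      _ = I.db.ncard * d ^ r.deg := by
          rw [Finset.sum_const, Set.ncard_eq_toFinset_card _ I.db_fin, smul_eq_mul]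
      _ ≤ d ^ (r.deg + 1) := by
          rw [pow_succ, mul_comm]; exact Nat.mul_le_mul_left _ hdb
  | choose x φ r ih =>
    obtain ⟨a, ha, hφ, h⟩ := h
    exact ih hdb h
  | par r₁ r₂ ih₁ ih₂ =>
    obtain ⟨D₁, h₁, D₂, h₂, rfl⟩ := h
    intro s
    rw [Finset.sum_add_distrib]
    exact (Nat.add_le_add (ih₁ hdb h₁ s) (ih₂ hdb h₂ s)).trans (pow_add_pow_le hd _ _)
  | seq r₁ r₂ ih₁ ih₂ =>
    rcases h with ⟨D₁, h₁, hc, D₂, h₂, rfl⟩ | ⟨h₁, hc⟩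
    · intro s
      calc _ ≤ ∑ u ∈ s, (D₁ u + D₂ u) := by
            refine Finset.sum_le_sum fun u _ => ?_
            simp only [mseqComp]; split_ifs <;> omega
        _ ≤ _ := by
            rw [Finset.sum_add_distrib]
            exact (Nat.add_le_add (ih₁ hdb h₁ s) (ih₂ (I := I.apply (mulToSet D₁)) hdb h₂ s)).trans
              (pow_add_pow_le hd _ _)
    · intro s
      refine (ih₁ hdb h₁ s).trans (Nat.pow_le_pow_right (by omega) ?_)
      simp only [Rule.deg]; omega
  | letr f t ρ r ih =>
    obtain ⟨D', h', rfl⟩ := h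
    intro s
    calc _ ≤ ∑ u ∈ s, (D' u + if u = (f, t.val I ζ, I.lop ρ (mulVals D' f (t.val I ζ)))
            then 1 else 0) := by
          refine Finset.sum_le_sum fun u _ => ?_
          obtain ⟨f', a, b⟩ := u
          simp only [mcollapse, Prod.mk.injEq]
          split_ifs <;> simp_all
      _ ≤ d ^ r.deg + d ^ 0 := by
          rw [Finset.sum_add_distrib, Finset.sum_ite_eq']
          refine Nat.add_le_add (ih hdb h' s) ?_
          simp only [pow_zero]
          split_ifs <;> simp
      _ ≤ _ := by simpa [Rule.deg] using pow_add_pow_le hd r.deg 0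

section Binary

open Classical in
/-- The number with binary digits `s 0, …, s (k - 1)`. -/
noncomputable def bitNum (s : ℕ → Prop) (k : ℕ) : ℕ :=
  ∑ i ∈ Finset.range k, if s i then 2 ^ i else 0

theorem bitNum_succ (s : ℕ → Prop) (k : ℕ) [Decidable (s k)] :
    bitNum s (k + 1) = bitNum s k + if s k then 2 ^ k else 0 := by
  rw [bitNum, Finset.sum_range_succ, bitNum]; congr

theorem bitNum_lt (s : ℕ → Prop) (k : ℕ) : bitNum s k < 2 ^ k := by
  classical
  induction k with
  | zero => simp [bitNum]
  | succ k ih => rw [bitNum_succ, pow_succ]; split_ifs <;> omega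

theorem bitNum_congr {s t : ℕ → Prop} {k : ℕ} (h : ∀ i < k, (s i ↔ t i)) :
    bitNum s k = bitNum t k := by
  classical
  refine Finset.sum_congr rfl fun i hi => ?_
  simp only [h i (Finset.mem_range.1 hi)]

theorem bitNum_inj {s t : ℕ → Prop} {k : ℕ} (h : bitNum s k = bitNum t k) :
    ∀ i < k, (s i ↔ t i) := by
  classical
  induction k with
  | zero => simp
  | succ k ih =>
    have hs := bitNum_lt s k
    have ht := bitNum_lt t k
    rw [bitNum_succ, bitNum_succ] at h
    have key : (s k ↔ t k) ∧ bitNum s k = bitNum t k := by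
      split_ifs at h with h1 h2 h2 <;> simp only [h1, h2] <;> simp <;> omega
    intro i hi
    rcases Nat.lt_succ_iff_lt_or_eq.1 hi with h' | rfl
    · exact ih key.2 i h'
    · exact key.1

theorem bitNum_surj {m k : ℕ} (h : m < 2 ^ k) : ∃ s, bitNum s k = m := by
  classical
  induction k generalizing m with
  | zero => exact ⟨fun _ => False, by simp [bitNum] at h ⊢; omega⟩
  | succ k ih =>
    rw [pow_succ] at h
    by_cases hm : m < 2 ^ k
    · obtain ⟨s, hs⟩ := ih hm
      refine ⟨fun i => s i ∧ i < k, ?_⟩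
      rw [bitNum_succ, ← hs, if_neg (by simp)]
      exact bitNum_congr fun i hi => by simp [hi]
    · obtain ⟨s, hs⟩ := ih (m := m - 2 ^ k) (by omega)
      refine ⟨fun i => s i ∨ i = k, ?_⟩
      rw [bitNum_succ, if_pos (by simp), bitNum_congr (t := s), hs]
      · omega
      · intro i hi; simp [hi.ne]

/-- The majority of three propositions. -/
def Maj (a b c : Prop) : Prop := (a ∧ b) ∨ (a ∧ c) ∨ (b ∧ c)

/-- The sum of three propositions modulo two. -/
def Xor3 (a b c : Prop) : Prop := (a ↔ (b ↔ c))

/-- The carries in the addition of two binary numbers. -/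
def carry (s t : ℕ → Prop) : ℕ → Prop
  | 0 => False
  | i + 1 => Maj (s i) (t i) (carry s t i)

open Classical in
theorem bitNum_add_of_carry {s t u c : ℕ → Prop} {N : ℕ} (h0 : ¬ c 0)
    (h : ∀ i < N, (u i ↔ Xor3 (s i) (t i) (c i)) ∧ (c (i + 1) ↔ Maj (s i) (t i) (c i))) :
    bitNum s N + bitNum t N = bitNum u N + if c N then 2 ^ N else 0 := by
  induction N with
  | zero => simp [bitNum, h0]
  | succ N ih =>
    have ih := ih fun i hi => h i (by omega)
    obtain ⟨hu, hc⟩ := h N (by omega)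
    rw [bitNum_succ, bitNum_succ, bitNum_succ]
    simp only [hu, hc, pow_succ]
    by_cases h1 : s N <;> by_cases h2 : t N <;> by_cases h3 : c N <;>
      simp [h1, h2, h3, Maj, Xor3] at ih ⊢ <;> omega

theorem bitNum_add_iff {s t u : ℕ → Prop} {N : ℕ} :
    bitNum s N + bitNum t N = bitNum u N ↔
      ∃ c : ℕ → Prop, ¬ c 0 ∧ ¬ c N ∧ ∀ i < N, (u i ↔ Xor3 (s i) (t i) (c i)) ∧
        (c (i + 1) ↔ Maj (s i) (t i) (c i)) := by
  classical
  constructor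
  · intro h
    have key := bitNum_add_of_carry (s := s) (t := t) (c := carry s t) (N := N)
      (u := fun i => Xor3 (s i) (t i) (carry s t i)) (by simp [carry])
      (fun i _ => ⟨Iff.rfl, Iff.rfl⟩)
    rw [h] at key
    have hlt := bitNum_lt u N
    have hc : ¬ carry s t N := by
      intro hc; rw [if_pos hc] at key; omega
    rw [if_neg hc, add_zero] at key
    exact ⟨carry s t, by simp [carry], hc, fun i hi => ⟨bitNum_inj key i hi, Iff.rfl⟩⟩
  · rintro ⟨c, h0, hN, h⟩
    have := bitNum_add_of_carry h0 h
    rwa [if_neg hN, add_zero] at this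

variable {N : ℕ} (e : B ≃ Fin N)

/-- The number whose binary digits are given by a subset of a linearly ordered finite set. -/
noncomputable def num (s : B → Prop) : ℕ := bitNum (fun i => ∃ h : i < N, s (e.symm ⟨i, h⟩)) N

theorem num_lt (s : B → Prop) : num e s < 2 ^ N := bitNum_lt _ _

theorem num_inj {s t : B → Prop} (h : num e s = num e t) (b : B) : s b ↔ t b := by
  simpa using bitNum_inj h (e b) (e b).2

theorem num_congr {s t : B → Prop} (h : ∀ b, s b ↔ t b) : num e s = num e t := by
  rw [show s = t from funext fun b => propext (h b)]

theorem num_surj {m : ℕ} (h : m < 2 ^ N) : ∃ s, num e s = m := by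
  obtain ⟨s, hs⟩ := bitNum_surj h
  refine ⟨fun b => s (e b), ?_⟩
  rw [num, ← hs]
  exact bitNum_congr fun i hi => by simp [hi]

theorem num_eq_zero {s : B → Prop} : num e s = 0 ↔ ∀ b, ¬ s b := by
  have h0 : num e (fun _ => False) = 0 := by simp [num, bitNum]
  constructor
  · intro h b; simpa using num_inj e (h.trans h0.symm) b
  · intro h; rw [← h0]; exact num_congr e fun b => by simp [h b]

theorem num_eq_one (hN : 0 < N) {s : B → Prop} : num e s = 1 ↔ ∀ b, (s b ↔ (e b : ℕ) = 0) := by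
  classical
  have h1 : num e (fun b => (e b : ℕ) = 0) = 1 := by
    rw [num, bitNum, Finset.sum_eq_single 0]
    · simp [hN]
    · intro i _ hi; simp [hi]
    · simp [hN.ne']
  constructor
  · intro h b; exact num_inj e (h.trans h1.symm) b
  · intro h; rw [← h1]; exact num_congr e h

theorem num_add_iff {s t u : B → Prop} :
    num e s + num e t = num e u ↔
      ∃ c : B → Prop, ∀ p, ((e p : ℕ) = 0 → ¬ c p) ∧ (u p ↔ Xor3 (s p) (t p) (c p)) ∧
        (∀ p', (e p' : ℕ) = e p + 1 → (c p' ↔ Maj (s p) (t p) (c p))) ∧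
        ((e p : ℕ) + 1 = N → ¬ Maj (s p) (t p) (c p)) := by
  rw [num, num, num, bitNum_add_iff]
  constructor
  · rintro ⟨c, h0, hN, h⟩
    refine ⟨fun p => c (e p), fun p => ⟨fun hp => by simpa [hp] using h0, ?_,
      fun p' hp' => ?_, fun hp => ?_⟩⟩
    · simpa using (h (e p) (e p).2).1
    · simpa [hp'] using (h (e p) (e p).2).2
    · have := (h (e p) (e p).2).2
      rw [hp] at this
      simpa [hN] using this
  · rintro ⟨c, h⟩
    refine ⟨fun i => ∃ h : i < N, c (e.symm ⟨i, h⟩), ?_, by simp, fun i hi => ⟨?_, ?_⟩⟩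
    · rintro ⟨h0, hc⟩
      exact (h _).1 (by simp) hc
    · simpa [hi] using (h (e.symm ⟨i, hi⟩)).2.1
    · simp only [hi, exists_true_left]
      by_cases hi' : i + 1 < N
      · simpa [hi'] using (h (e.symm ⟨i, hi⟩)).2.2.1 (e.symm ⟨i + 1, hi'⟩) (by simp)
      · have := (h (e.symm ⟨i, hi⟩)).2.2.2 (by simp; omega)
        simp [hi', this]

theorem num_sum_iff (hN : 0 < N) {r : B → B → Prop} {t : B → Prop} :
    num e t = ∑ i : Fin N, num e (r (e.symm i)) ↔
      ∃ S : B → B → Prop, ∀ x y, ((e x : ℕ) = 0 → ∀ p, ¬ S x p) ∧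
        ((e y : ℕ) = e x + 1 → num e (S x) + num e (r x) = num e (S y)) ∧
        ((e x : ℕ) + 1 = N → num e (S x) + num e (r x) = num e t) := by
  classical
  set g : ℕ → ℕ := fun i => if h : i < N then num e (r (e.symm ⟨i, h⟩)) else 0 with hg
  have hsum : ∑ i : Fin N, num e (r (e.symm i)) = ∑ i ∈ Finset.range N, g i := by
    rw [← Fin.sum_univ_eq_sum_range]
    exact Finset.sum_congr rfl fun i _ => by simp [hg]
  have hge : ∀ x, num e (r x) = g (e x) := by intro x; simp [hg]
  rw [hsum]
  constructor
  · intro h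
    have hlt : ∀ x : B, ∑ i ∈ Finset.range (e x), g i < 2 ^ N := fun x =>
      (Finset.sum_le_sum_of_subset (Finset.range_mono (e x).2.le)).trans_lt (h ▸ num_lt e t)
    choose S hS using fun x => num_surj e (hlt x)
    refine ⟨S, fun x y => ⟨fun hx => ?_, fun hy => ?_, fun hx => ?_⟩⟩
    · rw [← num_eq_zero e, hS, hx]; simp
    · rw [hS, hS, hy, hge, Finset.sum_range_succ]
    · rw [hS, h, hge, ← Finset.sum_range_succ, hx]
  · rintro ⟨S, h⟩
    have key : ∀ k (hk : k < N), num e (S (e.symm ⟨k, hk⟩)) = ∑ i ∈ Finset.range k, g i := by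
      intro k
      induction k with
      | zero =>
        intro hk
        rw [Finset.sum_range_zero, num_eq_zero]
        exact (h _ (e.symm ⟨0, hk⟩)).1 (by simp)
      | succ k ih =>
        intro hk
        rw [Finset.sum_range_succ, ← ih (by omega),
          ← (h (e.symm ⟨k, by omega⟩) (e.symm ⟨k + 1, hk⟩)).2.1 (by simp), hge]
        simp
    have hN' : N - 1 + 1 = N := by omega
    rw [← (h (e.symm ⟨N - 1, by omega⟩) (e.symm ⟨N - 1, by omega⟩)).2.2 (by simp; omega), key, hge]
    simp only [Equiv.apply_symm_apply]
    rw [← Finset.sum_range_succ, hN']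

end Binary

section OrderFormulas

/-- The linear order on `B` induced by an enumeration. -/
def ordRel {N : ℕ} (e : B ≃ Fin N) : Set (B × B) := {q | e q.1 ≤ e q.2}

theorem mem_ordRel {N : ℕ} (e : B ≃ Fin N) (a b : B) : (a, b) ∈ ordRel e ↔ (e a : ℕ) ≤ e b :=
  Iff.rfl

/-- `x` is the least element; `z` is an auxiliary bound variable. -/
def minF (x z : ℕ) : Fml σ := .allA z (.memM 0 (.avar x) (.avar z))

/-- `x` is the greatest element. -/
def maxF (x z : ℕ) : Fml σ := .allA z (.memM 0 (.avar z) (.avar x))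

/-- `y` is the successor of `x`. -/
def succF (x y z : ℕ) : Fml σ :=
  .and (.not (.memM 0 (.avar y) (.avar x)))
    (.allA z (.or (.memM 0 (.avar z) (.avar x)) (.memM 0 (.avar y) (.avar z))))

@[simp] theorem hasR_minF (b : Bool) (x z : ℕ) : ¬ (minF x z : Fml σ).hasR b := by
  simp [minF, Fml.hasR, LTerm.hasR]

@[simp] theorem hasR_maxF (b : Bool) (x z : ℕ) : ¬ (maxF x z : Fml σ).hasR b := by
  simp [maxF, Fml.hasR, LTerm.hasR]

@[simp] theorem hasR_succF (b : Bool) (x y z : ℕ) : ¬ (succF x y z : Fml σ).hasR b := by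
  simp [succF, Fml.hasR, LTerm.hasR]

variable {N : ℕ} {e : B ≃ Fin N} {I : Interp σ B} {ζ : Asg B} {Ξ : SOAsg σ B}

theorem fval_minF (hO : Ξ.m 0 = ordRel e) {x z : ℕ} (hz : x ≠ z) :
    fval I ζ Ξ (minF x z) ↔ (e (ζ.av x) : ℕ) = 0 := by
  simp only [minF, fval, lval, hO, Asg.updA_av, hz, if_true, if_false, mem_ordRel]
  constructor
  · intro h
    have hx := (e (ζ.av x)).2
    simpa using h (e.symm ⟨0, by omega⟩)
  · intro h b; omega

theorem fval_maxF (hO : Ξ.m 0 = ordRel e) {x z : ℕ} (hz : x ≠ z) :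
    fval I ζ Ξ (maxF x z) ↔ (e (ζ.av x) : ℕ) + 1 = N := by
  simp only [maxF, fval, lval, hO, Asg.updA_av, hz, if_true, if_false, mem_ordRel]
  have hx := (e (ζ.av x)).2
  constructor
  · intro h
    have := h (e.symm ⟨N - 1, by omega⟩)
    simp at this; omega
  · intro h b
    have := (e b).2; omega

theorem fval_succF (hO : Ξ.m 0 = ordRel e) {x y z : ℕ} (hz : x ≠ z) (hz' : y ≠ z) :
    fval I ζ Ξ (succF x y z) ↔ (e (ζ.av y) : ℕ) = e (ζ.av x) + 1 := by
  simp only [succF, fval, lval, fval_or, hO, Asg.updA_av, hz, hz', if_true, if_false, mem_ordRel]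
  have hx := (e (ζ.av x)).2
  have hy := (e (ζ.av y)).2
  constructor
  · rintro ⟨h1, h2⟩
    have := h2 (e.symm ⟨e (ζ.av x) + 1, by omega⟩)
    simp at this; omega
  · intro h
    exact ⟨by omega, fun b => by omega⟩

/-- Binary addition: the numbers with digits `T₁` and `T₂` (formulae in the position
variable `4`) add up to the number with digits `T₃`. -/
def addF (T₁ T₂ T₃ : Fml σ) : Fml σ :=
  let c : Fml σ := .memM 1 (.avar 4) (.avar 4)
  let maj : Fml σ := .or (.and T₁ T₂) (.or (.and T₁ c) (.and T₂ c))
  .exM 1 (.allA 4 (.allA 7 (.and (.imp (minF 4 6) (.not c))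
    (.and (.iff T₃ (.iff T₁ (.iff T₂ c)))
      (.and (.imp (succF 4 7 6) (.iff (.memM 1 (.avar 7) (.avar 7)) maj))
        (.imp (maxF 4 6) (.not maj)))))))

@[simp] theorem hasR_addF (b : Bool) (T₁ T₂ T₃ : Fml σ) :
    (addF T₁ T₂ T₃).hasR b ↔ T₁.hasR b ∨ T₂.hasR b ∨ T₃.hasR b := by
  simp [addF, Fml.hasR, LTerm.hasR]; tauto

theorem fval_addF (hO : Ξ.m 0 = ordRel e) {T₁ T₂ T₃ : Fml σ} {s₁ s₂ s₃ : B → Prop}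
    (h₁ : ∀ p p' S, fval I ((ζ.updA 4 p).updA 7 p') (Ξ.uM 1 S) T₁ ↔ s₁ p)
    (h₂ : ∀ p p' S, fval I ((ζ.updA 4 p).updA 7 p') (Ξ.uM 1 S) T₂ ↔ s₂ p)
    (h₃ : ∀ p p' S, fval I ((ζ.updA 4 p).updA 7 p') (Ξ.uM 1 S) T₃ ↔ s₃ p) :
    fval I ζ Ξ (addF T₁ T₂ T₃) ↔ num e s₁ + num e s₂ = num e s₃ := by
  have : Finite B := .of_equiv _ e.symm
  have hO' : ∀ S, (Ξ.uM 1 S).m 0 = ordRel e := fun S => by simp [hO]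
  rw [num_add_iff]
  simp only [addF, fval_exM, fval, fval_imp, fval_iff, fval_or, h₁, h₂, h₃,
    fval_minF (hO' _) (show 4 ≠ 6 by decide), fval_maxF (hO' _) (show 4 ≠ 6 by decide),
    fval_succF (hO' _) (show 4 ≠ 6 by decide) (show 7 ≠ 6 by decide), lval]
  simp only [Asg.updA_av, SOAsg.uM_m, if_true, show (4 : ℕ) ≠ 7 by decide, if_false]
  constructor
  · rintro ⟨S, -, h⟩
    refine ⟨fun p => (p, p) ∈ S, fun p => ⟨(h p p).1, (h p p).2.1, fun p' => (h p p').2.2.1,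
      (h p p).2.2.2⟩⟩
  · rintro ⟨c, h⟩
    exact ⟨{q | c q.1}, Set.toFinite _, fun p p' =>
      ⟨(h p).1, (h p).2.1, (h p).2.2.1 p', (h p).2.2.2⟩⟩

/-- Iterated binary addition: the sum over all values of the variable `3` of the numbers with
digits `R` is the number with digits `T`. -/
def sumF (R T : Fml σ) : Fml σ :=
  .exM 2 (.allA 3 (.allA 5 (.and (.imp (minF 3 6) (.allA 4 (.not (.memM 2 (.avar 3) (.avar 4)))))
    (.and (.imp (succF 3 5 6) (addF (.memM 2 (.avar 3) (.avar 4)) R (.memM 2 (.avar 5) (.avar 4))))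
      (.imp (maxF 3 6) (addF (.memM 2 (.avar 3) (.avar 4)) R T))))))

@[simp] theorem hasR_sumF (b : Bool) (R T : Fml σ) :
    (sumF R T).hasR b ↔ R.hasR b ∨ T.hasR b := by
  simp [sumF, Fml.hasR, LTerm.hasR]

theorem fval_sumF (hO : Ξ.m 0 = ordRel e) {R T : Fml σ} {r : B → B → Prop} {t : B → Prop}
    (hR : ∀ x y p p' S S', fval I ((((ζ.updA 3 x).updA 5 y).updA 4 p).updA 7 p')
      ((Ξ.uM 2 S).uM 1 S') R ↔ r x p)
    (hT : ∀ x y p p' S S', fval I ((((ζ.updA 3 x).updA 5 y).updA 4 p).updA 7 p')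
      ((Ξ.uM 2 S).uM 1 S') T ↔ t p) :
    fval I ζ Ξ (sumF R T) ↔ num e t = ∑ i : Fin N, num e (r (e.symm i)) := by
  have : Finite B := .of_equiv _ e.symm
  have hO' : ∀ S, (Ξ.uM 2 S).m 0 = ordRel e := fun S => by simp [hO]
  have hN : 0 < N := (Nat.zero_le _).trans_lt (e (ζ.av 0)).2
  have hS : ∀ S x y, fval I ((ζ.updA 3 x).updA 5 y) (Ξ.uM 2 S)
      (addF (.memM 2 (.avar 3) (.avar 4)) R (.memM 2 (.avar 5) (.avar 4))) ↔
      num e (fun p => (x, p) ∈ S) + num e (r x) = num e (fun p => (y, p) ∈ S) := by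
    intro S x y
    refine fval_addF (hO' _) (fun p p' S' => ?_) (fun p p' S' => hR _ _ _ _ _ _)
      (fun p p' S' => ?_) <;> simp [fval, lval]
  have hS' : ∀ S x y, fval I ((ζ.updA 3 x).updA 5 y) (Ξ.uM 2 S)
      (addF (.memM 2 (.avar 3) (.avar 4)) R T) ↔
      num e (fun p => (x, p) ∈ S) + num e (r x) = num e t := by
    intro S x y
    refine fval_addF (hO' _) (fun p p' S' => ?_) (fun p p' S' => hR _ _ _ _ _ _)
      (fun p p' S' => hT _ _ _ _ _ _) ; simp [fval, lval]
  rw [num_sum_iff e hN]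
  simp only [sumF, fval_exM, fval, fval_imp, hS, hS',
    fval_minF (hO' _) (show 3 ≠ 6 by decide), fval_maxF (hO' _) (show 3 ≠ 6 by decide),
    fval_succF (hO' _) (show 3 ≠ 6 by decide) (show 5 ≠ 6 by decide), lval]
  simp only [Asg.updA_av, SOAsg.uM_m, if_true, show (3 : ℕ) ≠ 5 by decide, if_false,
    show (4 : ℕ) ≠ 5 by decide, show (3 : ℕ) ≠ 4 by decide]
  constructor
  · rintro ⟨S, -, h⟩
    exact ⟨fun x p => (x, p) ∈ S, h⟩
  · rintro ⟨S, h⟩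
    exact ⟨{q | S q.1 q.2}, Set.toFinite _, h⟩

/-- `M₀` is a linear order. -/
def ordF : Fml σ :=
  .allA 0 (.allA 1 (.allA 2 (.and (.or (.memM 0 (.avar 0) (.avar 1)) (.memM 0 (.avar 1) (.avar 0)))
    (.and (.imp (.and (.memM 0 (.avar 0) (.avar 1)) (.memM 0 (.avar 1) (.avar 0)))
        (.eq (.avar 0) (.avar 1)))
      (.imp (.and (.memM 0 (.avar 0) (.avar 1)) (.memM 0 (.avar 1) (.avar 2)))
        (.memM 0 (.avar 0) (.avar 2)))))))

@[simp] theorem hasR_ordF (b : Bool) : ¬ (ordF : Fml σ).hasR b := by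
  simp [ordF, Fml.hasR, LTerm.hasR]

theorem fval_ordF_iff :
    fval I ζ Ξ ordF ↔ ∀ a b c, ((a, b) ∈ Ξ.m 0 ∨ (b, a) ∈ Ξ.m 0) ∧
      ((a, b) ∈ Ξ.m 0 ∧ (b, a) ∈ Ξ.m 0 → a = b) ∧
      ((a, b) ∈ Ξ.m 0 ∧ (b, c) ∈ Ξ.m 0 → (a, c) ∈ Ξ.m 0) := by
  simp [ordF, fval, lval]

theorem fval_ordF_of_eq (hO : Ξ.m 0 = ordRel e) : fval I ζ Ξ ordF := by
  rw [fval_ordF_iff, hO]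
  intro a b c
  simp only [mem_ordRel]
  refine ⟨by omega, fun h => e.injective (Fin.ext (by omega)), by omega⟩

theorem exists_enum_of_ordF [Finite B] (h : fval I ζ Ξ ordF) :
    ∃ (N : ℕ) (e : B ≃ Fin N), Ξ.m 0 = ordRel e := by
  classical
  rw [fval_ordF_iff] at h
  have := Fintype.ofFinite B
  let L : LinearOrder B :=
    { le := fun a b => (a, b) ∈ Ξ.m 0
      le_refl := fun a => by simpa using (h a a a).1
      le_trans := fun a b c h1 h2 => (h a b c).2.2 ⟨h1, h2⟩
      le_antisymm := fun a b h1 h2 => (h a b a).2.1 ⟨h1, h2⟩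
      le_total := fun a b => (h a b a).1
      toDecidableLE := Classical.decRel _ }
  let o : Fin (Fintype.card B) ≃o B := Fintype.orderIsoFinOfCardEq B rfl
  refine ⟨_, o.symm.toEquiv, ?_⟩
  ext ⟨a, b⟩
  exact (o.symm.le_iff_le (x := a) (y := b)).symm

end OrderFormulas

section Reach

/-- The static function symbols of a term. -/
def PTerm.stats : PTerm σ → List σ.Stat
  | .var _ => []
  | .avar _ => []
  | .dyn _ t => t.stats
  | .stat g t => g :: t.stats

/-- The nesting depth of a term. -/
def PTerm.depth : PTerm σ → ℕ
  | .var _ => 0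
  | .avar _ => 0
  | .dyn _ t => t.depth + 1
  | .stat _ t => t.depth + 1

/-- The static function symbols in the value terms of a rule. -/
def Rule.stats : Rule σ → List σ.Stat
  | .assign _ _ s => s.stats
  | .cond _ r => r.stats
  | .forall_ _ _ r => r.stats
  | .choose _ _ r => r.stats
  | .par r₁ r₂ => r₁.stats ++ r₂.stats
  | .seq r₁ r₂ => r₁.stats ++ r₂.stats
  | .letr _ _ _ r => r.stats

/-- The location operators of a rule. -/
def Rule.rhos : Rule σ → List σ.Rho
  | .assign _ _ _ => []
  | .cond _ r => r.rhos
  | .forall_ _ _ r => r.rhos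
  | .choose _ _ r => r.rhos
  | .par r₁ r₂ => r₁.rhos ++ r₂.rhos
  | .seq r₁ r₂ => r₁.rhos ++ r₂.rhos
  | .letr _ _ ρ r => ρ :: r.rhos

/-- A bound for the number of evaluation steps needed to produce the values of a rule. -/
def Rule.depth : Rule σ → ℕ
  | .assign _ _ s => s.depth
  | .cond _ r => r.depth
  | .forall_ _ _ r => r.depth
  | .choose _ _ r => r.depth
  | .par r₁ r₂ => max r₁.depth r₂.depth
  | .seq r₁ r₂ => r₁.depth + r₂.depth
  | .letr _ _ _ r => r.depth + 1

/-- The elements obtained from `A` in at most `k` steps by applying dynamic functions, the static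
functions in `G`, and the location operators in `P` to multisets of size at most `T`. -/
def Reach (I : Interp σ B) (G : List σ.Stat) (P : List σ.Rho) (T : ℕ) (A : Set B) : ℕ → Set B
  | 0 => A
  | k + 1 => {v | v ∈ Reach I G P T A k ∨
      (∃ g ∈ G, ∃ c ∈ Reach I G P T A k, v = I.stat g c) ∨
      (∃ f, ∃ c ∈ Reach I G P T A k, v = I.dyn f c) ∨
      ∃ ρ ∈ P, ∃ M : Multiset B, (∀ c ∈ M, c ∈ Reach I G P T A k) ∧ M.card ≤ T ∧ v = I.lop ρ M}

variable {I : Interp σ B} {G : List σ.Stat} {P : List σ.Rho} {T : ℕ} {A : Set B}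

theorem Reach.mono {j k : ℕ} (h : j ≤ k) : Reach I G P T A j ⊆ Reach I G P T A k := by
  induction h with
  | refl => exact subset_rfl
  | step _ ih => exact ih.trans fun v hv => .inl hv

theorem PTerm.val_mem_reach {ζ : Asg B} (t : PTerm σ) (hv : ∀ j < t.bnd, ζ.dbv j ∈ A)
    (ha : ∀ j < t.bnd, ζ.av j ∈ A) (hG : ∀ g ∈ t.stats, g ∈ G) :
    t.val I ζ ∈ Reach I G P T A t.depth := by
  induction t with
  | var x => exact hv x (Nat.lt_succ_self x)
  | avar x => exact ha x (Nat.lt_succ_self x)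
  | dyn f t ih => exact .inr (.inr (.inl ⟨f, _, ih hv ha hG, rfl⟩))
  | stat g t ih =>
    simp only [PTerm.stats, List.mem_cons, forall_eq_or_imp] at hG
    exact .inr (.inl ⟨g, hG.1, _, ih hv ha hG.2, rfl⟩)

theorem reach_apply_subset {D : UMul σ B} {j : ℕ}
    (h : ∀ f a b, D (f, a, b) ≠ 0 → b ∈ Reach I G P T A j) (k : ℕ) :
    Reach (I.apply (mulToSet D)) G P T A k ⊆ Reach I G P T A (j + k) := by
  induction k with
  | zero => exact fun v hv => Reach.mono (Nat.zero_le j) (show v ∈ Reach I G P T A 0 from hv)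
  | succ k ih =>
    rintro v (hv | ⟨g, hg, c, hc, rfl⟩ | ⟨f, c, hc, rfl⟩ | ⟨ρ, hρ, M, hM, hT, rfl⟩)
    · exact .inl (ih hv)
    · exact .inr (.inl ⟨g, hg, c, ih hc, rfl⟩)
    · simp only [Interp.apply]
      split_ifs with hex
      · exact Reach.mono (by omega) (h _ _ _ hex.choose_spec)
      · exact .inr (.inr (.inl ⟨f, c, ih hc, rfl⟩))
    · exact .inr (.inr (.inr ⟨ρ, hρ, M, fun c hc => ih (hM c hc), hT, rfl⟩))

theorem value_mem_reach (r : Rule σ) {ζ : Asg B} {D : UMul σ B} {d : ℕ} (hd : 2 ≤ d)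
    (hdb : I.db.ncard ≤ d) (hT : d ^ r.deg ≤ T) (hA : I.db ⊆ A)
    (hv : ∀ j < r.bnd, ζ.dbv j ∈ A) (ha : ∀ j < r.bnd, ζ.av j ∈ A)
    (hG : ∀ g ∈ r.stats, g ∈ G) (hP : ∀ ρ ∈ r.rhos, ρ ∈ P) (hD : D ∈ updMuls r I ζ)
    (f : σ.F) (a b : B) (hb : D (f, a, b) ≠ 0) : b ∈ Reach I G P T A r.depth := by
  classical
  have hup : ∀ (x n : ℕ) (ζ : Asg B) (c : B), c ∈ I.db → (∀ j < n, ζ.dbv j ∈ A) →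
      ∀ j < n, (ζ.updDb x c).dbv j ∈ A := by
    intro x n ζ c hc h j hj
    rw [Asg.updDb_dbv]
    split_ifs
    · exact hA hc
    · exact h j hj
  have hpow : ∀ {j k : ℕ}, j ≤ k → d ^ k ≤ T → d ^ j ≤ T := fun hjk h =>
    (Nat.pow_le_pow_right (by omega) hjk).trans h
  induction r generalizing I ζ D f a b with
  | assign f' t s =>
    obtain rfl := hD
    simp only [ne_eq, ite_eq_right_iff, one_ne_zero, imp_false, not_not, Prod.mk.injEq] at hb
    rw [hb.2.2]
    exact s.val_mem_reach (fun j hj => hv j (lt_max_of_lt_right hj))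
      (fun j hj => ha j (lt_max_of_lt_right hj)) hG
  | cond φ r ih =>
    simp only [updMuls] at hD
    split_ifs at hD
    · exact ih hdb hT hA (fun j hj => hv j (lt_max_of_lt_right hj))
        (fun j hj => ha j (lt_max_of_lt_right hj)) hG hP hD f a b hb hup
    · obtain rfl := hD
      simp at hb
  | forall_ x φ r ih =>
    obtain ⟨g, hg, hg0, rfl⟩ := hD
    simp only [ne_eq, Finset.sum_eq_zero_iff,
        Set.Finite.mem_toFinset, not_forall,
      exists_prop] at hb
    obtain ⟨c, hc, hb⟩ := hb
    by_cases hφ : φ.val I (ζ.updDb x c)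
    · exact ih hdb (hpow (Nat.le_succ _) hT) hA
        (hup _ _ _ _ hc fun j hj => hv j (lt_max_of_lt_right (lt_max_of_lt_right hj)))
        (fun j hj => ha j (lt_max_of_lt_right (lt_max_of_lt_right hj))) hG hP (hg c hc hφ)
        f a b hb hup
    · rw [hg0 c (fun h => hφ h.2)] at hb; simp at hb
  | choose x φ r ih =>
    obtain ⟨c, hc, hφ, h⟩ := hD
    exact ih hdb hT hA
      (hup _ _ _ _ hc fun j hj => hv j (lt_max_of_lt_right (lt_max_of_lt_right hj)))
      (fun j hj => ha j (lt_max_of_lt_right (lt_max_of_lt_right hj))) hG hP h f a b hb hup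
  | par r₁ r₂ ih₁ ih₂ =>
    obtain ⟨D₁, h₁, D₂, h₂, rfl⟩ := hD
    simp only [Rule.stats, Rule.rhos, List.mem_append] at hG hP
    simp only [Rule.deg] at hT
    have hb : D₁ (f, a, b) + D₂ (f, a, b) ≠ 0 := hb
    by_cases h : D₁ (f, a, b) = 0
    · exact Reach.mono (le_max_right _ _) (ih₂ hdb (hpow (by omega) hT) hA
        (fun j hj => hv j (lt_max_of_lt_right hj)) (fun j hj => ha j (lt_max_of_lt_right hj))
        (fun g hg => hG g (.inr hg)) (fun g hg => hP g (.inr hg)) h₂ f a b (by omega) hup)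
    · exact Reach.mono (le_max_left _ _) (ih₁ hdb (hpow (by omega) hT) hA
        (fun j hj => hv j (lt_max_of_lt_left hj)) (fun j hj => ha j (lt_max_of_lt_left hj))
        (fun g hg => hG g (.inl hg)) (fun g hg => hP g (.inl hg)) h₁ f a b h hup)
  | seq r₁ r₂ ih₁ ih₂ =>
    simp only [Rule.stats, Rule.rhos, List.mem_append] at hG hP
    simp only [Rule.deg] at hT
    have key : ∀ D₁ ∈ updMuls r₁ I ζ, ∀ f a b, D₁ (f, a, b) ≠ 0 →
        b ∈ Reach I G P T A r₁.depth := fun D₁ h₁ f a b h =>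
      ih₁ hdb (hpow (by omega) hT) hA
        (fun j hj => hv j (lt_max_of_lt_left hj)) (fun j hj => ha j (lt_max_of_lt_left hj))
        (fun g hg => hG g (.inl hg)) (fun g hg => hP g (.inl hg)) h₁ f a b h hup
    rcases hD with ⟨D₁, h₁, hc, D₂, h₂, rfl⟩ | ⟨h₁, hc⟩
    · by_cases h : D₂ (f, a, b) = 0
      · refine Reach.mono (Nat.le_add_right _ _) (key D₁ h₁ f a b fun h' => hb ?_)
        simp [mseqComp, h, h']
      · exact reach_apply_subset (key D₁ h₁) _ (ih₂ (I := I.apply (mulToSet D₁)) hdb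
          (hpow (by omega) hT) hA
          (fun j hj => hv j (lt_max_of_lt_right hj)) (fun j hj => ha j (lt_max_of_lt_right hj))
          (fun g hg => hG g (.inr hg)) (fun g hg => hP g (.inr hg)) h₂ f a b h hup)
    · exact Reach.mono (Nat.le_add_right _ _) (key D h₁ f a b hb)
  | letr f' t ρ r ih =>
    obtain ⟨D', h', rfl⟩ := hD
    simp only [Rule.rhos, List.mem_cons, forall_eq_or_imp] at hP
    have hT' := hpow (Nat.le_succ _) hT
    have key : ∀ f a b, D' (f, a, b) ≠ 0 → b ∈ Reach I G P T A r.depth := fun f a b h =>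
      ih hdb hT' hA (fun j hj => hv j (lt_max_of_lt_right hj))
        (fun j hj => ha j (lt_max_of_lt_right hj)) hG hP.2 h' f a b h hup
    simp only [mcollapse] at hb
    split_ifs at hb with h1 h2
    · refine .inr (.inr (.inr ⟨ρ, hP.1, mulVals D' f' (t.val I ζ),
        fun c hc => key _ _ _ (mem_mulVals hc), ?_, h2⟩))
      exact ((finBound_of_mem_updMuls r hd hdb h').card_mulVals _ _).trans hT'
    · exact absurd rfl hb
    · exact .inl (key _ _ _ hb)

end Reach

section Small

/-- The variable `v` is the element with index `i` in the order `M₀`. -/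
def elF : ℕ → ℕ → Fml σ
  | 0, v => minF v (v + 1)
  | i + 1, v => .exA (v + 1) (.and (elF i (v + 1)) (succF (v + 1) v (v + 2)))

@[simp] theorem hasR_elF (b : Bool) (i v : ℕ) : ¬ (elF i v : Fml σ).hasR b := by
  induction i generalizing v with
  | zero => simp [elF]
  | succ i ih => simp [elF, Fml.hasR, ih]

theorem fval_elF {N : ℕ} {e : B ≃ Fin N} {I : Interp σ B} {ζ : Asg B} {Ξ : SOAsg σ B}
    (hO : Ξ.m 0 = ordRel e) (i v : ℕ) : fval I ζ Ξ (elF i v) ↔ (e (ζ.av v) : ℕ) = i := by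
  induction i generalizing v ζ with
  | zero => rw [elF, fval_minF hO (by omega)]
  | succ i ih =>
    simp only [elF, fval_exA, fval, ih, fval_succF hO (show v + 1 ≠ v + 2 by omega)
      (show v ≠ v + 2 by omega), Asg.updA_av, if_true, show v ≠ v + 1 by omega, if_false]
    constructor
    · rintro ⟨a, h1, h2⟩; omega
    · intro h
      have := (e (ζ.av v)).2
      exact ⟨e.symm ⟨i, by omega⟩, by simp, by simp [h]⟩

/-- Transport of an update multiset along an enumeration of the base set. -/
def push {s : ℕ} (e : B ≃ Fin s) (D : UMul σ (Fin s)) : UMul σ B :=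
  fun u => D (u.1, e u.2.1, e u.2.2)

theorem exists_push {s : ℕ} (e : B ≃ Fin s) (D : UMul σ B) : ∃ D', D = push e D' :=
  ⟨fun u => D (u.1, e.symm u.2.1, e.symm u.2.2), by funext u; simp [push]⟩

theorem push_injective {s : ℕ} (e : B ≃ Fin s) :
    Function.Injective (push e : UMul σ (Fin s) → UMul σ B) := by
  intro D D' h
  funext u
  simpa [push] using congrFun h (u.1, e.symm u.2.1, e.symm u.2.2)

/-- `Q` is expressed, over states with `s` elements enumerated along `M₀`, by a formula
without `upd`. -/
def Expr (s : ℕ) (Q : ∀ B : Type, Interp σ B → Asg B → (B ≃ Fin s) → Prop) : Prop :=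
  ∃ ψ : Fml σ, ¬ ψ.hasR true ∧ ∀ (B : Type) (I : Interp σ B) (ζ : Asg B) (Ξ : SOAsg σ B)
    (e : B ≃ Fin s), Ξ.m 0 = ordRel e → (fval I ζ Ξ ψ ↔ Q B I ζ e)

namespace Expr

variable {s : ℕ} {Q Q' : ∀ B : Type, Interp σ B → Asg B → (B ≃ Fin s) → Prop}

theorem congr (h : Expr s Q) (hQ : ∀ B I ζ e, Q B I ζ e ↔ Q' B I ζ e) : Expr s Q' := by
  obtain ⟨ψ, h1, h2⟩ := h
  exact ⟨ψ, h1, fun B I ζ Ξ e hO => (h2 B I ζ Ξ e hO).trans (hQ B I ζ e)⟩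

theorem not (h : Expr s Q) : Expr s fun B I ζ e => ¬ Q B I ζ e := by
  obtain ⟨ψ, h1, h2⟩ := h
  exact ⟨.not ψ, h1, fun B I ζ Ξ e hO => not_congr (h2 B I ζ Ξ e hO)⟩

theorem and (h : Expr s Q) (h' : Expr s Q') :
    Expr s fun B I ζ e => Q B I ζ e ∧ Q' B I ζ e := by
  obtain ⟨ψ, h1, h2⟩ := h
  obtain ⟨ψ', h1', h2'⟩ := h'
  exact ⟨.and ψ ψ', by simp [Fml.hasR, h1, h1'], fun B I ζ Ξ e hO =>
    and_congr (h2 B I ζ Ξ e hO) (h2' B I ζ Ξ e hO)⟩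

theorem or (h : Expr s Q) (h' : Expr s Q') :
    Expr s fun B I ζ e => Q B I ζ e ∨ Q' B I ζ e :=
  (h.not.and h'.not).not.congr fun B I ζ e => by tauto

theorem imp (h : Expr s Q) (h' : Expr s Q') :
    Expr s fun B I ζ e => Q B I ζ e → Q' B I ζ e :=
  (h.and h'.not).not.congr fun B I ζ e => by tauto

theorem const (p : Prop) : Expr (σ := σ) s fun _ _ _ _ => p := by
  by_cases hp : p
  · exact ⟨.tt, by simp, by simp [hp]⟩
  · exact ⟨.not .tt, by simp [Fml.hasR], by simp [hp, fval]⟩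

theorem pfml (φ : PFml σ) : Expr s fun _ I ζ _ => φ.val I ζ :=
  ⟨φ.toF, by simp, by simp⟩

theorem ex {ι : Type} [Finite ι]
    {Q : ι → ∀ B : Type, Interp σ B → Asg B → (B ≃ Fin s) → Prop}
    (h : ∀ i, Expr s (Q i)) : Expr s fun B I ζ e => ∃ i, Q i B I ζ e := by
  have := Fintype.ofFinite ι
  choose ψ h1 h2 using h
  refine ⟨.bigOr (Finset.univ.toList.map ψ), by simp [h1], fun B I ζ Ξ e hO => ?_⟩
  simp [fun i => h2 i B I ζ Ξ e hO]

theorem all {ι : Type} [Finite ι]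
    {Q : ι → ∀ B : Type, Interp σ B → Asg B → (B ≃ Fin s) → Prop}
    (h : ∀ i, Expr s (Q i)) : Expr s fun B I ζ e => ∀ i, Q i B I ζ e :=
  (ex fun i => (h i).not).not.congr fun B I ζ e => by simp

theorem updDb (h : Expr s Q) (x : ℕ) (i : Fin s) :
    Expr s fun B I ζ e => e.symm i ∈ I.db ∧ Q B I (ζ.updDb x (e.symm i)) e := by
  obtain ⟨ψ, h1, h2⟩ := h
  refine ⟨.exDb x (.and (.exA 0 (.and (.eq (.var x) (.avar 0)) (elF i 0))) ψ),
    by simp [Fml.hasR, LTerm.hasR, h1], fun B I ζ Ξ e hO => ?_⟩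
  simp only [fval_exDb, fval, fval_exA, lval, fval_elF hO, h2 _ _ _ _ _ hO, Asg.updA_av,
    Asg.updA_dbv, Asg.updDb_dbv, if_true]
  constructor
  · rintro ⟨a, ha, ⟨b, rfl, hb⟩, hQ⟩
    obtain rfl : a = e.symm i := by rw [Equiv.eq_symm_apply]; exact Fin.ext hb
    exact ⟨ha, hQ⟩
  · rintro ⟨ha, hQ⟩
    exact ⟨_, ha, ⟨_, rfl, by simp⟩, hQ⟩

theorem updA (h : Expr s Q) (v : ℕ) (i : Fin s) :
    Expr s fun B I ζ e => Q B I (ζ.updA v (e.symm i)) e := by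
  obtain ⟨ψ, h1, h2⟩ := h
  refine ⟨.exA v (.and (elF i v) ψ), by simp [Fml.hasR, h1], fun B I ζ Ξ e hO => ?_⟩
  simp only [fval, fval_exA, fval_elF hO, h2 _ _ _ _ _ hO, Asg.updA_av, if_true]
  constructor
  · rintro ⟨a, ha, hQ⟩
    obtain rfl : a = e.symm i := by rw [Equiv.eq_symm_apply]; exact Fin.ext ha
    exact hQ
  · exact fun hQ => ⟨_, by simp, hQ⟩

end Expr

open Classical in
/-- `X n` is the support of the transported update multiset. -/
noncomputable def suppF {s : ℕ} (D : UMul σ (Fin s)) (n : ℕ) : Fml σ :=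
  .allFdyn fun f => .allA 0 (.allA 1 (.iff (.memX n f (.avar 0) (.avar 1))
    (.bigOr (((Finset.univ : Finset (Fin s × Fin s)).filter
      fun q => D (f, q.1, q.2) ≠ 0).toList.map fun q => .and (elF q.1 0) (elF q.2 1)))))

theorem hasR_suppF {s : ℕ} (b : Bool) (D : UMul σ (Fin s)) (n : ℕ) : ¬ (suppF D n).hasR b := by
  simp [suppF, Fml.hasR, LTerm.hasR]

theorem fval_suppF {s : ℕ} {e : B ≃ Fin s} {I : Interp σ B} {ζ : Asg B} {Ξ : SOAsg σ B}
    (hO : Ξ.m 0 = ordRel e) (D : UMul σ (Fin s)) (n : ℕ) :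
    fval I ζ Ξ (suppF D n) ↔ Ξ.x n = mulToSet (push e D) := by
  have hx : ∀ (a : B) (i : Fin s), (e a : ℕ) = i ↔ e a = i := fun a i => Fin.ext_iff.symm
  simp only [suppF, fval_allFdyn, fval, fval_iff, lval, fval_bigOr, List.mem_map,
    Finset.mem_toList, Finset.mem_filter, Finset.mem_univ, true_and,
    Asg.updA_av, Set.ext_iff, Prod.forall, mulToSet, push, Set.mem_ofPred_eq,
    Prod.exists]
  simp [hx, fval, fval_elF hO]

open Classical in
/-- The tokens in `Ẍ 0` represent the transported update multiset. -/
noncomputable def tokF {s : ℕ} (D : UMul σ (Fin s)) : Fml σ :=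
  .allFdyn fun f => .allA 0 (.allA 1 (.allA 2 (.iff (.memXm 0 f (.avar 0) (.avar 1) (.avar 2))
    (.bigOr (((Finset.univ : Finset (Fin s × Fin s × Fin s)).filter
      fun q => (q.2.2 : ℕ) < D (f, q.1, q.2.1)).toList.map fun q =>
        .and (elF q.1 0) (.and (elF q.2.1 1) (elF q.2.2 2)))))))

theorem hasR_tokF {s : ℕ} (b : Bool) (D : UMul σ (Fin s)) : ¬ (tokF D).hasR b := by
  simp [tokF, Fml.hasR, LTerm.hasR]

theorem fval_tokF {s : ℕ} {e : B ≃ Fin s} {I : Interp σ B} {ζ : Asg B} {Ξ : SOAsg σ B}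
    (hO : Ξ.m 0 = ordRel e) (D : UMul σ (Fin s)) :
    fval I ζ Ξ (tokF D) ↔ Ξ.xm 0 = {u | (e u.2.2.2 : ℕ) < push e D (u.1, u.2.1, u.2.2.1)} := by
  have hx : ∀ (a : B) (i : Fin s), (e a : ℕ) = i ↔ e a = i := fun a i => Fin.ext_iff.symm
  simp only [tokF, fval_allFdyn, fval, fval_iff, lval, fval_bigOr, List.mem_map,
    Finset.mem_toList, Finset.mem_filter, Finset.mem_univ, true_and,
    Asg.updA_av, Set.ext_iff, Prod.forall, push, Set.mem_ofPred_eq,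
    Prod.exists]
  simp [hx, fval, fval_elF hO]

theorem Expr.box {s : ℕ} {Q : ∀ B : Type, Interp σ B → Asg B → (B ≃ Fin s) → Prop}
    (h : Expr s Q) (D : UMul σ (Fin s)) :
    Expr s fun B I ζ e => consistentU (mulToSet (push e D)) ∧
      Q B (I.apply (mulToSet (push e D))) ζ e := by
  obtain ⟨ψ, h1, h2⟩ := h
  refine ⟨.exX 0 (.and (suppF D 0) (.and (conUSetF 0) (.box 0 ψ))),
    by simp [Fml.hasR, hasR_suppF, h1], fun B I ζ Ξ e hO => ?_⟩
  have : Finite B := .of_equiv _ e.symm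
  have hO' : ∀ P, (Ξ.uX 0 P).m 0 = ordRel e := fun P => hO
  simp only [fval_exX, fval, fval_suppF (hO' _), fval_conUSetF, h2 _ _ _ _ _ (hO' _),
    SOAsg.uX_x, if_true]
  constructor
  · rintro ⟨P, -, rfl, hc, h | h⟩
    · exact absurd hc h
    · exact ⟨hc, h⟩
  · rintro ⟨hc, h⟩
    exact ⟨_, Set.toFinite _, rfl, hc, .inr h⟩

theorem ncard_lt_enum {s : ℕ} (e : B ≃ Fin s) {m : ℕ} (hm : m ≤ s) :
    {p : B | (e p : ℕ) < m}.ncard = m := by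
  have h : {p : B | (e p : ℕ) < m} = e ⁻¹' (Set.range (Fin.castLE hm)) := by
    ext p
    simp only [Set.mem_ofPred_eq, Set.mem_preimage, Set.mem_range]
    exact ⟨fun hp => ⟨⟨e p, hp⟩, rfl⟩, by rintro ⟨q, hq⟩; rw [← hq]; exact q.2⟩
  rw [h, Set.ncard_preimage_of_injective_subset_range e.injective (by simp),
    ← Set.image_univ, Set.ncard_image_of_injective _ (Fin.castLE_injective hm)]
  simp

theorem Expr.upm {s : ℕ} (r : Rule σ) (D : UMul σ (Fin s)) (hD : ∀ u, D u ≤ s) :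
    Expr s fun _ I ζ e => push e D ∈ updMuls r I ζ := by
  refine ⟨.exXm 0 (.and (tokF D) (.upm r 0)), by simp [Fml.hasR, hasR_tokF],
    fun B I ζ Ξ e hO => ?_⟩
  have : Finite B := .of_equiv _ e.symm
  have hO' : ∀ P, (Ξ.uXm 0 P).m 0 = ordRel e := fun P => hO
  have hn : ∀ u : Upd σ B, {p : B | (e p : ℕ) < push e D u}.ncard = push e D u :=
    fun u => ncard_lt_enum e (hD _)
  simp only [fval_exXm, fval, fval_tokF (hO' _), SOAsg.uXm_xm, if_true]
  constructor
  · rintro ⟨P, -, rfl, h⟩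
    simpa [hn] using h
  · intro h
    exact ⟨_, Set.toFinite _, rfl, by simpa [hn] using h⟩

end Small

section SmallRules

/-- The assignment binding the first `k` algorithmic variables to the first `k` elements. -/
def Asg.enum {s : ℕ} (ζ : Asg B) (e : B ≃ Fin s) (k : ℕ) (hk : k ≤ s) : Asg B :=
  { ζ with av := fun v => if h : v < k then e.symm ⟨v, h.trans_le hk⟩ else ζ.av v }

theorem Expr.enum {s : ℕ} {Q : ∀ B : Type, Interp σ B → Asg B → (B ≃ Fin s) → Prop}
    (h : Expr s Q) (k : ℕ) (hk : k ≤ s) : Expr s fun B I ζ e => Q B I (ζ.enum e k hk) e := by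
  induction k with
  | zero => exact h.congr fun B I ζ e => by simp [Asg.enum]
  | succ k ih =>
    refine ((ih (by omega)).updA k ⟨k, hk⟩).congr fun B I ζ e => ?_
    have : (ζ.updA k (e.symm ⟨k, hk⟩)).enum e k (by omega) = ζ.enum e (k + 1) hk := by
      simp only [Asg.enum, Asg.updA, Asg.mk.injEq, true_and]
      funext v
      rcases lt_trichotomy v k with hv | rfl | hv
      · simp [hv, hv.trans (Nat.lt_succ_self k)]
      · simp
      · simp [show ¬ v < k by omega, show ¬ v < k + 1 by omega, show v ≠ k by omega]
    rw [this]

/-- A rule yielding the empty update multiset. -/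
def Rule.skip (f : σ.F) : Rule σ :=
  .cond (.not (.eq (.var 0) (.var 0))) (.assign f (.var 0) (.var 0))

@[simp] theorem updMuls_skip (f : σ.F) (I : Interp σ B) (ζ : Asg B) :
    updMuls (.skip f) I ζ = {fun _ => 0} := by
  simp [Rule.skip, updMuls, PFml.val]

/-- The update multiset with the single update `u`. -/
def oneU [DecidableEq B] (u : Upd σ B) : UMul σ B := fun v => if v = u then 1 else 0

/-- The rule assigning to `f (avar w)` all the values `avar j`, `j ∈ L`, in parallel. -/
def assignAll (f : σ.F) (w : ℕ) (L : List ℕ) : Rule σ :=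
  L.foldr (fun j r => .par (.assign f (.avar w) (.avar j)) r) (.skip f)

open Classical in
theorem updMuls_assignAll (f : σ.F) (w : ℕ) (L : List ℕ) (I : Interp σ B) (ζ : Asg B) :
    updMuls (assignAll f w L) I ζ =
      {fun u => if u.1 = f ∧ u.2.1 = ζ.av w then (L.map ζ.av).count u.2.2 else 0} := by
  induction L with
  | nil => simp [assignAll]
  | cons j L ih =>
    have : assignAll f w (j :: L) = .par (.assign f (.avar w) (.avar j)) (assignAll f w L) := rfl
    rw [this]
    simp only [updMuls, ih, Set.mem_ofPred_eq, Set.mem_singleton_iff, exists_eq_left]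
    ext D
    simp only [Set.mem_ofPred_eq, Set.mem_singleton_iff]
    refine Eq.congr_right ?_
    funext ⟨f', a, b⟩
    simp only [PTerm.val, Prod.mk.injEq, List.map_cons, List.count_cons, beq_iff_eq]
    by_cases h1 : f' = f ∧ a = ζ.av w
    · simp only [h1, true_and, and_self, if_true, eq_comm (a := b)]
      omega
    · rw [if_neg h1, if_neg h1, if_neg (by tauto)]

open Classical in
theorem mcollapse_zero_off (I : Interp σ B) (f : σ.F) (a : B) (ρ : σ.Rho) (D : UMul σ B)
    (h : ∀ u : Upd σ B, ¬ (u.1 = f ∧ u.2.1 = a) → D u = 0) :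
    mcollapse I f a ρ D = oneU (f, a, I.lop ρ (mulVals D f a)) := by
  funext ⟨f', a', b⟩
  by_cases h1 : f' = f ∧ a' = a
  · simp [mcollapse, oneU, h1]
  · rw [mcollapse, if_neg h1, h _ h1, oneU, if_neg (by simp; tauto)]

theorem push_oneU [DecidableEq B] {s : ℕ} (e : B ≃ Fin s) (f : σ.F) (i j : Fin s) :
    push e (oneU (f, i, j)) = oneU (f, e.symm i, e.symm j) := by
  funext u
  simp [push, oneU, Prod.ext_iff, Equiv.eq_symm_apply]

theorem oneU_injective [DecidableEq B] : Function.Injective (oneU : Upd σ B → UMul σ B) := by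
  intro u v h
  have := congrFun h u
  by_contra hne
  simp [oneU, hne] at this

theorem Expr.lop {s : ℕ} (f : σ.F) (ρ : σ.Rho) (M : Multiset (Fin s)) (w : Fin s) :
    Expr s fun _ I _ e => I.lop ρ (M.map e.symm) = e.symm w := by
  classical
  induction M using Quotient.inductionOn with | _ L
  refine ((Expr.upm (.letr f (.avar w) ρ (assignAll f w (L.map Fin.val))) (oneU (f, w, w))
    (fun u => ?_)).enum s le_rfl).congr fun B I ζ e => ?_
  · have := w.2
    rw [oneU]; split_ifs <;> omega
  · have : Finite B := .of_equiv _ e.symm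
    have hw : (ζ.enum e s le_rfl).av w = e.symm w := by simp [Asg.enum]
    have hL : (L.map Fin.val).map (ζ.enum e s le_rfl).av = L.map e.symm := by
      rw [List.map_map]
      exact List.map_congr_left fun i _ => by simp [Asg.enum]
    simp only [updMuls, updMuls_assignAll, Set.mem_singleton_iff, exists_eq_left,
      Set.mem_ofPred_eq, PTerm.val, hw, hL]
    rw [mcollapse_zero_off _ _ _ _ _ fun u hu => if_neg hu, push_oneU, oneU_injective.eq_iff]
    have hM : mulVals (fun u : Upd σ B => if u.1 = f ∧ u.2.1 = e.symm w then
        (L.map e.symm).count u.2.2 else 0) f (e.symm w) = ((L : Multiset (Fin s)).map e.symm) := by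
      ext b
      rw [count_mulVals (Set.toFinite _)]
      simp
    rw [hM]
    simp [eq_comm]

theorem Expr.term {s : ℕ} (f : σ.F) (t : PTerm σ) (i : Fin s) :
    Expr s fun _ I ζ e => t.val I ζ = e.symm i := by
  classical
  refine (Expr.upm (.assign f t t) (oneU (f, i, i)) (fun u => ?_)).congr fun B I ζ e => ?_
  · have := i.2
    rw [oneU]; split_ifs <;> omega
  · have h : updMuls (.assign f t t) I ζ = {oneU (f, t.val I ζ, t.val I ζ)} := by
      ext D
      simp only [updMuls, Set.mem_ofPred_eq, Set.mem_singleton_iff]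
      refine Eq.congr_right ?_
      funext u
      simp [oneU]
    rw [h, push_oneU, Set.mem_singleton_iff, oneU_injective.eq_iff]
    simp [eq_comm]

end SmallRules

section SmallInduction

theorem push_mseqComp {s : ℕ} (e : B ≃ Fin s) (D₁ D₂ : UMul σ (Fin s)) :
    push e (mseqComp D₁ D₂) = mseqComp (push e D₁) (push e D₂) := by
  classical
  funext u
  have hiff : (∀ b : Fin s, D₂ (u.1, e u.2.1, b) = 0) ↔ ∀ b : B, push e D₂ (u.1, u.2.1, b) = 0 :=
    (e.forall_congr_right (q := fun b => D₂ (u.1, e u.2.1, b) = 0)).symm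
  rw [push, mseqComp, mseqComp]
  by_cases h : ∀ b : B, push e D₂ (u.1, u.2.1, b) = 0
  · rw [if_pos h, if_pos (hiff.2 h)]; rfl
  · rw [if_neg h, if_neg (mt hiff.1 h)]; rfl

open Classical in
theorem mulVals_push {s : ℕ} (e : B ≃ Fin s) (D : UMul σ (Fin s)) (f : σ.F) (i : Fin s) :
    mulVals (push e D) f (e.symm i) = (mulVals D f i).map e.symm := by
  have : Finite B := .of_equiv _ e.symm
  ext b
  obtain ⟨j, rfl⟩ := e.symm.surjective b
  rw [count_mulVals (Set.toFinite _), Multiset.count_map_eq_count' _ _ e.symm.injective,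
    count_mulVals (Set.toFinite _)]
  simp [push]

theorem mem_updMuls_le {s : ℕ} (e : B ≃ Fin s) {r : Rule σ} {I : Interp σ B} {ζ : Asg B}
    {D : UMul σ B} (h : D ∈ updMuls r I ζ) (u : Upd σ B) : D u ≤ (max s 2) ^ r.deg := by
  refine (finBound_of_mem_updMuls r (le_max_right _ _) ?_ h).le u
  have : Finite B := .of_equiv _ e.symm
  refine le_max_of_le_left ((Set.ncard_le_ncard (Set.subset_univ _)).trans ?_)
  rw [Set.ncard_univ, Nat.card_congr e, Nat.card_fin]

/-- Every update multiset yielded over a base set with `s` elements is coded by a function into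
a finite type depending on `s` and the rule only. -/
theorem exists_code_of_mem {s : ℕ} (e : B ≃ Fin s) {r : Rule σ} {I : Interp σ B} {ζ : Asg B}
    {D : UMul σ B} (h : D ∈ updMuls r I ζ) :
    ∃ d : Upd σ (Fin s) → Fin ((max s 2) ^ r.deg + 1), D = push e fun u => d u := by
  obtain ⟨D', rfl⟩ := exists_push e D
  refine ⟨fun u => ⟨D' u, Nat.lt_succ_of_le ?_⟩, rfl⟩
  simpa [push] using mem_updMuls_le e h (u.1, e.symm u.2.1, e.symm u.2.2)

theorem expr_mem_updMuls (r : Rule σ) {s : ℕ} (D : UMul σ (Fin s)) :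
    Expr s fun _ I ζ e => push e D ∈ updMuls r I ζ := by
  classical
  induction r generalizing D with
  | assign f t v =>
    by_cases hD : ∀ u, D u ≤ s
    · exact .upm _ _ hD
    · refine (Expr.const False).congr fun B I ζ e => ⟨False.elim, fun h => hD fun u => ?_⟩
      have h1 : 1 ≤ s := by have := (e (ζ.av 0)).2; omega
      have := mem_updMuls_le e h (u.1, e.symm u.2.1, e.symm u.2.2)
      simp only [push, Rule.deg, Equiv.apply_symm_apply, pow_zero] at this
      exact this.trans h1
  | cond φ r ih =>
    refine (((Expr.pfml φ).and (ih D)).or ((Expr.pfml φ).not.and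
      (Expr.const (D = fun _ => 0)))).congr fun B I ζ e => ?_
    have h0 : push e D = (fun _ => 0) ↔ D = fun _ => 0 :=
      (push_injective e).eq_iff (b := fun _ => 0)
    by_cases h : φ.val I ζ <;> simp [updMuls, h, h0]
  | forall_ x φ r ih =>
    have hφ : ∀ i : Fin s, Expr s fun _ I ζ e => e.symm i ∈ I.db ∧ φ.val I (ζ.updDb x (e.symm i)) :=
      fun i => (Expr.pfml φ).updDb x i
    have hr : ∀ (g : Fin s → Upd σ (Fin s) → Fin ((max s 2) ^ r.deg + 1)) (i : Fin s),
        Expr s fun _ I ζ e => e.symm i ∈ I.db ∧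
          (push e fun u => g i u) ∈ updMuls r I (ζ.updDb x (e.symm i)) :=
      fun g i => (ih fun u => g i u).updDb x i
    refine (Expr.ex fun g : Fin s → Upd σ (Fin s) → Fin ((max s 2) ^ r.deg + 1) =>
      (Expr.all fun i => ((hφ i).imp (hr g i)).and ((hφ i).not.imp
        (Expr.const (∀ u, g i u = 0)))).and
      (Expr.const (D = fun u => ∑ i, (g i u : ℕ)))).congr fun B I ζ e => ?_
    have hsum : ∀ g : B → UMul σ B, (∀ a, a ∉ I.db → g a = fun _ => 0) → ∀ u,
        ∑ a ∈ I.db_fin.toFinset, g a u = ∑ i, g (e.symm i) u := by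
      intro g hg u
      have : Fintype B := Fintype.ofEquiv _ e.symm
      rw [Equiv.sum_comp e.symm (fun a => g a u)]
      exact Finset.sum_subset (Finset.subset_univ _) fun a _ ha => by
        simp [hg a (by simpa using ha)]
    constructor
    · rintro ⟨g, h, rfl⟩
      have h0 : ∀ a : B, ¬ (a ∈ I.db ∧ φ.val I (ζ.updDb x a)) →
          (push e fun u => (g (e a) u : ℕ)) = fun _ => 0 := by
        intro a ha
        funext u
        simp [push, (h (e a)).2 (by simpa using ha)]
      refine ⟨fun a => push e fun u => g (e a) u, fun a ha hφ => ?_, h0, ?_⟩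
      · simpa using ((h (e a)).1 (by simpa using ⟨ha, hφ⟩)).2
      · funext u
        rw [hsum (fun a => push e fun u => (g (e a) u : ℕ)) fun a ha => h0 a fun h => ha h.1]
        simp [push]
    · rintro ⟨g, h1, h2, h3⟩
      have hc : ∀ i, ∃ d : Upd σ (Fin s) → Fin ((max s 2) ^ r.deg + 1),
          g (e.symm i) = push e fun u => d u := by
        intro i
        by_cases hi : e.symm i ∈ I.db ∧ φ.val I (ζ.updDb x (e.symm i))
        · exact exists_code_of_mem e (h1 _ hi.1 hi.2)
        · exact ⟨fun _ => 0, by rw [h2 _ hi]; rfl⟩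
      choose d hd using hc
      refine ⟨d, fun i => ⟨fun hi => ⟨hi.1, ?_⟩, fun hi u => ?_⟩, push_injective e ?_⟩
      · rw [← hd]; exact h1 _ hi.1 hi.2
      · have := congrFun ((hd i).symm.trans (h2 _ hi)) (u.1, e.symm u.2.1, e.symm u.2.2)
        simp only [push, Equiv.apply_symm_apply] at this
        exact Fin.ext this
      · rw [h3]
        funext u
        rw [hsum g fun a ha => h2 a fun h => ha h.1]
        simp only [hd, push]
  | choose x φ r ih =>
    refine (Expr.ex fun i : Fin s => ((Expr.pfml φ).and (ih D)).updDb x i).congr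
      fun B I ζ e => ?_
    exact ⟨fun ⟨i, h1, h2, h3⟩ => ⟨_, h1, h2, h3⟩, fun ⟨a, h1, h2, h3⟩ =>
      ⟨e a, by simpa using h1, by simpa using h2, by simpa using h3⟩⟩
  | par r₁ r₂ ih₁ ih₂ =>
    refine (Expr.ex fun d₁ : Upd σ (Fin s) → Fin ((max s 2) ^ r₁.deg + 1) =>
      Expr.ex fun d₂ : Upd σ (Fin s) → Fin ((max s 2) ^ r₂.deg + 1) =>
        ((ih₁ fun u => d₁ u).and (ih₂ fun u => d₂ u)).and
          (Expr.const (D = fun u => (d₁ u + d₂ u : ℕ)))).congr fun B I ζ e => ?_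
    constructor
    · rintro ⟨d₁, d₂, ⟨h₁, h₂⟩, rfl⟩
      exact ⟨_, h₁, _, h₂, rfl⟩
    · rintro ⟨D₁, h₁, D₂, h₂, h⟩
      obtain ⟨d₁, rfl⟩ := exists_code_of_mem e h₁
      obtain ⟨d₂, rfl⟩ := exists_code_of_mem e h₂
      exact ⟨d₁, d₂, ⟨h₁, h₂⟩, push_injective e h⟩
  | seq r₁ r₂ ih₁ ih₂ =>
    refine ((Expr.ex fun d₁ : Upd σ (Fin s) → Fin ((max s 2) ^ r₁.deg + 1) =>
      Expr.ex fun d₂ : Upd σ (Fin s) → Fin ((max s 2) ^ r₂.deg + 1) =>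
        ((ih₁ fun u => d₁ u).and ((ih₂ fun u => d₂ u).box fun u => d₁ u)).and
          (Expr.const (D = mseqComp (fun u => d₁ u) (fun u => d₂ u)))).or
      ((ih₁ D).and ((Expr.const True).box D).not)).congr fun B I ζ e => ?_
    constructor
    · rintro (⟨d₁, d₂, ⟨h₁, hc, h₂⟩, rfl⟩ | ⟨h, hc⟩)
      · exact .inl ⟨_, h₁, hc, _, h₂, push_mseqComp e _ _⟩
      · exact .inr ⟨h, by simpa using hc⟩
    · rintro (⟨D₁, h₁, hc, D₂, h₂, h⟩ | ⟨h, hc⟩)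
      · obtain ⟨d₁, rfl⟩ := exists_code_of_mem e h₁
        obtain ⟨d₂, rfl⟩ := exists_code_of_mem e h₂
        exact .inl ⟨d₁, d₂, ⟨h₁, hc, h₂⟩, push_injective e (h.trans (push_mseqComp e _ _).symm)⟩
      · exact .inr ⟨h, by simpa using hc⟩
  | letr f t ρ r ih =>
    refine (Expr.ex fun d : Upd σ (Fin s) → Fin ((max s 2) ^ r.deg + 1) =>
      Expr.ex fun i : Fin s => Expr.ex fun w : Fin s =>
        ((ih fun u => d u).and ((Expr.term f t i).and
          (Expr.lop f ρ (mulVals (fun u => (d u : ℕ)) f i) w))).and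
        (Expr.const (D = fun u => if u.1 = f ∧ u.2.1 = i then (if u.2.2 = w then 1 else 0)
          else (d u : ℕ)))).congr fun B I ζ e => ?_
    have key : ∀ (d : Upd σ (Fin s) → Fin ((max s 2) ^ r.deg + 1)) (i w : Fin s),
        I.lop ρ ((mulVals (fun u => (d u : ℕ)) f i).map e.symm) = e.symm w →
        push e (fun u => if u.1 = f ∧ u.2.1 = i then (if u.2.2 = w then 1 else 0)
          else (d u : ℕ)) = mcollapse I f (e.symm i) ρ (push e fun u => d u) := by
      intro d i w hw
      funext u
      simp only [push, mcollapse, mulVals_push, hw, Equiv.eq_symm_apply]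
    constructor
    · rintro ⟨d, i, w, ⟨h, hi, hw⟩, rfl⟩
      exact ⟨_, h, by rw [key d i w hw, hi]⟩
    · rintro ⟨D', h, hD⟩
      obtain ⟨d, rfl⟩ := exists_code_of_mem e h
      have hw : I.lop ρ ((mulVals (fun u => (d u : ℕ)) f (e (t.val I ζ))).map e.symm) =
          e.symm (e (I.lop ρ ((mulVals (fun u => (d u : ℕ)) f (e (t.val I ζ))).map e.symm))) := by
        simp
      refine ⟨d, e (t.val I ζ), _, ⟨h, by simp, hw⟩, push_injective e ?_⟩
      rw [hD, key d _ _ hw]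
      simp

/-- Over base sets with `s` elements enumerated along `M₀`, the update sets yielded by a rule are
expressed without `upd`. -/
theorem exists_small (r : Rule σ) (n s : ℕ) : ∃ ψ : Fml σ, ¬ ψ.hasR true ∧
    ∀ (B : Type) (I : Interp σ B) (ζ : Asg B) (Ξ : SOAsg σ B) (e : B ≃ Fin s),
      Ξ.m 0 = ordRel e → (fval I ζ Ξ ψ ↔ Ξ.x n ∈ updSets r I ζ) := by
  choose ψ h1 h2 using fun D : UMul σ (Fin s) => expr_mem_updMuls r D
  let ι := Upd σ (Fin s) → Fin ((max s 2) ^ r.deg + 1)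
  refine ⟨.bigOr ((Finset.univ : Finset ι).toList.map fun d =>
      .and (ψ fun u => d u) (suppF (fun u => d u) n)), by simp [Fml.hasR, hasR_suppF, h1],
    fun B I ζ Ξ e hO => ?_⟩
  simp only [fval_bigOr, List.mem_map, Finset.mem_toList, Finset.mem_univ, true_and,
    exists_exists_eq_and, fval, h2 _ _ _ _ _ _ hO, fval_suppF hO, mem_updSets_iff]
  constructor
  · rintro ⟨d, h, hx⟩
    exact ⟨_, h, hx.symm⟩
  · rintro ⟨D, h, hx⟩
    obtain ⟨d, rfl⟩ := exists_code_of_mem e h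
    exact ⟨d, h, hx.symm⟩

end SmallInduction

section Large

variable {N : ℕ} {e : B ≃ Fin N} {I : Interp σ B} {ζ : Asg B} {Ξ : SOAsg σ B}

theorem num_eq_iff {s t : B → Prop} : num e s = num e t ↔ ∀ b, (s b ↔ t b) :=
  ⟨num_inj e, num_congr e⟩

/-- The update multiset whose multiplicities are given in binary by a set of tokens. -/
noncomputable def dec (e : B ≃ Fin N) (X : Set (σ.F × B × B × B)) : UMul σ B :=
  fun u => num e fun p => (u.1, u.2.1, u.2.2, p) ∈ X

theorem exists_dec (e : B ≃ Fin N) {D : UMul σ B} (h : ∀ u, D u < 2 ^ N) :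
    ∃ X, dec e X = D := by
  choose s hs using fun u => num_surj e (h u)
  exact ⟨{q | s (q.1, q.2.1, q.2.2.1) q.2.2.2}, funext hs⟩

theorem dec_eq_zero {X : Set (σ.F × B × B × B)} {u : Upd σ B} :
    dec e X u = 0 ↔ ∀ p, (u.1, u.2.1, u.2.2, p) ∉ X := num_eq_zero e

/-- The update multiset represented by a set of tokens. -/
noncomputable def tok (X : Set (σ.F × B × B × B)) : UMul σ B :=
  fun u => {p | (u.1, u.2.1, u.2.2, p) ∈ X}.ncard

theorem exists_tok (e : B ≃ Fin N) {D : UMul σ B} (h : ∀ u, D u ≤ N) : ∃ X, tok X = D :=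
  ⟨{q | (e q.2.2.2 : ℕ) < D (q.1, q.2.1, q.2.2.1)}, funext fun u => ncard_lt_enum e (h u)⟩

theorem tok_ne_zero [Finite B] {X : Set (σ.F × B × B × B)} {u : Upd σ B} :
    tok X u ≠ 0 ↔ ∃ p, (u.1, u.2.1, u.2.2, p) ∈ X := by
  rw [tok, ne_eq, Set.ncard_eq_zero, ← ne_eq, ← Set.nonempty_iff_ne_empty]; rfl

/-- The base set is large compared to the exponent `k`. -/
def Big (k N : ℕ) : Prop := k + 10 ≤ N ∧ N ^ k < 2 ^ N

theorem Big.mono {j k : ℕ} (h : Big k N) (hjk : j ≤ k) : Big j N :=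
  ⟨by have := h.1; omega, (Nat.pow_le_pow_right (by have := h.1; omega) hjk).trans_lt h.2⟩

theorem ncard_db_le (e : B ≃ Fin N) (I : Interp σ B) : I.db.ncard ≤ N := by
  have : Finite B := .of_equiv _ e.symm
  refine (Set.ncard_le_ncard (Set.subset_univ _)).trans ?_
  rw [Set.ncard_univ, Nat.card_congr e, Nat.card_fin]

theorem lt_two_pow_of_mem (e : B ≃ Fin N) {r : Rule σ} (hN : Big r.deg N)
    {D : UMul σ B} (h : D ∈ updMuls r I ζ) (u : Upd σ B) : D u < 2 ^ N :=
  ((finBound_of_mem_updMuls r (by have := hN.1; omega) (ncard_db_le e I) h).le u).trans_lt hN.2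

/-- Universal quantification over all updates. -/
noncomputable def allU (k : σ.F → Fml σ) : Fml σ := .allFdyn fun f => .allA 0 (.allA 1 (k f))

@[simp] theorem fval_allU (k : σ.F → Fml σ) :
    fval I ζ Ξ (allU k) ↔ ∀ f a b, fval I ((ζ.updA 0 a).updA 1 b) Ξ (k f) := by
  simp [allU, fval]

@[simp] theorem hasR_allU (b : Bool) (k : σ.F → Fml σ) :
    (allU k).hasR b ↔ ∃ f, (k f).hasR b := by
  simp [allU, Fml.hasR]

/-- The digit at position `4` of the multiplicity of the update given by `0` and `1`. -/
def digF (n : ℕ) (f : σ.F) : Fml σ := .memXm n f (.avar 0) (.avar 1) (.avar 4)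

@[simp] theorem hasR_digF (b : Bool) (n : ℕ) (f : σ.F) : ¬ (digF n f).hasR b := by
  simp [digF, Fml.hasR, LTerm.hasR]

theorem fval_digF (n : ℕ) (f : σ.F) :
    fval I ζ Ξ (digF n f) ↔ (f, ζ.av 0, ζ.av 1, ζ.av 4) ∈ Ξ.xm n := Iff.rfl

/-- Two multiplicities agree. -/
def eqDigF (n m : ℕ) (f : σ.F) : Fml σ := .allA 4 (.iff (digF n f) (digF m f))

@[simp] theorem hasR_eqDigF (b : Bool) (n m : ℕ) (f : σ.F) : ¬ (eqDigF n m f).hasR b := by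
  simp [eqDigF, Fml.hasR]

theorem fval_eqDigF (e : B ≃ Fin N) (n m : ℕ) (f : σ.F) :
    fval I ζ Ξ (eqDigF n m f) ↔
      dec e (Ξ.xm n) (f, ζ.av 0, ζ.av 1) = dec e (Ξ.xm m) (f, ζ.av 0, ζ.av 1) := by
  simp [eqDigF, fval, fval_digF, dec, num_eq_iff]

/-- The rule `r` is expressed without `upd` on large base sets, with multiplicities in binary. -/
def LExpr (r : Rule σ) : Prop :=
  ∀ n : ℕ, ∃ ψ : Fml σ, ¬ ψ.hasR true ∧ ∀ (B : Type) (I : Interp σ B) (ζ : Asg B)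
    (Ξ : SOAsg σ B) (N : ℕ) (e : B ≃ Fin N), Ξ.m 0 = ordRel e → Big r.deg N → 2 ≤ I.db.ncard →
      (fval I ζ Ξ ψ ↔ dec e (Ξ.xm n) ∈ updMuls r I ζ)

theorem LExpr.assign (f : σ.F) (t v : PTerm σ) : LExpr (.assign f t v) := by
  classical
  intro n
  refine ⟨.exXm (n + 1) (.and (.upm (.assign f t v) (n + 1)) (allU fun f' => .allA 4
    (.iff (digF n f') (.and (minF 4 6) (.exA 2 (.memXm (n + 1) f' (.avar 0) (.avar 1)
      (.avar 2))))))), by simp [Fml.hasR, LTerm.hasR], fun B I ζ Ξ N e hO hN hd => ?_⟩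
  have hfin : Finite B := .of_equiv _ e.symm
  have hO' : ∀ P, (Ξ.uXm (n + 1) P).m 0 = ordRel e := fun P => hO
  have hN1 : 10 ≤ N := by have := hN.1; omega
  have hu : updMuls (.assign f t v) I ζ = {oneU (f, t.val I ζ, v.val I ζ)} := by
    ext D
    simp only [updMuls, Set.mem_ofPred_eq, Set.mem_singleton_iff]
    refine Eq.congr_right ?_
    funext u
    simp [oneU]
  have key : ∀ P, fval I ζ (Ξ.uXm (n + 1) P) (.and (.upm (.assign f t v) (n + 1))
      (allU fun f' => .allA 4 (.iff (digF n f')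
        (.and (minF 4 6) (.exA 2 (.memXm (n + 1) f' (.avar 0)
        (.avar 1) (.avar 2))))))) ↔ tok P = oneU (f, t.val I ζ, v.val I ζ) ∧
      ∀ u : Upd σ B, ∀ p, ((u.1, u.2.1, u.2.2, p) ∈ Ξ.xm n ↔ (e p : ℕ) = 0 ∧ tok P u ≠ 0) := by
    intro P
    simp only [fval, hu, fval_allU, fval_iff, fval_digF, fval_minF (hO' P) (show 4 ≠ 6 by decide),
      fval_exA, lval, tok_ne_zero, Prod.forall]
    simp
    exact fun _ => Iff.rfl
  simp only [fval_exXm, key, hu, Set.mem_singleton_iff]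
  have key2 : ∀ u : Upd σ B, dec e (Ξ.xm n) u = oneU (f, t.val I ζ, v.val I ζ) u ↔
      ∀ p, ((u.1, u.2.1, u.2.2, p) ∈ Ξ.xm n ↔
        (e p : ℕ) = 0 ∧ oneU (f, t.val I ζ, v.val I ζ) u ≠ 0) := by
    intro u
    rw [oneU]
    split_ifs
    · rw [dec, num_eq_one e (by omega)]; simp
    · rw [dec_eq_zero]; simp
  rw [funext_iff, forall_congr' key2]
  constructor
  · rintro ⟨P, -, hP, h⟩
    rwa [hP] at h
  · intro h
    obtain ⟨P, hP⟩ := exists_tok e (D := oneU (f, t.val I ζ, v.val I ζ))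
      (fun u => by rw [oneU]; split_ifs <;> omega)
    exact ⟨P, Set.toFinite _, hP, by rwa [hP]⟩

theorem LExpr.cond (φ : PFml σ) {r : Rule σ} (hr : LExpr r) : LExpr (.cond φ r) := by
  intro n
  obtain ⟨ψ, h1, h2⟩ := hr n
  refine ⟨.or (.and φ.toF ψ) (.and (.not φ.toF) (allU fun f => .allA 4 (.not (digF n f)))),
    by simp [Fml.hasR, h1], fun B I ζ Ξ N e hO hN hd => ?_⟩
  have h0 : dec e (Ξ.xm n) = (fun _ => 0) ↔ ∀ f a b p, (f, a, b, p) ∉ Ξ.xm n := by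
    simp [funext_iff, dec_eq_zero]
  have h3 := h2 B I ζ Ξ N e hO hN hd
  by_cases h : φ.val I ζ <;> simp [updMuls, h, h0, fval, h3, fval_digF]

theorem LExpr.choose (x : ℕ) (φ : PFml σ) {r : Rule σ} (hr : LExpr r) :
    LExpr (.choose x φ r) := by
  intro n
  obtain ⟨ψ, h1, h2⟩ := hr n
  refine ⟨.exDb x (.and φ.toF ψ), by simp [Fml.hasR, h1], fun B I ζ Ξ N e hO hN hd => ?_⟩
  have h3 := fun ζ => h2 B I ζ Ξ N e hO hN hd
  simp [fval, h3, updMuls]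

theorem LExpr.par {r₁ r₂ : Rule σ} (hr₁ : LExpr r₁) (hr₂ : LExpr r₂) : LExpr (.par r₁ r₂) := by
  intro n
  obtain ⟨ψ₁, h1, h2⟩ := hr₁ (n + 1)
  obtain ⟨ψ₂, h1', h2'⟩ := hr₂ (n + 2)
  refine ⟨.exXm (n + 1) (.exXm (n + 2) (.and ψ₁ (.and ψ₂
    (allU fun f => addF (digF (n + 1) f) (digF (n + 2) f) (digF n f))))),
    by simp [Fml.hasR, h1, h1'], fun B I ζ Ξ N e hO hN hd => ?_⟩
  have hfin : Finite B := .of_equiv _ e.symm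
  have hN₁ : Big r₁.deg N := hN.mono (by simp only [Rule.deg]; omega)
  have hN₂ : Big r₂.deg N := hN.mono (by simp only [Rule.deg]; omega)
  have hadd : ∀ P P' f a b, fval I ((ζ.updA 0 a).updA 1 b) ((Ξ.uXm (n + 1) P).uXm (n + 2) P')
      (addF (digF (n + 1) f) (digF (n + 2) f) (digF n f)) ↔
      dec e P (f, a, b) + dec e P' (f, a, b) = dec e (Ξ.xm n) (f, a, b) := by
    intro P P' f a b
    have hO' : ((Ξ.uXm (n + 1) P).uXm (n + 2) P').m 0 = ordRel e := hO
    exact fval_addF (s₁ := fun p => (f, a, b, p) ∈ P) (s₂ := fun p => (f, a, b, p) ∈ P')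
      (s₃ := fun p => (f, a, b, p) ∈ Ξ.xm n) hO' (fun p p' S => by simp [fval_digF])
      (fun p p' S => by simp [fval_digF]) (fun p p' S => by simp [fval_digF])
  have h3 := fun P P' => h2 B I ζ ((Ξ.uXm (n + 1) P).uXm (n + 2) P') N e hO hN₁ hd
  have h3' := fun P P' => h2' B I ζ ((Ξ.uXm (n + 1) P).uXm (n + 2) P') N e hO hN₂ hd
  simp only [fval_exXm, fval, h3, h3', fval_allU, hadd]
  simp only [SOAsg.uXm_xm, if_true, show n + 1 ≠ n + 2 by omega, if_false, updMuls,
    Set.mem_ofPred_eq, funext_iff, Prod.forall]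
  constructor
  · rintro ⟨P, -, P', -, hP, hP', h⟩
    exact ⟨_, hP, _, hP', fun f a b => (h f a b).symm⟩
  · rintro ⟨D₁, hD₁, D₂, hD₂, h⟩
    obtain ⟨P, rfl⟩ := exists_dec e (lt_two_pow_of_mem e hN₁ hD₁)
    obtain ⟨P', rfl⟩ := exists_dec e (lt_two_pow_of_mem e hN₂ hD₂)
    exact ⟨P, Set.toFinite _, P', Set.toFinite _, hD₁, hD₂, fun f a b => (h f a b).symm⟩

theorem LExpr.forall_ (x : ℕ) (φ : PFml σ) {r : Rule σ} (hr : LExpr r) :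
    LExpr (.forall_ x φ r) := by
  classical
  intro n
  obtain ⟨ψ, h1, h2⟩ := hr (n + 1)
  refine ⟨.exXmc 0 (.and (.allDb x (.and (.imp φ.toF (.exXm (n + 1) (.and ψ (allU fun f => .allA 4
      (.iff (digF (n + 1) f) (.memXmc 0 f (.avar 0) (.avar 1) (.avar 4) (.var x)))))))
      (.imp (.not φ.toF) (allU fun f => .allA 4
        (.not (.memXmc 0 f (.avar 0) (.avar 1) (.avar 4) (.var x)))))))
    (allU fun f => sumF (.and (.exDb 0 (.eq (.var 0) (.avar 3)))
      (.memXmc 0 f (.avar 0) (.avar 1) (.avar 4) (.avar 3))) (digF n f))),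
    by simp [Fml.hasR, LTerm.hasR, h1], fun B I ζ Ξ N e hO hN hd => ?_⟩
  have hfin : Finite B := .of_equiv _ e.symm
  have hN' : Big r.deg N := hN.mono (by simp only [Rule.deg]; omega)
  let G : Set (σ.F × B × B × B × B) → B → UMul σ B :=
    fun P x u => num e fun p => (u.1, u.2.1, u.2.2, p, x) ∈ P
  have hsum : ∀ P f a b, fval I ((ζ.updA 0 a).updA 1 b) (Ξ.uXmc 0 P)
      (sumF (.and (.exDb 0 (.eq (.var 0) (.avar 3)))
      (.memXmc 0 f (.avar 0) (.avar 1) (.avar 4) (.avar 3))) (digF n f)) ↔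
      dec e (Ξ.xm n) (f, a, b) = ∑ c ∈ I.db_fin.toFinset, G P c (f, a, b) := by
    intro P f a b
    have hO' : (Ξ.uXmc 0 P).m 0 = ordRel e := hO
    rw [fval_sumF (r := fun x p => x ∈ I.db ∧ (f, a, b, p, x) ∈ P)
      (t := fun p => (f, a, b, p) ∈ Ξ.xm n) hO' (fun x y p p' S S' => by simp [fval, lval])
      (fun x y p p' S S' => by simp [fval_digF])]
    refine Eq.congr rfl ?_
    have : Fintype B := Fintype.ofEquiv _ e.symm
    rw [Equiv.sum_comp e.symm (fun c => num e fun p => c ∈ I.db ∧ (f, a, b, p, c) ∈ P)]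
    symm
    rw [← Finset.sum_subset (Finset.subset_univ I.db_fin.toFinset)]
    · exact Finset.sum_congr rfl fun c hc => num_congr e fun p => by
        simp [show c ∈ I.db by simpa using hc]
    · exact fun c _ hc => (num_eq_zero e).2 fun p => by simp [show c ∉ I.db by simpa using hc]
  have h3 := fun P P' c => h2 B I (ζ.updDb x c) ((Ξ.uXmc 0 P).uXm (n + 1) P') N e hO hN' hd
  simp only [fval_exXmc, fval, fval_allU, hsum, fval_imp, fval_exXm, h3, fval_toF, fval_iff,
    fval_digF, lval]
  simp only [SOAsg.uXm_xm, SOAsg.uXm_xmc, SOAsg.uXmc_xmc, if_true, Asg.updA_av, Asg.updA_dbv,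
    Asg.updDb_dbv, updMuls, Set.mem_ofPred_eq, show (0 : ℕ) ≠ 1 by decide,
    show (0 : ℕ) ≠ 4 by decide, show (1 : ℕ) ≠ 4 by decide, if_false]
  have hG : ∀ P P' c, (∀ f a b p, (f, a, b, p) ∈ P' ↔ (f, a, b, p, c) ∈ P) →
      dec e P' = G P c := fun P P' c h => funext fun u => num_congr e fun p => h _ _ _ _
  constructor
  · rintro ⟨P, -, h, hs⟩
    refine ⟨fun c => if c ∈ I.db then G P c else fun _ => 0, fun c hc hφ => ?_, fun c hc => ?_, ?_⟩
    · obtain ⟨P', -, hP', hPP'⟩ := (h c hc).1 hφ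
      simpa [hc, ← hG P P' c hPP'] using hP'
    · dsimp only
      split_ifs with hc'
      · funext u
        exact (num_eq_zero e).2 fun p => (h c hc').2 (fun hφ => hc ⟨hc', hφ⟩) _ _ _ p
      · rfl
    · funext ⟨f, a, b⟩
      rw [hs]
      exact Finset.sum_congr rfl fun c hc => by
        dsimp only
        rw [if_pos (by simpa using hc)]
  · rintro ⟨g, hg, hg0, hs⟩
    have hlt : ∀ c, ∃ P', dec e P' = g c := by
      intro c
      refine exists_dec e fun u => ?_
      by_cases hc : c ∈ I.db ∧ φ.val I (ζ.updDb x c)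
      · exact lt_two_pow_of_mem e hN' (hg c hc.1 hc.2) u
      · rw [hg0 c hc]; positivity
    choose P' hP' using hlt
    refine ⟨{q | (q.1, q.2.1, q.2.2.1, q.2.2.2.1) ∈ P' q.2.2.2.2}, Set.toFinite _,
      fun c hc => ⟨fun hφ => ⟨P' c, Set.toFinite _, ?_, fun _ _ _ _ => Iff.rfl⟩,
        fun hφ f a b => ?_⟩, fun f a b => ?_⟩
    · rw [hP']; exact hg c hc hφ
    · have : dec e (P' c) (f, a, b) = 0 := by rw [hP', hg0 c fun h => hφ h.2]
      exact dec_eq_zero.1 this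
    · rw [hs]
      exact Finset.sum_congr rfl fun c hc => by rw [← hP']; rfl

theorem LExpr.seq {r₁ r₂ : Rule σ} (hr₁ : LExpr r₁) (hr₂ : LExpr r₂) : LExpr (.seq r₁ r₂) := by
  classical
  intro n
  obtain ⟨ψ₁, h1, h2⟩ := hr₁ (n + 1)
  obtain ⟨ψ₂, h1', h2'⟩ := hr₂ (n + 2)
  let g : σ.F → Fml σ := fun f =>
    .allA 2 (.allA 6 (.not (.memXm (n + 2) f (.avar 0) (.avar 2) (.avar 6))))
  refine ⟨.exXm (n + 1) (.and ψ₁ (.exX 0 (.and (projEq 0 (n + 1))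
    (.or (.and (.not (conUSetF 0)) (allU fun f => eqDigF n (n + 1) f))
      (.and (conUSetF 0) (.exXm (n + 2) (.and (.box 0 ψ₂) (allU fun f =>
        .and (.imp (g f) (eqDigF n (n + 1) f)) (.imp (.not (g f)) (eqDigF n (n + 2) f)))))))))),
    by simp [Fml.hasR, LTerm.hasR, h1, h1', g], fun B I ζ Ξ N e hO hN hd => ?_⟩
  have hfin : Finite B := .of_equiv _ e.symm
  have hN₁ : Big r₁.deg N := hN.mono (by simp only [Rule.deg]; omega)
  have hN₂ : Big r₂.deg N := hN.mono (by simp only [Rule.deg]; omega)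
  have h3 := fun P => h2 B I ζ (Ξ.uXm (n + 1) P) N e hO hN₁ hd
  have h3' := fun P Q P' => h2' B (I.apply Q) ζ (((Ξ.uXm (n + 1) P).uX 0 Q).uXm (n + 2) P') N e
    hO hN₂ hd
  have hp : ∀ (P : Set (σ.F × B × B × B)) (Q : USet σ B),
      (∀ f a b, ((f, a, b) ∈ Q ↔ ∃ p, (f, a, b, p) ∈ P)) ↔
      Q = mulToSet (dec e P) := by
    intro P Q
    rw [Set.ext_iff]
    simp [mulToSet, dec_eq_zero]
  have hg : ∀ P Q P' f a b, fval I ((ζ.updA 0 a).updA 1 b)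
      (((Ξ.uXm (n + 1) P).uX 0 Q).uXm (n + 2) P') (g f) ↔ ∀ c, dec e P' (f, a, c) = 0 := by
    intro P Q P' f a b
    simp [g, fval, lval, dec_eq_zero]
  simp only [fval_exXm, fval, h3, fval_exX, fval_projEq, fval_or, fval_conUSetF, fval_allU,
    fval_eqDigF e, fval_imp, hg]
  simp only [SOAsg.uX_x, SOAsg.uXm_x, if_true, h3', SOAsg.uXm_xm, SOAsg.uX_xm,
    show n + 1 ≠ n + 2 by omega, if_false, show n ≠ n + 1 by omega, show n ≠ n + 2 by omega, hp]
  simp only [Asg.updA_av, if_true, show (0 : ℕ) ≠ 1 by decide, if_false]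
  have hseq : ∀ P P', (∀ f a b, ((∀ c, dec e P' (f, a, c) = 0) →
      dec e (Ξ.xm n) (f, a, b) = dec e P (f, a, b)) ∧ (¬ (∀ c, dec e P' (f, a, c) = 0) →
      dec e (Ξ.xm n) (f, a, b) = dec e P' (f, a, b))) ↔
      dec e (Ξ.xm n) = mseqComp (dec e P) (dec e P') := by
    intro P P'
    rw [funext_iff, Prod.forall]
    refine forall_congr' fun f => ?_
    rw [Prod.forall]
    refine forall_congr' fun a => forall_congr' fun b => ?_
    rw [mseqComp]
    split_ifs with h
    · rw [show dec e P' (f, a, b) = 0 from h b, zero_add]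
      exact ⟨fun h' => h'.1 h, fun h' => ⟨fun _ => h', fun hn => absurd h hn⟩⟩
    · exact ⟨fun h' => h'.2 h, fun h' => ⟨fun hn => absurd hn h, fun _ => h'⟩⟩
  have heq : ∀ P, (∀ f a b, dec e (Ξ.xm n) (f, a, b) = dec e P (f, a, b)) ↔
      dec e (Ξ.xm n) = dec e P := by
    intro P; simp [funext_iff]
  simp only [hseq, heq]
  constructor
  · rintro ⟨P, -, hP, Q, -, rfl, ⟨hc, h⟩ | ⟨hc, P', -, hbox, h⟩⟩
    · exact .inr (by rw [h]; exact ⟨hP, hc⟩)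
    · exact .inl ⟨_, hP, hc, _, hbox.resolve_left (not_not.2 hc), h⟩
  · rintro (⟨D₁, hD₁, hc, D₂, hD₂, h⟩ | ⟨h, hc⟩)
    · obtain ⟨P, rfl⟩ := exists_dec e (lt_two_pow_of_mem e hN₁ hD₁)
      obtain ⟨P', rfl⟩ := exists_dec e (lt_two_pow_of_mem e hN₂ hD₂)
      exact ⟨P, Set.toFinite _, hD₁, _, Set.toFinite _, rfl,
        .inr ⟨hc, P', Set.toFinite _, .inr hD₂, h⟩⟩
    · exact ⟨_, Set.toFinite _, h, _, Set.toFinite _, rfl, .inl ⟨hc, rfl⟩⟩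

end Large

section Combinators

/-- The pure formula that is always true. -/
def PFml.tt (y : ℕ) : PFml σ := .eq (.var y) (.var y)

@[simp] theorem PFml.val_tt (y : ℕ) (I : Interp σ B) (ζ : Asg B) : (PFml.tt y).val I ζ := rfl

/-- Nondeterministic choice between two rules, deciding by whether `y` equals `avar q`. -/
def Rule.orElse (y q : ℕ) (g₁ g₂ : Rule σ) : Rule σ :=
  .choose y (.tt y) (.par (.cond (.eq (.var y) (.avar q)) g₁)
    (.cond (.not (.eq (.var y) (.avar q))) g₂))

/-- Nondeterministic choice between the rules in a list and doing nothing. -/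
def Rule.anyOf (y q : ℕ) (f : σ.F) (l : List (Rule σ)) : Rule σ :=
  l.foldr (.orElse y q) (.skip f)

/-- Repetition of a rule for all tuples of length `i` over the database. -/
def Rule.rep (y : ℕ) (g : Rule σ) : ℕ → Rule σ
  | 0 => g
  | i + 1 => .forall_ y (.tt y) (rep y g i)

/-- At most `d ^ k` parallel runs of a rule, where `d` is the size of the database. -/
def Rule.runs (y q : ℕ) (f : σ.F) (g : Rule σ) (k : ℕ) : Rule σ :=
  .rep y (.orElse y q g (.skip f)) k

/-- `g` yields `D` whatever the value of the variable `y`. -/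
def Yields (I : Interp σ B) (ζ : Asg B) (y : ℕ) (g : Rule σ) (D : UMul σ B) : Prop :=
  ∀ c, D ∈ updMuls g I (ζ.updDb y c)

/-- Whatever the value of `y`, all update multisets yielded by `g` satisfy `Q`. -/
def Only (I : Interp σ B) (ζ : Asg B) (y : ℕ) (g : Rule σ) (Q : UMul σ B → Prop) : Prop :=
  ∀ c, ∀ D ∈ updMuls g I (ζ.updDb y c), Q D

variable {I : Interp σ B} {ζ : Asg B} {y q : ℕ} {f : σ.F} {Q : UMul σ B → Prop}

@[simp] theorem Asg.updDb_updDb (ζ : Asg B) (y : ℕ) (c c' : B) :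
    (ζ.updDb y c).updDb y c' = ζ.updDb y c' := by
  simp [Asg.updDb]

theorem Asg.updDb_self (ζ : Asg B) (y : ℕ) : ζ.updDb y (ζ.dbv y) = ζ := by
  simp [Asg.updDb]

theorem Only.self {g : Rule σ} (h : Only I ζ y g Q) {D : UMul σ B} (hD : D ∈ updMuls g I ζ) :
    Q D := h (ζ.dbv y) D (by rwa [Asg.updDb_self])

theorem Yields.self {g : Rule σ} {D : UMul σ B} (h : Yields I ζ y g D) : D ∈ updMuls g I ζ := by
  simpa [Asg.updDb_self] using h (ζ.dbv y)

theorem Only.skip (h : Q 0) : Only I ζ y (.skip f) Q := by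
  intro c D hD
  rw [updMuls_skip] at hD
  obtain rfl := hD
  exact h

theorem Yields.skip : Yields I ζ y (.skip f) 0 := by
  intro c
  rw [updMuls_skip]
  rfl

theorem Only.orElse {g₁ g₂ : Rule σ} (h₁ : Only I ζ y g₁ Q) (h₂ : Only I ζ y g₂ Q) :
    Only I ζ y (.orElse y q g₁ g₂) Q := by
  rintro c D ⟨c', -, -, D₁, hD₁, D₂, hD₂, rfl⟩
  rw [Asg.updDb_updDb] at hD₁ hD₂
  rw [updMuls] at hD₁ hD₂
  by_cases h : (PFml.eq (.var y) (.avar q)).val I (ζ.updDb y c')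
  · rw [if_pos h] at hD₁
    rw [if_neg (by exact not_not.2 h)] at hD₂
    obtain rfl := hD₂
    simpa using h₁ c' D₁ hD₁
  · rw [if_neg h] at hD₁
    rw [if_pos (by exact h)] at hD₂
    obtain rfl := hD₁
    simpa using h₂ c' D₂ hD₂

theorem Yields.orElse_left {g₁ g₂ : Rule σ} {D : UMul σ B} (hq : ζ.av q ∈ I.db)
    (h : Yields I ζ y g₁ D) : Yields I ζ y (.orElse y q g₁ g₂) D := by
  intro c
  refine ⟨ζ.av q, hq, rfl, D, ?_, 0, ?_, by funext u; simp⟩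
  · rw [Asg.updDb_updDb, updMuls, if_pos (by simp [PFml.val, PTerm.val])]
    exact h _
  · rw [updMuls, if_neg (by simp [PFml.val, PTerm.val])]
    rfl

theorem Yields.orElse_right {g₁ g₂ : Rule σ} {D : UMul σ B} (hq : ∃ c ∈ I.db, c ≠ ζ.av q)
    (h : Yields I ζ y g₂ D) : Yields I ζ y (.orElse y q g₁ g₂) D := by
  obtain ⟨b, hb, hbq⟩ := hq
  intro c
  refine ⟨b, hb, rfl, 0, ?_, D, ?_, by funext u; simp⟩
  · rw [updMuls, if_neg (by simpa [PFml.val, PTerm.val] using hbq)]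
    rfl
  · rw [Asg.updDb_updDb, updMuls, if_pos (by simpa [PFml.val, PTerm.val] using hbq)]
    exact h _

theorem Only.anyOf {l : List (Rule σ)} (h0 : Q 0) (h : ∀ g ∈ l, Only I ζ y g Q) :
    Only I ζ y (.anyOf y q f l) Q := by
  induction l with
  | nil => exact .skip h0
  | cons g l ih =>
    simp only [List.mem_cons, forall_eq_or_imp] at h
    exact .orElse h.1 (ih h.2)

theorem Yields.anyOf {l : List (Rule σ)} {g : Rule σ} {D : UMul σ B} (hq : ζ.av q ∈ I.db)
    (hq' : ∃ c ∈ I.db, c ≠ ζ.av q) (hg : g ∈ l) (h : Yields I ζ y g D) :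
    Yields I ζ y (.anyOf y q f l) D := by
  induction l with
  | nil => simp at hg
  | cons g' l ih =>
    rcases List.mem_cons.1 hg with rfl | hg
    · exact .orElse_left hq h
    · exact .orElse_right hq' (ih hg)

theorem Only.rep {g : Rule σ} (h0 : Q 0) (hadd : ∀ D D', Q D → Q D' → Q (D + D'))
    (h : Only I ζ y g Q) (k : ℕ) : Only I ζ y (.rep y g k) Q := by
  induction k with
  | zero => exact h
  | succ k ih =>
    rintro c D ⟨G, hG, -, rfl⟩
    have : (fun u => ∑ a ∈ I.db_fin.toFinset, G a u) = ∑ a ∈ I.db_fin.toFinset, G a := by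
      funext u; simp
    rw [this]
    refine Finset.sum_induction _ Q hadd h0 fun a ha => ?_
    have := hG a (by simpa using ha) rfl
    rw [Asg.updDb_updDb] at this
    exact ih a _ this

theorem Yields.rep_succ {g : Rule σ} {k : ℕ} {G : B → UMul σ B}
    (h : ∀ a ∈ I.db, Yields I ζ y (.rep y g k) (G a)) :
    Yields I ζ y (.rep y g (k + 1)) (∑ a ∈ I.db_fin.toFinset, G a) := by
  classical
  intro c
  refine ⟨fun a => if a ∈ I.db then G a else 0, fun a ha _ => ?_, fun a ha => ?_, ?_⟩
  · rw [Asg.updDb_updDb]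
    simpa [ha] using h a ha a
  · have : a ∉ I.db := fun h => ha ⟨h, rfl⟩
    simp only [this, if_false]
    rfl
  · funext u
    rw [Finset.sum_apply]
    exact Finset.sum_congr rfl fun a ha => by simp [show a ∈ I.db by simpa using ha]

theorem Only.runs {g : Rule σ} (h0 : Q 0) (hadd : ∀ D D', Q D → Q D' → Q (D + D'))
    (h : Only I ζ y g Q) (k : ℕ) : Only I ζ y (.runs y q f g k) Q :=
  .rep h0 hadd (.orElse h (.skip h0)) k

theorem exists_split {α β : Type*} (s : Finset α) (T : ℕ) (L : Multiset β)
    (h : L.card ≤ s.card * T) :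
    ∃ G : α → Multiset β, (∀ a ∈ s, (G a).card ≤ T) ∧ ∑ a ∈ s, G a = L := by
  classical
  induction s using Finset.induction_on generalizing L with
  | empty =>
    have : L = 0 := by simpa using h
    exact ⟨fun _ => 0, by simp, by simp [this]⟩
  | insert b s hb ih =>
    obtain ⟨l, rfl⟩ : ∃ l : List β, (l : Multiset β) = L := Quot.exists_rep L
    rw [Finset.card_insert_of_notMem hb] at h
    obtain ⟨G, h1, h2⟩ := ih (l.drop T : Multiset β) (by
      simp only [Multiset.coe_card, List.length_drop] at h ⊢
      rw [add_mul] at h; omega)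
    refine ⟨Function.update G b (l.take T : Multiset β), fun a ha => ?_, ?_⟩
    · by_cases hab : a = b
      · subst hab; simp
      · rw [Function.update_of_ne hab]
        exact h1 a ((Finset.mem_insert.1 ha).resolve_left hab)
    · have : ∀ a ∈ s, Function.update G b (l.take T : Multiset β) a = G a := fun a ha =>
        Function.update_of_ne (by rintro rfl; exact hb ha) _ _
      rw [Finset.sum_insert hb, Function.update_self, Finset.sum_congr rfl this, h2,
        Multiset.coe_add, List.take_append_drop]

theorem Yields.runs {g : Rule σ} (hq : ζ.av q ∈ I.db) (hq' : ∃ c ∈ I.db, c ≠ ζ.av q) (k : ℕ)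
    (L : Multiset (UMul σ B)) (hL : ∀ D ∈ L, Yields I ζ y g D)
    (hcard : L.card ≤ I.db.ncard ^ k) : Yields I ζ y (.runs y q f g k) L.sum := by
  induction k generalizing L with
  | zero =>
    have : L.card = 0 ∨ L.card = 1 := by rw [pow_zero] at hcard; omega
    rcases this with h | h
    · rw [Multiset.card_eq_zero] at h
      subst h
      exact .orElse_right hq' .skip
    · obtain ⟨D, rfl⟩ := Multiset.card_eq_one.1 h
      rw [Multiset.sum_singleton]
      exact .orElse_left hq (hL D (by simp))
  | succ k ih =>
    obtain ⟨G, h1, rfl⟩ := exists_split I.db_fin.toFinset (I.db.ncard ^ k) L (by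
      rwa [← Set.ncard_eq_toFinset_card _ I.db_fin, ← pow_succ'])
    rw [show (∑ a ∈ I.db_fin.toFinset, G a).sum = ∑ a ∈ I.db_fin.toFinset, (G a).sum from
      map_sum Multiset.sumAddMonoidHom _ _]
    refine Yields.rep_succ fun a ha => ih _ (fun D hD => hL D ?_) (h1 a (by simpa using ha))
    exact Multiset.mem_of_le (Finset.single_le_sum_of_canonicallyOrdered
      (f := G) (by simpa using ha)) hD

theorem Only.rep_smul {g : Rule σ} {D : UMul σ B} (h : Only I ζ y g (· = D)) (k : ℕ) :
    Only I ζ y (.rep y g k) (· = I.db.ncard ^ k • D) := by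
  induction k with
  | zero => simpa [Rule.rep] using h
  | succ k ih =>
    rintro c _ ⟨G, hG, -, rfl⟩
    funext u
    have : ∀ a ∈ I.db_fin.toFinset, G a u = I.db.ncard ^ k * D u := fun a ha => by
      have := hG a (by simpa using ha) rfl
      rw [Asg.updDb_updDb] at this
      rw [ih a _ this]; simp
    rw [Finset.sum_congr rfl this, Finset.sum_const, ← Set.ncard_eq_toFinset_card _ I.db_fin]
    simp [pow_succ', mul_assoc]

theorem Yields.rep_smul {g : Rule σ} {D : UMul σ B} (h : Yields I ζ y g D) (k : ℕ) :
    Yields I ζ y (.rep y g k) (I.db.ncard ^ k • D) := by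
  induction k with
  | zero => simpa [Rule.rep] using h
  | succ k ih =>
    have := Yields.rep_succ fun a (_ : a ∈ I.db) => ih
    rwa [Finset.sum_const, ← Set.ncard_eq_toFinset_card _ I.db_fin, smul_smul, ← pow_succ'] at this

end Combinators

section Generator

/-- A rule producing, in the cell `(f, avar p)`, the values reachable in `k` steps. -/
noncomputable def Rule.gen (y q p j₀ n m : ℕ) (f : σ.F) (G : List σ.Stat) (P : List σ.Rho) :
    ℕ → Rule σ
  | 0 => .anyOf y q f (.choose y (.tt y) (.assign f (.avar p) (.var y)) ::
      ((List.range n).map (fun j => .assign f (.avar p) (.var j)) ++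
        (List.range n).map (fun j => .assign f (.avar p) (.avar j))))
  | k + 1 => .anyOf y q f (gen y q p j₀ n m f G P k :: .assign f (.avar p) (.avar j₀) ::
      (G.map (fun g => .seq (gen y q p j₀ n m f G P k)
          (.assign f (.avar p) (.stat g (.dyn f (.avar p))))) ++
        ((Finset.univ : Finset σ.F).toList.map (fun f' => .seq (gen y q p j₀ n m f G P k)
          (.assign f (.avar p) (.dyn f' (.dyn f (.avar p))))) ++
        P.map fun ρ => .letr f (.avar p) ρ (.runs y q f (gen y q p j₀ n m f G P k) m))))

variable {I : Interp σ B} {ζ : Asg B} {y q p j₀ n m : ℕ} {f : σ.F} {G : List σ.Stat}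
  {P : List σ.Rho}

/-- All updates of `D` are in the cell `(f, a)`. -/
def InCell (f : σ.F) (a : B) (D : UMul σ B) : Prop :=
  ∀ u : Upd σ B, ¬ (u.1 = f ∧ u.2.1 = a) → D u = 0

theorem InCell.zero {a : B} : InCell f a 0 := fun _ _ => rfl

theorem InCell.add {a : B} (D D' : UMul σ B) (h : InCell f a D) (h' : InCell f a D') :
    InCell f a (D + D') := fun u hu => by simp [h u hu, h' u hu]

@[simp] theorem updMuls_assign [DecidableEq B] (f : σ.F) (t s : PTerm σ) (I : Interp σ B)
    (ζ : Asg B) : updMuls (.assign f t s) I ζ = {oneU (f, t.val I ζ, s.val I ζ)} := by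
  ext D
  simp only [updMuls, Set.mem_ofPred_eq, Set.mem_singleton_iff]
  refine Eq.congr_right ?_
  funext u
  simp [oneU]

theorem InCell.oneU [DecidableEq B] {a v : B} : InCell f a (oneU (f, a, v)) := by
  intro u hu
  rw [DBASM.oneU, if_neg (by rintro rfl; simp at hu)]

theorem only_assign (s : PTerm σ) : Only I ζ y (.assign f (.avar p) s) (InCell f (ζ.av p)) := by
  classical
  intro c D hD
  rw [updMuls_assign] at hD
  obtain rfl := hD
  exact .oneU

theorem Only.seq_assign {g : Rule σ} (h : Only I ζ y g (InCell f (ζ.av p))) (s : PTerm σ) :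
    Only I ζ y (.seq g (.assign f (.avar p) s)) (InCell f (ζ.av p)) := by
  classical
  rintro c D (⟨D₁, h₁, -, D₂, h₂, rfl⟩ | ⟨h₁, -⟩)
  · rw [updMuls_assign] at h₂
    obtain rfl := h₂
    intro u hu
    simp only [mseqComp, h c D₁ h₁ u hu, ite_self, add_zero]
    exact InCell.oneU u hu
  · exact h c _ h₁

theorem Only.gen (k : ℕ) : Only I ζ y (.gen y q p j₀ n m f G P k) (InCell f (ζ.av p)) := by
  induction k with
  | zero =>
    refine .anyOf .zero fun g hg => ?_
    simp only [List.mem_cons, List.mem_append, List.mem_map] at hg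
    rcases hg with rfl | ⟨j, -, rfl⟩ | ⟨j, -, rfl⟩
    · rintro c D ⟨c', -, -, hD⟩
      rw [Asg.updDb_updDb] at hD
      exact only_assign _ c' D hD
    · exact only_assign _
    · exact only_assign _
  | succ k ih =>
    refine .anyOf .zero fun g hg => ?_
    simp only [List.mem_cons, List.mem_append, List.mem_map] at hg
    rcases hg with rfl | rfl | ⟨j, -, rfl⟩ | ⟨j, -, rfl⟩ | ⟨ρ, -, rfl⟩
    · exact ih
    · exact only_assign _
    · exact ih.seq_assign _
    · exact ih.seq_assign _
    · rintro c D ⟨D', hD', rfl⟩ u hu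
      rw [mcollapse, if_neg (by exact hu)]
      exact Only.runs .zero .add ih m c D' hD' u hu

theorem Interp.apply_oneU [DecidableEq B] (I : Interp σ B) (f f' : σ.F) (a v c : B) :
    (I.apply (mulToSet (oneU (f, a, v)))).dyn f' c =
      if f' = f ∧ c = a then v else I.dyn f' c := by
  have hm : ∀ b, (f', c, b) ∈ mulToSet (oneU (f, a, v)) ↔ (f' = f ∧ c = a) ∧ b = v := by
    intro b; simp [mulToSet, oneU, and_assoc]
  simp only [Interp.apply]
  split_ifs with h h' h'
  · exact ((hm _).1 h.choose_spec).2
  · exact absurd ((hm _).1 h.choose_spec).1 h'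
  · exact absurd ⟨v, (hm v).2 ⟨h', rfl⟩⟩ h
  · rfl

theorem consistentU_oneU [DecidableEq B] (f : σ.F) (a v : B) :
    consistentU (mulToSet (oneU (f, a, v))) := by
  intro f' a' b b' h h'
  simp only [mulToSet, oneU, Set.mem_ofPred_eq, ne_eq, ite_eq_right_iff, one_ne_zero, imp_false,
    not_not, Prod.mk.injEq] at h h'
  rw [h.2.2, h'.2.2]

theorem mseqComp_oneU [DecidableEq B] (f : σ.F) (a v w : B) :
    mseqComp (oneU (f, a, v)) (oneU (f, a, w)) = oneU (f, a, w) := by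
  funext u
  simp only [mseqComp]
  split_ifs with h
  · rw [show oneU (f, a, v) u = 0 from ?_, add_zero]
    rw [oneU, if_neg]
    rintro rfl
    simpa [oneU] using h w
  · rw [add_zero]

theorem Yields.seq_assign [DecidableEq B] {g : Rule σ} {v : B} {s : PTerm σ}
    (h : Yields I ζ y g (oneU (f, ζ.av p, v))) {w : B}
    (hs : ∀ c, s.val (I.apply (mulToSet (oneU (f, ζ.av p, v)))) (ζ.updDb y c) = w) :
    Yields I ζ y (.seq g (.assign f (.avar p) s)) (oneU (f, ζ.av p, w)) := by
  intro c
  refine .inl ⟨_, h c, consistentU_oneU _ _ _, oneU (f, ζ.av p, w), ?_, (mseqComp_oneU ..).symm⟩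
  rw [updMuls_assign, hs]
  rfl

theorem sum_oneU_apply [DecidableEq B] (M : Multiset B) (f : σ.F) (a : B) (u : Upd σ B) :
    (M.map fun v => oneU (f, a, v)).sum u = if u.1 = f ∧ u.2.1 = a then M.count u.2.2 else 0 := by
  induction M using Multiset.induction_on with
  | empty => simp
  | cons v M ih =>
    obtain ⟨f', a', b⟩ := u
    simp only [Multiset.map_cons, Multiset.sum_cons, Pi.add_apply, ih, oneU, Prod.mk.injEq,
      Multiset.count_cons]
    by_cases h : f' = f ∧ a' = a
    · simp [h, add_comm]
    · rw [if_neg h, if_neg h, if_neg (by tauto)]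

theorem mulVals_eq_of_count [DecidableEq B] {D : UMul σ B} {f : σ.F} {a : B} {M : Multiset B}
    (h : ∀ b, D (f, a, b) = M.count b) : mulVals D f a = M := by
  have hf : (Function.support fun b => D (f, a, b)).Finite :=
    M.toFinset.finite_toSet.subset fun b hb => by
      simpa [h, Multiset.count_eq_zero] using hb
  ext b
  rw [count_mulVals hf, h]

theorem Yields.gen [DecidableEq B] (hq : ζ.av q ∈ I.db) (hq' : ∃ c ∈ I.db, c ≠ ζ.av q)
    (hj : ζ.av j₀ = I.dyn f (ζ.av p)) (hy : n ≤ y) {A : Set B}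
    (hA : ∀ v ∈ A, v ∈ I.db ∨ (∃ j < n, ζ.dbv j = v) ∨ ∃ j < n, ζ.av j = v) (k : ℕ) {v : B}
    (hv : v ∈ Reach I G P (I.db.ncard ^ m) A k) :
    Yields I ζ y (.gen y q p j₀ n m f G P k) (oneU (f, ζ.av p, v)) := by
  induction k generalizing v with
  | zero =>
    have key : ∀ s : PTerm σ, (∀ c, s.val I (ζ.updDb y c) = v) →
        Yields I ζ y (.assign f (.avar p) s) (oneU (f, ζ.av p, v)) := fun s hs c => by
      rw [updMuls_assign, hs]
      rfl
    rcases hA v hv with h | ⟨j, hjn, rfl⟩ | ⟨j, hjn, rfl⟩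
    · refine .anyOf hq hq' (List.mem_cons_self ..) fun c => ⟨v, h, rfl, ?_⟩
      rw [updMuls_assign]
      simp [PTerm.val]
    · refine .anyOf hq hq' (g := .assign f (.avar p) (.var j)) ?_ (key _ fun c => ?_)
      · simp [hjn]
      · simp [PTerm.val, show j ≠ y by omega]
    · refine .anyOf hq hq' (g := .assign f (.avar p) (.avar j)) ?_ (key _ fun c => ?_)
      · simp [hjn]
      · simp [PTerm.val]
  | succ k ih =>
    have hdyn : ∀ v c, (PTerm.dyn f (.avar p)).val (I.apply (mulToSet (oneU (f, ζ.av p, v))))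
        (ζ.updDb y c) = v := by
      intro v c
      simp [PTerm.val, Interp.apply_oneU]
    rcases hv with hv | ⟨g, hg, c, hc, rfl⟩ | ⟨f', c, hc, rfl⟩ | ⟨ρ, hρ, M, hM, hT, rfl⟩
    · exact .anyOf hq hq' (List.mem_cons_self ..) (ih hv)
    · refine .anyOf hq hq' (g := .seq (.gen y q p j₀ n m f G P k)
        (.assign f (.avar p) (.stat g (.dyn f (.avar p))))) (by simp [hg])
        ((ih hc).seq_assign fun c' => ?_)
      rw [PTerm.val, hdyn]
      rfl
    · by_cases h : f' = f ∧ c = ζ.av p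
      · refine .anyOf hq hq' (g := .assign f (.avar p) (.avar j₀)) (by simp) fun c' => ?_
        rw [updMuls_assign, h.1, h.2, ← hj]
        rfl
      · refine .anyOf hq hq' (g := .seq (.gen y q p j₀ n m f G P k)
          (.assign f (.avar p) (.dyn f' (.dyn f (.avar p))))) (by simp)
          ((ih hc).seq_assign fun c' => ?_)
        rw [PTerm.val, hdyn, Interp.apply_oneU, if_neg h]
    · refine .anyOf hq hq' (g := .letr f (.avar p) ρ (.runs y q f (.gen y q p j₀ n m f G P k) m))
        (by simp [hρ]) fun c => ?_
      refine ⟨(M.map fun v => oneU (f, ζ.av p, v)).sum, Yields.runs hq hq' m _ ?_ (by simpa) c, ?_⟩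
      · intro D hD
        obtain ⟨v, hv, rfl⟩ := Multiset.mem_map.1 hD
        exact ih (hM v hv)
      · rw [mcollapse_zero_off]
        · rw [mulVals_eq_of_count (M := M)]
          · funext u
            simp only [oneU, PTerm.val, Asg.updDb_av]
            congr
          · intro b
            rw [sum_oneU_apply]
            simp [PTerm.val]
        · intro u hu
          rw [sum_oneU_apply, if_neg (by exact hu)]

end Generator

section Query

/-- Emit the value of `f (avar p)` once in the cell of `b` and `d ^ i` times in the cell of `a`. -/
def Rule.emit (y p a b i : ℕ) (f : σ.F) : Rule σ :=
  .par (.assign f (.avar b) (.dyn f (.avar p)))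
    (.rep y (.assign f (.avar a) (.dyn f (.avar p))) i)

/-- Evaluate `ρ` on a multiset of generated values; the multiplicities of these values are
recorded in base `d`, with the digits in the cells `b 0, …, b m`. -/
noncomputable def Rule.query (y q p a j₀ n m k : ℕ) (b : ℕ → ℕ) (f : σ.F) (ρ : σ.Rho)
    (G : List σ.Stat) (P : List σ.Rho) : Rule σ :=
  .letr f (.avar p) ρ (.letr f (.avar a) ρ (.runs y q f (.anyOf y q f
    ((List.range (m + 1)).map fun i =>
      .seq (.gen y q p j₀ n m f G P k) (.emit y p a (b i) i f))) m))

/-- The cells used by a query are distinct. -/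
structure Cells (ζ : Asg B) (p a : ℕ) (b : ℕ → ℕ) (K : ℕ) : Prop where
  pa : ζ.av p ≠ ζ.av a
  pb : ∀ i < K, ζ.av p ≠ ζ.av (b i)
  ab : ∀ i < K, ζ.av a ≠ ζ.av (b i)
  bb : ∀ i < K, ∀ j < K, ζ.av (b i) = ζ.av (b j) → i = j

/-- The multiplicities at `(f, a)` have the digits given at `(f, b i)`. -/
def Balanced (d K : ℕ) (f : σ.F) (a : B) (b : ℕ → B) (D : UMul σ B) : Prop :=
  ∀ v, D (f, a, v) = ∑ i ∈ Finset.range K, d ^ i * D (f, b i, v)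

variable {I : Interp σ B} {ζ : Asg B} {y q p a j₀ n m k : ℕ} {b : ℕ → ℕ} {f : σ.F} {ρ : σ.Rho}
  {G : List σ.Stat} {P : List σ.Rho}

theorem Balanced.zero {d K : ℕ} {a : B} {b : ℕ → B} : Balanced d K f a b 0 := by
  intro v; simp

theorem Balanced.add {d K : ℕ} {a : B} {b : ℕ → B} (D D' : UMul σ B) (h : Balanced d K f a b D)
    (h' : Balanced d K f a b D') : Balanced d K f a b (D + D') := by
  intro v
  simp only [Pi.add_apply, h v, h' v, mul_add, Finset.sum_add_distrib]

theorem Cells.balanced [DecidableEq B] {K : ℕ} (h : Cells ζ p a b K) (d : ℕ) {i : ℕ} (hi : i < K)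
    (w : B) : Balanced d K f (ζ.av a) (fun i => ζ.av (b i))
      (oneU (f, ζ.av (b i), w) + d ^ i • oneU (f, ζ.av a, w)) := by
  intro v
  rw [Finset.sum_eq_single_of_mem i (Finset.mem_range.2 hi)]
  · simp [oneU, h.ab i hi, (h.ab i hi).symm]
  · intro j hj hji
    rw [Finset.mem_range] at hj
    have : ζ.av (b j) ≠ ζ.av (b i) := fun h' => hji (h.bb j hj i hi h')
    simp [oneU, this, (h.ab j hj).symm]

theorem Only.emit [DecidableEq B] (i : ℕ) {b : ℕ} : Only I ζ y (.emit y p a b i f) (· =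
    oneU (f, ζ.av b, I.dyn f (ζ.av p)) + I.db.ncard ^ i • oneU (f, ζ.av a, I.dyn f (ζ.av p))) := by
  rintro c D ⟨D₁, h₁, D₂, h₂, rfl⟩
  rw [updMuls_assign] at h₁
  obtain rfl := h₁
  have : Only I ζ y (.assign f (.avar a) (.dyn f (.avar p)))
      (· = oneU (f, ζ.av a, I.dyn f (ζ.av p))) := by
    intro c D hD
    rw [updMuls_assign] at hD
    exact hD
  rw [this.rep_smul i c D₂ h₂]
  rfl

theorem Yields.emit [DecidableEq B] (i : ℕ) {b : ℕ} : Yields I ζ y (.emit y p a b i f)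
    (oneU (f, ζ.av b, I.dyn f (ζ.av p)) + I.db.ncard ^ i • oneU (f, ζ.av a, I.dyn f (ζ.av p))) := by
  intro c
  refine ⟨_, ?_, _, Yields.rep_smul (D := oneU (f, ζ.av a, I.dyn f (ζ.av p))) ?_ i c, rfl⟩
  · rw [updMuls_assign]; rfl
  · intro c
    rw [updMuls_assign]; rfl

theorem Only.seq_emit {K : ℕ} (hc : Cells ζ p a b K) {i : ℕ} (hi : i < K) {g : Rule σ}
    (hg : Only I ζ y g (InCell f (ζ.av p))) : Only I ζ y (.seq g (.emit y p a (b i) i f))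
      (Balanced I.db.ncard K f (ζ.av a) fun i => ζ.av (b i)) := by
  classical
  rintro c D (⟨D₁, h₁, -, D₂, h₂, rfl⟩ | ⟨h₁, -⟩)
  · have h : ∀ x, x ≠ ζ.av p → ∀ v, mseqComp D₁ D₂ (f, x, v) = D₂ (f, x, v) := fun x hx v => by
      simp [mseqComp, hg c D₁ h₁ (f, x, v) (by simp [hx])]
    intro v
    rw [h _ hc.pa.symm, Finset.sum_congr rfl fun j hj => by
      rw [h _ (hc.pb j (Finset.mem_range.1 hj)).symm]]
    have := Only.emit i c D₂ h₂
    rw [this]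
    exact hc.balanced _ hi _ v
  · intro v
    rw [hg c D h₁ _ (by simp [hc.pa.symm]), Finset.sum_eq_zero fun j hj => by
      rw [hg c D h₁ _ (by simp [(hc.pb j (Finset.mem_range.1 hj)).symm]), mul_zero]]

theorem query_sound (hc : Cells ζ p a b (m + 1)) {D D' : UMul σ B}
    (hD : D ∈ updMuls (.query y q p a j₀ n m k b f ρ G P) I ζ)
    (hD' : ∀ v, D' (f, ζ.av a, v) =
      ∑ i ∈ Finset.range (m + 1), I.db.ncard ^ i * D (f, ζ.av (b i), v))
    {w : B} (hw : D (f, ζ.av a, w) ≠ 0) : w = I.lop ρ (mulVals D' f (ζ.av a)) := by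
  classical
  obtain ⟨D₁, ⟨D₂, h₂, rfl⟩, rfl⟩ := hD
  simp only [PTerm.val] at hw hD'
  have hbal : Balanced I.db.ncard (m + 1) f (ζ.av a) (fun i => ζ.av (b i)) D₂ := by
    refine Only.self (y := y) (.runs .zero .add (.anyOf .zero fun g hg => ?_) m) h₂
    obtain ⟨i, hi, rfl⟩ := List.mem_map.1 hg
    exact .seq_emit hc (List.mem_range.1 hi) (.gen k)
  rw [mcollapse, if_neg (by simp [hc.pa.symm]), mcollapse, if_pos ⟨rfl, rfl⟩] at hw
  have hw' : w = I.lop ρ (mulVals D₂ f (ζ.av a)) := by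
    by_contra hne
    exact hw (if_neg hne)
  have : ∀ v, D' (f, ζ.av a, v) = D₂ (f, ζ.av a, v) := by
    intro v
    rw [hD', hbal v]
    refine Finset.sum_congr rfl fun i hi => ?_
    rw [Finset.mem_range] at hi
    simp [mcollapse, (hc.pb i hi).symm, (hc.ab i hi).symm]
  rw [hw']
  simp only [mulVals, this]

theorem sum_digits (d c K : ℕ) (h : c < d ^ K) :
    ∑ i ∈ Finset.range K, d ^ i * (c / d ^ i % d) = c := by
  have : ∀ K, ∑ i ∈ Finset.range K, d ^ i * (c / d ^ i % d) = c % d ^ K := by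
    intro K
    induction K with
    | zero => simp [Nat.mod_one]
    | succ K ih => rw [Finset.sum_range_succ, ih, Nat.mod_pow_succ]
  rw [this, Nat.mod_eq_of_lt h]

theorem Yields.seq_emit [DecidableEq B] {K : ℕ} (hc : Cells ζ p a b K) {i : ℕ} (hi : i < K)
    {g : Rule σ} {v : B} (hg : Yields I ζ y g (oneU (f, ζ.av p, v))) :
    Yields I ζ y (.seq g (.emit y p a (b i) i f)) (oneU (f, ζ.av (b i), v) +
      I.db.ncard ^ i • oneU (f, ζ.av a, v) + oneU (f, ζ.av p, v)) := by
  intro c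
  refine .inl ⟨_, hg c, consistentU_oneU _ _ _, _, Yields.emit i c, ?_⟩
  rw [Interp.apply_oneU, if_pos ⟨rfl, rfl⟩]
  funext ⟨f', x, w⟩
  simp only [mseqComp, Pi.add_apply, Pi.smul_apply]
  congr 1
  symm
  by_cases h : ∀ w',
      (oneU (f, ζ.av (b i), v) + I.db.ncard ^ i • oneU (f, ζ.av a, v)) (f', x, w') = 0
  · exact if_pos h
  refine (if_neg h).trans ?_
  by_contra h'
  rw [eq_comm] at h'
  refine h fun w' => ?_
  have hx : f' = f ∧ x = ζ.av p := by
    by_contra hx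
    refine h' ?_
    rw [oneU, if_neg (by simp; tauto)]
  rw [hx.2]
  simp [oneU, hc.pa, hc.pb i hi]

theorem query_complete [DecidableEq B] (hc : Cells ζ p a b (m + 1)) (hq : ζ.av q ∈ I.db)
    (hq' : ∃ c ∈ I.db, c ≠ ζ.av q) (hj : ζ.av j₀ = I.dyn f (ζ.av p)) (hy : n ≤ y) {A : Set B}
    (hA : ∀ v ∈ A, v ∈ I.db ∨ (∃ j < n, ζ.dbv j = v) ∨ ∃ j < n, ζ.av j = v)
    {M : Multiset B} (hM : ∀ v ∈ M, v ∈ Reach I G P (I.db.ncard ^ m) A k)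
    (hcard : M.card ≤ I.db.ncard ^ m) (hd : 2 ≤ I.db.ncard) :
    ∃ D ∈ updMuls (.query y q p a j₀ n m k b f ρ G P) I ζ, D (f, ζ.av a, I.lop ρ M) ≠ 0 ∧
      (∀ u, D u ≤ I.db.ncard) ∧ ∀ v, M.count v =
        ∑ i ∈ Finset.range (m + 1), I.db.ncard ^ i * D (f, ζ.av (b i), v) := by
  set d := I.db.ncard with hd'
  let E : ℕ → B → UMul σ B := fun i v =>
    oneU (f, ζ.av (b i), v) + d ^ i • oneU (f, ζ.av a, v) + oneU (f, ζ.av p, v)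
  let c : ℕ → B → ℕ := fun i v => M.count v / d ^ i % d
  have hcount : ∀ v, ∑ i ∈ Finset.range (m + 1), d ^ i * c i v = M.count v := fun v =>
    sum_digits _ _ _ (((M.count_le_card v).trans hcard).trans_lt
      (Nat.pow_lt_pow_right (by omega) (Nat.lt_succ_self m)))
  have hc0 : ∀ i v, v ∉ M → c i v = 0 := fun i v hv => by
    simp [c, Multiset.count_eq_zero.2 hv]
  let L : Multiset (UMul σ B) := ∑ v ∈ M.toFinset, ∑ i ∈ Finset.range (m + 1),
    Multiset.replicate (c i v) (E i v)
  have hLcard : L.card ≤ d ^ m := by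
    refine le_trans ?_ hcard
    rw [← Multiset.toFinset_sum_count_eq M]
    simp only [L, Multiset.card_sum, Multiset.card_replicate]
    refine Finset.sum_le_sum fun v _ => ?_
    rw [← hcount v]
    exact Finset.sum_le_sum fun i _ => Nat.le_mul_of_pos_left _ (pow_pos (by omega) i)
  have hLmem : ∀ D ∈ L, Yields I ζ y (.anyOf y q f ((List.range (m + 1)).map fun i =>
      .seq (.gen y q p j₀ n m f G P k) (.emit y p a (b i) i f))) D := by
    intro D hD
    simp only [L, Multiset.mem_sum, Multiset.mem_replicate] at hD
    obtain ⟨v, hv, i, hi, -, rfl⟩ := hD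
    exact .anyOf hq hq' (List.mem_map.2 ⟨i, List.mem_range.2 (Finset.mem_range.1 hi), rfl⟩)
      (.seq_emit hc (Finset.mem_range.1 hi) (.gen hq hq' hj hy hA k (hM v (by simpa using hv))))
  have hLsum : ∀ u, L.sum u = ∑ v ∈ M.toFinset, ∑ i ∈ Finset.range (m + 1), c i v * E i v u := by
    intro u
    have : L.sum = ∑ v ∈ M.toFinset, ∑ i ∈ Finset.range (m + 1), c i v • E i v := by
      simp only [L, ← Multiset.coe_sumAddMonoidHom, map_sum]
      simp [Multiset.sum_replicate]
    rw [this]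
    simp [Finset.sum_apply]
  have hb : ∀ j < m + 1, ∀ v, L.sum (f, ζ.av (b j), v) = c j v := by
    intro j hj v
    rw [hLsum]
    have hE : ∀ v', ∀ i ∈ Finset.range (m + 1), c i v' * E i v' (f, ζ.av (b j), v) =
        if i = j then (if v' = v then c j v else 0) else 0 := by
      intro v' i hi
      rw [Finset.mem_range] at hi
      have h1 : ζ.av (b j) = ζ.av (b i) ↔ i = j :=
        ⟨fun h => hc.bb _ hi _ hj h.symm, fun h => by rw [h]⟩
      simp only [E, oneU, Pi.add_apply, Pi.smul_apply, Prod.mk.injEq, true_and, h1,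
        (hc.ab j hj).symm, (hc.pb j hj).symm, false_and, if_false, smul_zero, add_zero]
      by_cases hij : i = j <;> by_cases hv : v' = v
      · simp [hij, hv]
      · simp [hij, hv, Ne.symm hv]
      · simp [hij]
      · simp [hij]
    rw [Finset.sum_congr rfl fun v' _ => Finset.sum_congr rfl (hE v')]
    simp only [Finset.sum_ite_eq', Finset.mem_range, hj, if_true]
    by_cases hv : v ∈ M
    · simp [hv]
    · simp [hv, hc0 j v hv]
  have ha : ∀ v, L.sum (f, ζ.av a, v) = M.count v := by
    intro v
    rw [hLsum]
    have hE : ∀ v', ∀ i ∈ Finset.range (m + 1), c i v' * E i v' (f, ζ.av a, v) =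
        if v' = v then d ^ i * c i v else 0 := by
      intro v' i hi
      rw [Finset.mem_range] at hi
      by_cases hv : v' = v
      · simp [E, oneU, hc.ab i hi, hc.pa.symm, hv, mul_comm]
      · simp [E, oneU, hv, Ne.symm hv]
    rw [Finset.sum_congr rfl fun v' _ => Finset.sum_congr rfl (hE v')]
    rw [← hcount v]
    by_cases hv : v ∈ M
    · rw [Finset.sum_eq_single_of_mem v (by simpa using hv)]
      · simp
      · intro v' _ h; simp [h]
    · rw [Finset.sum_eq_zero, Finset.sum_eq_zero]
      · intro i _; rw [hc0 i v hv, mul_zero]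
      · intro v' hv'
        have : v' ≠ v := by rintro rfl; exact hv (by simpa using hv')
        simp [this]
  have hcase : ∀ u : Upd σ B, ¬ (u.1 = f ∧ u.2.1 = ζ.av p) → ¬ (u.1 = f ∧ u.2.1 = ζ.av a) →
      L.sum u ≤ d := by
    rintro ⟨f', x, v⟩ hup hua
    by_cases hu : f' = f ∧ ∃ j < m + 1, x = ζ.av (b j)
    · obtain ⟨rfl, j, hj, rfl⟩ := hu
      rw [hb j hj]
      exact (Nat.mod_lt _ (by omega)).le
    · rw [hLsum, Finset.sum_eq_zero]
      · omega
      intro v' _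
      refine Finset.sum_eq_zero fun i hi => ?_
      have h1 : E i v' (f', x, v) = 0 := by
        simp only [E, Pi.add_apply, Pi.smul_apply, oneU]
        rw [if_neg, if_neg, if_neg]
        · simp
        · simp only [Prod.mk.injEq]; exact fun h => hup ⟨h.1, h.2.1⟩
        · simp only [Prod.mk.injEq]; exact fun h => hua ⟨h.1, h.2.1⟩
        · simp only [Prod.mk.injEq]
          exact fun h => hu ⟨h.1, i, Finset.mem_range.1 hi, h.2.1⟩
      rw [h1, mul_zero]
  refine ⟨_, ⟨_, ⟨_, (Yields.runs hq hq' m L hLmem hLcard).self, rfl⟩, rfl⟩, ?_, fun u => ?_,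
    fun v => ?_⟩
  · simp only [PTerm.val]
    rw [mcollapse, if_neg (by simp [hc.pa.symm]), mcollapse, if_pos ⟨rfl, rfl⟩,
      mulVals_eq_of_count ha, if_pos rfl]
    exact one_ne_zero
  · by_cases h1 : u.1 = f ∧ u.2.1 = ζ.av p
    · refine (if_pos h1).trans_le ?_
      by_cases h2 : u.2.2 = I.lop ρ (mulVals (mcollapse I f (ζ.av a) ρ L.sum) f (ζ.av p))
      · exact (if_pos h2).trans_le (by omega)
      · exact (if_neg h2).trans_le (by omega)
    refine (if_neg h1).trans_le ?_
    by_cases h3 : u.1 = f ∧ u.2.1 = ζ.av a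
    · refine (if_pos h3).trans_le ?_
      by_cases h4 : u.2.2 = I.lop ρ (mulVals L.sum f (ζ.av a))
      · exact (if_pos h4).trans_le (by omega)
      · exact (if_neg h4).trans_le (by omega)
    · exact (if_neg h3).trans_le (hcase u h1 h3)
  · rw [← hcount v]
    refine Finset.sum_congr rfl fun i hi => ?_
    rw [Finset.mem_range] at hi
    rw [← hb i hi]
    simp [PTerm.val, mcollapse, (hc.pb i hi).symm, (hc.ab i hi).symm]

end Query

section Let

variable {N : ℕ} {e : B ≃ Fin N} {I : Interp σ B} {ζ : Asg B} {Ξ : SOAsg σ B}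

theorem sum_num_and (e : B ≃ Fin N) (P : B → Prop) (s : B → Prop) :
    ∑ i : Fin N, num e (fun p => P (e.symm i) ∧ s p) = {x | P x}.ncard * num e s := by
  classical
  have : Fintype B := Fintype.ofEquiv _ e.symm
  rw [Equiv.sum_comp e.symm fun c => num e fun p => P c ∧ s p, Set.ncard_eq_toFinset_card',
    Set.toFinset_ofPred, Finset.card_filter, Finset.sum_mul]
  refine Finset.sum_congr rfl fun c _ => ?_
  split_ifs with h
  · rw [one_mul]
    exact num_congr e fun p => by simp [h]
  · rw [zero_mul]
    exact (num_eq_zero e).2 fun p => by simp [h]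

/-- The number with binary digits in `M_k` has, in base `|B_db|`, as digits the multiplicities
of the value `1` in the cells `j, …, j + K - 1`. -/
def hornF (c : ℕ) (f : σ.F) : ℕ → ℕ → ℕ → Fml σ
  | 0, _, k => .allA 4 (.not (.memM k (.avar 4) (.avar 4)))
  | K + 1, j, k => .exM (k + 1) (.and (hornF c f K (j + 1) (k + 1)) (.exM 3 (.and
      (sumF (.and (.exDb 0 (.eq (.var 0) (.avar 3))) (.memM (k + 1) (.avar 4) (.avar 4)))
        (.memM 3 (.avar 4) (.avar 4)))
      (.exM 4 (.and (sumF (.and (.memXm c f (.avar j) (.avar 1) (.avar 3)) (minF 4 6))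
          (.memM 4 (.avar 4) (.avar 4)))
        (addF (.memM 3 (.avar 4) (.avar 4)) (.memM 4 (.avar 4) (.avar 4))
          (.memM k (.avar 4) (.avar 4))))))))

@[simp] theorem hasR_hornF (b : Bool) (c : ℕ) (f : σ.F) (K j k : ℕ) :
    ¬ (hornF c f K j k).hasR b := by
  induction K generalizing j k with
  | zero => simp [hornF, Fml.hasR, LTerm.hasR]
  | succ K ih => simp [hornF, Fml.hasR, LTerm.hasR, ih]

theorem fval_hornF (hO : Ξ.m 0 = ordRel e) (hd : 0 < I.db.ncard) (c : ℕ) (f : σ.F) (K : ℕ)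
    {j k : ℕ} (hj : 10 ≤ j) (hk : 5 ≤ k) : fval I ζ Ξ (hornF c f K j k) ↔
      num e (fun p => (p, p) ∈ Ξ.m k) = ∑ i ∈ Finset.range K,
        I.db.ncard ^ i * tok (Ξ.xm c) (f, ζ.av (j + i), ζ.av 1) := by
  have hfin : Finite B := .of_equiv _ e.symm
  have hN : 0 < N := (Nat.zero_le _).trans_lt (e (ζ.av 0)).2
  induction K generalizing j k Ξ with
  | zero => simp [hornF, fval, lval, num_eq_zero]
  | succ K ih =>
    have h0 : ∀ S, (Ξ.uM (k + 1) S).m 0 = ordRel e := fun S => by simp [hO]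
    have h1 := fun S => ih (h0 S) (j := j + 1) (k := k + 1) (by omega) (by omega)
    have h2 : ∀ S S₃, fval I ζ ((Ξ.uM (k + 1) S).uM 3 S₃)
        (sumF (.and (.exDb 0 (.eq (.var 0) (.avar 3))) (.memM (k + 1) (.avar 4) (.avar 4)))
          (.memM 3 (.avar 4) (.avar 4))) ↔ num e (fun p => (p, p) ∈ S₃) =
            I.db.ncard * num e (fun p => (p, p) ∈ S) := by
      intro S S₃
      rw [fval_sumF (e := e) (r := fun x p => x ∈ I.db ∧ (p, p) ∈ S)
        (t := fun p => (p, p) ∈ S₃), sum_num_and e (· ∈ I.db)]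
      · rfl
      · simp [hO]
      · intro x y p p' T T'
        simp [fval, lval, show k + 1 ≠ 2 by omega, show k + 1 ≠ 3 by omega,
          show k ≠ 0 by omega]
      · intro x y p p' T T'
        simp [fval, lval]
    have h3 : ∀ S S₃ S₄, fval I ζ (((Ξ.uM (k + 1) S).uM 3 S₃).uM 4 S₄)
        (sumF (.and (.memXm c f (.avar j) (.avar 1) (.avar 3)) (minF 4 6))
          (.memM 4 (.avar 4) (.avar 4))) ↔ num e (fun p => (p, p) ∈ S₄) =
            tok (Ξ.xm c) (f, ζ.av j, ζ.av 1) := by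
      intro S S₃ S₄
      rw [fval_sumF (e := e) (r := fun x p => (f, ζ.av j, ζ.av 1, x) ∈ Ξ.xm c ∧ (e p : ℕ) = 0)
        (t := fun p => (p, p) ∈ S₄), sum_num_and e (fun x => (f, ζ.av j, ζ.av 1, x) ∈ Ξ.xm c),
        (num_eq_one e hN).2 fun _ => Iff.rfl, mul_one]
      · rfl
      · simp [hO]
      · intro x y p p' T T'
        rw [fval, fval_minF (e := e) (by simp [hO]) (by decide)]
        simp [fval, lval, show j ≠ 3 by omega, show j ≠ 4 by omega, show j ≠ 5 by omega,
          show j ≠ 7 by omega]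
      · intro x y p p' T T'
        simp [fval, lval]
    have h4 : ∀ S S₃ S₄, fval I ζ (((Ξ.uM (k + 1) S).uM 3 S₃).uM 4 S₄)
        (addF (.memM 3 (.avar 4) (.avar 4)) (.memM 4 (.avar 4) (.avar 4))
          (.memM k (.avar 4) (.avar 4))) ↔ num e (fun p => (p, p) ∈ S₃) +
            num e (fun p => (p, p) ∈ S₄) = num e (fun p => (p, p) ∈ Ξ.m k) := by
      intro S S₃ S₄
      refine fval_addF (by simp [hO]) (fun p p' T => ?_) (fun p p' T => ?_) (fun p p' T => ?_)
      · simp [fval, lval]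
      · simp [fval, lval]
      · simp [fval, lval, show k ≠ 1 by omega, show k ≠ 3 by omega, show k ≠ 4 by omega]
    simp only [hornF, fval_exM, fval, h1, h2, h3, h4]
    simp only [SOAsg.uM_m, if_true]
    rw [Finset.sum_range_succ']
    have hxm : ∀ S, (Ξ.uM (k + 1) S).xm c = Ξ.xm c := fun _ => rfl
    have hstep : ∑ i ∈ Finset.range K, I.db.ncard ^ (i + 1) *
        tok (Ξ.xm c) (f, ζ.av (j + (i + 1)), ζ.av 1) = I.db.ncard * ∑ i ∈ Finset.range K,
          I.db.ncard ^ i * tok (Ξ.xm c) (f, ζ.av (j + 1 + i), ζ.av 1) := by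
      rw [Finset.mul_sum]
      refine Finset.sum_congr rfl fun i _ => ?_
      rw [show j + (i + 1) = j + 1 + i by omega]
      ring
    rw [hstep]
    simp only [hxm, pow_zero, one_mul, add_zero]
    constructor
    · rintro ⟨S, -, hS, S₃, -, hS₃, S₄, -, hS₄, h⟩
      rw [← h, hS₃, hS₄, hS]
    · intro h
      have hlt := num_lt e fun p => (p, p) ∈ Ξ.m k
      rw [h] at hlt
      have hle := Nat.le_mul_of_pos_left (∑ i ∈ Finset.range K,
          I.db.ncard ^ i * tok (Ξ.xm c) (f, ζ.av (j + 1 + i), ζ.av 1)) hd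
      obtain ⟨s, hs⟩ := num_surj e (lt_of_le_of_lt (hle.trans (Nat.le_add_right _ _)) hlt)
      obtain ⟨s₃, hs₃⟩ := num_surj e (lt_of_le_of_lt (Nat.le_add_right _ _) hlt)
      obtain ⟨s₄, hs₄⟩ := num_surj e (lt_of_le_of_lt (Nat.le_add_left _ _) hlt)
      refine ⟨{q | s q.1}, Set.toFinite _, hs, {q | s₃ q.1}, Set.toFinite _, ?_, {q | s₄ q.1},
        Set.toFinite _, hs₄, ?_⟩
      · exact hs₃.trans (by rw [← hs]; rfl)
      · rw [h, ← hs₃, ← hs₄]; rfl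

theorem PTerm.val_congr (t : PTerm σ) {ζ' : Asg B} (h : ∀ j < t.bnd, ζ'.dbv j = ζ.dbv j)
    (hav : ∀ j < t.bnd, ζ'.av j = ζ.av j) : t.val I ζ' = t.val I ζ := by
  induction t with
  | var x => exact h x (Nat.lt_succ_self x)
  | avar x => exact hav x (Nat.lt_succ_self x)
  | dyn f t ih => simp only [PTerm.val, ih h hav]
  | stat g t ih => simp only [PTerm.val, ih h hav]

/-- Existential quantification over the variables `s, …, s + L - 1`. -/
def exBlk : ℕ → ℕ → Fml σ → Fml σ
  | _, 0, φ => φ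
  | s, L + 1, φ => .exA s (exBlk (s + 1) L φ)

@[simp] theorem hasR_exBlk (b : Bool) (s L : ℕ) (φ : Fml σ) :
    (exBlk s L φ).hasR b ↔ φ.hasR b := by
  induction L generalizing s with
  | zero => rfl
  | succ L ih => simp [exBlk, ih]

/-- Two assignments agree outside of the variables `s, …, s + L - 1`. -/
def AgreeOff (s L : ℕ) (ζ ζ' : Asg B) : Prop :=
  ζ'.dbv = ζ.dbv ∧ ∀ j, j < s ∨ s + L ≤ j → ζ'.av j = ζ.av j

theorem fval_exBlk (s L : ℕ) (φ : Fml σ) :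
    fval I ζ Ξ (exBlk s L φ) ↔ ∃ ζ', AgreeOff s L ζ ζ' ∧ fval I ζ' Ξ φ := by
  induction L generalizing s ζ with
  | zero =>
    refine ⟨fun h => ⟨ζ, ⟨rfl, fun _ _ => rfl⟩, h⟩, ?_⟩
    rintro ⟨ζ', ⟨h1, h2⟩, h⟩
    have : ζ' = ζ := by
      cases ζ; cases ζ'
      simp only [Asg.mk.injEq]
      exact ⟨h1, funext fun j => h2 j (by omega)⟩
    rwa [this] at h
  | succ L ih =>
    simp only [exBlk, fval_exA, ih]
    constructor
    · rintro ⟨a, ζ', ⟨h1, h2⟩, h⟩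
      refine ⟨ζ', ⟨h1, fun j hj => ?_⟩, h⟩
      rw [h2 j (by omega), Asg.updA_av, if_neg (by omega)]
    · rintro ⟨ζ', ⟨h1, h2⟩, h⟩
      refine ⟨ζ'.av s, ζ', ⟨h1, fun j hj => ?_⟩, h⟩
      rw [Asg.updA_av]
      split_ifs with hjs
      · rw [hjs]
      · exact h2 j (by omega)

/-- The variables `s, …, s + L - 1` have distinct values. -/
def distF (s L : ℕ) : Fml σ :=
  .bigAnd ((List.range L).flatMap fun j => (List.range j).map fun i =>
    .not (.eq (.avar (s + i)) (.avar (s + j))))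

@[simp] theorem hasR_distF (b : Bool) (s L : ℕ) : ¬ (distF s L : Fml σ).hasR b := by
  simp only [distF, hasR_bigAnd, List.mem_flatMap, List.mem_map]
  rintro ⟨φ, ⟨j, -, i, -, rfl⟩, h⟩
  simp [Fml.hasR, LTerm.hasR] at h

theorem fval_distF (s L : ℕ) : fval I ζ Ξ (distF s L) ↔
    ∀ i < L, ∀ j < L, ζ.av (s + i) = ζ.av (s + j) → i = j := by
  simp only [distF, fval_bigAnd, List.mem_flatMap, List.mem_map, List.mem_range]
  constructor
  · intro h i hi j hj hij
    rcases lt_trichotomy i j with hlt | heq | hlt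
    · exact absurd hij (h _ ⟨j, hj, i, hlt, rfl⟩)
    · exact heq
    · exact absurd hij.symm (h _ ⟨i, hi, j, hlt, rfl⟩)
  · rintro h φ ⟨j, hj, i, hi, rfl⟩ hij
    have := h i (by omega) j hj hij
    omega

/-- The query evaluating a location operator on a location updated by `r`, with the variables
from `s` on as parameters. -/
noncomputable def Rule.ask (s : ℕ) (f : σ.F) (ρ : σ.Rho) (r : Rule σ) : Rule σ :=
  .query s (s + r.deg + 3) s (s + 1) (s + r.deg + 4) s r.deg r.depth (s + 2 + ·) f ρ r.stats r.rhos

theorem cells_of_dist {s m : ℕ}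
    (h₀ : ∀ i < m + 3, ∀ j < m + 3, ζ.av (s + i) = ζ.av (s + j) → i = j) :
    Cells ζ s (s + 1) (s + 2 + ·) (m + 1) := by
  refine ⟨fun h => ?_, fun i hi h => ?_, fun i hi h => ?_, fun i hi j hj h => ?_⟩
  · exact absurd (h₀ 0 (by omega) 1 (by omega) h) (by omega)
  · exact absurd (h₀ 0 (by omega) (2 + i) (by omega) (by rwa [← add_assoc])) (by omega)
  · exact absurd (h₀ 1 (by omega) (2 + i) (by omega) (by rwa [← add_assoc])) (by omega)
  · have := h₀ (2 + i) (by omega) (2 + j) (by omega) (by rwa [← add_assoc, ← add_assoc])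
    omega

theorem exists_ask (e : B ≃ Fin N) {r : Rule σ} (hN : Big r.deg N) (hd : 2 ≤ I.db.ncard)
    {D : UMul σ B} (hD : D ∈ updMuls r I ζ) (f : σ.F) (ρ : σ.Rho) (a : B) {s : ℕ}
    (hs : r.bnd ≤ s) : ∃ ζ', AgreeOff s (r.deg + 6) ζ ζ' ∧ ζ'.av (s + 1) = a ∧
      (∀ i < r.deg + 3, ∀ j < r.deg + 3, ζ'.av (s + i) = ζ'.av (s + j) → i = j) ∧
      ζ'.av (s + r.deg + 5) = I.lop ρ (mulVals D f a) ∧ ∃ D' ∈ updMuls (.ask s f ρ r) I ζ',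
        D' (f, a, I.lop ρ (mulVals D f a)) ≠ 0 ∧ (∀ u, D' u ≤ N) ∧
        ∀ v, D (f, a, v) = ∑ i ∈ Finset.range (r.deg + 1),
          I.db.ncard ^ i * D' (f, ζ'.av (s + 2 + i), v) := by
  classical
  have hN1 := hN.1
  let π := Equiv.swap (e.symm ⟨1, by omega⟩) a
  let g : ℕ → B := fun i => if h : i < N then π (e.symm ⟨i, h⟩) else a
  have hg1 : g 1 = a := by
    simp only [g, dif_pos (show 1 < N by omega), π]
    exact Equiv.swap_apply_left _ _
  have hginj : ∀ i < N, ∀ j < N, g i = g j → i = j := by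
    intro i hi j hj h
    simp only [g, dif_pos hi, dif_pos hj] at h
    simpa using e.symm.injective (π.injective h)
  obtain ⟨q₀, hq₀, q₁, hq₁, hq⟩ := (Set.one_lt_ncard I.db_fin).1 hd
  let w := I.lop ρ (mulVals D f a)
  let ζ' : Asg B := ⟨ζ.dbv, fun j => if j < s then ζ.av j else if j < s + r.deg + 3 then g (j - s)
    else if j = s + r.deg + 3 then q₀ else if j = s + r.deg + 4 then I.dyn f (g 0)
    else if j = s + r.deg + 5 then w else ζ.av j⟩
  have hcell : ∀ i < r.deg + 3, ζ'.av (s + i) = g i := fun i hi => by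
    simp only [ζ']
    rw [if_neg (by omega), if_pos (by omega), Nat.add_sub_cancel_left]
  have hlow : ∀ j < s, ζ'.av j = ζ.av j := fun j hj => by simp [ζ', hj]
  have hinj : ∀ i < r.deg + 3, ∀ j < r.deg + 3, ζ'.av (s + i) = ζ'.av (s + j) → i = j := by
    intro i hi j hj h
    rw [hcell i hi, hcell j hj] at h
    exact hginj i (by omega) j (by omega) h
  have ha : ζ'.av (s + 1) = a := by rw [hcell 1 (by omega), hg1]
  have hc := cells_of_dist hinj
  have hB := finBound_of_mem_updMuls r hd le_rfl hD
  have hreach : ∀ v ∈ mulVals D f a, v ∈ Reach I r.stats r.rhos (I.db.ncard ^ r.deg)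
      (I.db ∪ {v | ∃ j < s, ζ.dbv j = v} ∪ {v | ∃ j < s, ζ.av j = v}) r.depth := fun v hv =>
    value_mem_reach r hd le_rfl le_rfl (fun x hx => .inl (.inl hx))
      (fun j hj => .inl (.inr ⟨j, by omega, rfl⟩)) (fun j hj => .inr ⟨j, by omega, rfl⟩)
      (fun _ h => h) (fun _ h => h) hD f a v (mem_mulVals hv)
  obtain ⟨D', h1, h2, h3, h4⟩ := query_complete (ρ := ρ) (y := s) (q := s + r.deg + 3)
    (j₀ := s + r.deg + 4) (f := f) hc (n := s)
    (show ζ'.av (s + r.deg + 3) ∈ I.db by simpa [ζ', add_assoc] using hq₀)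
    ⟨q₁, hq₁, by simpa [ζ', add_assoc] using hq.symm⟩
    (by rw [show ζ'.av s = g 0 from hcell 0 (by omega)]; simp [ζ', add_assoc]) le_rfl
    (by
      rintro v ((hv | hv) | ⟨j, hj, hv⟩)
      · exact .inl hv
      · exact .inr (.inl hv)
      · exact .inr (.inr ⟨j, hj, (hlow j hj).trans hv⟩)) hreach
    (hB.card_mulVals f a) hd
  refine ⟨ζ', ⟨rfl, fun j hj => ?_⟩, ha, hinj, ?_, D', h1, ?_, fun u => ?_, fun v => ?_⟩
  · rcases hj with hj | hj
    · exact hlow j hj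
    · simp only [ζ']
      rw [if_neg (by omega), if_neg (by omega), if_neg (by omega), if_neg (by omega),
        if_neg (by omega)]
  · simp [ζ', add_assoc, w]
  · rwa [ha] at h2
  · exact (h3 u).trans (ncard_db_le e I)
  · rw [← h4, count_mulVals (hB.finite_support_loc f a)]

theorem LExpr.letr (f : σ.F) (t : PTerm σ) (ρ : σ.Rho) {r : Rule σ} (hr : LExpr r) :
    LExpr (.letr f t ρ r) := by
  classical
  intro n
  obtain ⟨ψ, h1, h2⟩ := hr (n + 1)
  obtain ⟨s, hs, hts, hrs⟩ : ∃ s, 10 ≤ s ∧ t.bnd ≤ s ∧ r.bnd ≤ s :=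
    ⟨max 10 (max t.bnd r.bnd), by omega, by omega, by omega⟩
  let χ : Fml σ := .allA 1 (.exM 5 (.and (hornF (n + 2) f (r.deg + 1) (s + 2) 5)
    (.allA 4 (.iff (.memM 5 (.avar 4) (.avar 4))
      (.memXm (n + 1) f (.avar (s + 1)) (.avar 1) (.avar 4))))))
  let ω : Fml σ := .exA 2 (.memXm (n + 2) f (.avar (s + 1)) (.avar (s + r.deg + 5)) (.avar 2))
  let θ : σ.F → Fml σ := fun f' => if f' = f then
      .and (.imp (.not (.eq (.avar 0) (.avar (s + 1)))) (eqDigF n (n + 1) f'))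
        (.imp (.eq (.avar 0) (.avar (s + 1))) (.allA 4 (.iff (digF n f')
          (.and (.eq (.avar 1) (.avar (s + r.deg + 5))) (minF 4 6)))))
    else eqDigF n (n + 1) f'
  refine ⟨.exXm (n + 1) (.and ψ (exBlk s (r.deg + 6) (.and (.eq (.avar (s + 1)) t.toL)
    (.and (distF s (r.deg + 3)) (.exXm (n + 2) (.and (.upm (.ask s f ρ r) (n + 2))
      (.and χ (.and ω (allU θ))))))))), ?_, fun B I ζ Ξ N e hO hN hd => ?_⟩
  · have : ∀ f', ¬ (θ f').hasR true := by
      intro f'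
      simp only [θ]
      split_ifs <;> simp [Fml.hasR, LTerm.hasR]
    simp [Fml.hasR, LTerm.hasR, h1, χ, ω, this]
  have hfin : Finite B := .of_equiv _ e.symm
  have hN' : Big r.deg N := hN.mono (by simp only [Rule.deg]; omega)
  have hN1 : 0 < N := by have := hN.1; omega
  have h3 := fun P => h2 B I ζ (Ξ.uXm (n + 1) P) N e hO hN' hd
  have hχ : ∀ P Q ζ', fval I ζ' ((Ξ.uXm (n + 1) P).uXm (n + 2) Q) χ ↔
      ∀ v, dec e P (f, ζ'.av (s + 1), v) = ∑ i ∈ Finset.range (r.deg + 1),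
        I.db.ncard ^ i * tok Q (f, ζ'.av (s + 2 + i), v) := by
    intro P Q ζ'
    simp only [χ, fval]
    refine forall_congr' fun v => ?_
    rw [fval_exM]
    have hO' : ∀ S, (((Ξ.uXm (n + 1) P).uXm (n + 2) Q).uM 5 S).m 0 = ordRel e := fun S => by
      simpa using hO
    simp only [fval, fval_hornF (hO' _) (show 0 < I.db.ncard by omega) (n + 2) f (r.deg + 1)
      (show 10 ≤ s + 2 by omega) le_rfl, fval_iff, lval]
    simp [show ∀ i, s + 2 + i ≠ 1 by omega, show s ≠ 3 by omega, show s ≠ 0 by omega]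
    constructor
    · rintro ⟨S, -, hS, h⟩
      rw [← hS]
      exact num_congr e fun p => (h p).symm
    · intro h
      exact ⟨{q | (f, ζ'.av (s + 1), v, q.1) ∈ P}, Set.toFinite _, h, fun _ => Iff.rfl⟩
  have hω : ∀ P Q ζ', fval I ζ' ((Ξ.uXm (n + 1) P).uXm (n + 2) Q) ω ↔
      tok Q (f, ζ'.av (s + 1), ζ'.av (s + r.deg + 5)) ≠ 0 := by
    intro P Q ζ'
    simp [ω, fval, lval, tok_ne_zero, show s + r.deg + 5 ≠ 2 by omega, show s ≠ 1 by omega]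
  have hθ : ∀ P Q ζ', fval I ζ' ((Ξ.uXm (n + 1) P).uXm (n + 2) Q) (allU θ) ↔
      ∀ f' x v, dec e (Ξ.xm n) (f', x, v) = if f' = f ∧ x = ζ'.av (s + 1) then
        (if v = ζ'.av (s + r.deg + 5) then 1 else 0) else dec e P (f', x, v) := by
    intro P Q ζ'
    rw [fval_allU]
    refine forall_congr' fun f' => forall_congr' fun x => forall_congr' fun v => ?_
    have hO' : ((Ξ.uXm (n + 1) P).uXm (n + 2) Q).m 0 = ordRel e := hO
    by_cases hf : f' = f
    · simp only [θ, if_pos hf, fval, fval_imp, fval_eqDigF e, lval, fval_iff, fval_digF,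
        fval_minF hO' (show 4 ≠ 6 by decide)]
      simp [show s + r.deg + 5 ≠ 1 by omega, show s + r.deg + 5 ≠ 4 by omega,
        show s ≠ 0 by omega, hf]
      by_cases hx : x = ζ'.av (s + 1)
      · by_cases hv : v = ζ'.av (s + r.deg + 5)
        · simp only [hx, hv, if_true, not_true_eq_false, false_imp_iff, true_and, true_imp_iff]
          exact (num_eq_one e hN1).symm
        · simp only [hx, hv, if_true, if_false, not_true_eq_false, false_imp_iff, true_and,
            true_imp_iff, false_and, iff_false]
          exact (dec_eq_zero (e := e) (u := (f, ζ'.av (s + 1), v))).symm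
      · simp [hx]
    · simp [θ, hf, fval_eqDigF e]
  simp only [fval_exXm, fval, h3, fval_exBlk, fval_distF, hχ, hω, hθ, lval, lval_toL]
  simp only [SOAsg.uXm_xm, if_true]
  constructor
  · rintro ⟨P, -, hP, ζ', hζ', ht, hdist, Q, -, hQ, hbal, hw, hall⟩
    have ht' : ζ'.av (s + 1) = t.val I ζ := ht.trans (PTerm.val_congr t (fun j _ => by rw [hζ'.1])
      fun j hj => hζ'.2 j (by omega))
    have hc : Cells ζ' s (s + 1) (s + 2 + ·) (r.deg + 1) := cells_of_dist hdist
    refine ⟨_, hP, funext fun ⟨f', x, v⟩ => ?_⟩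
    rw [hall, query_sound hc hQ hbal hw, ht']
    rfl
  · rintro ⟨D, hD, h⟩
    obtain ⟨P, rfl⟩ := exists_dec e (lt_two_pow_of_mem e hN' hD)
    obtain ⟨ζ', hζ', ha, hdist, hw, D', hD', hne, hle, hbal⟩ :=
      exists_ask e hN' hd hD f ρ (t.val I ζ) hrs
    obtain ⟨Q, rfl⟩ := exists_tok e hle
    refine ⟨P, Set.toFinite _, hD, ζ', hζ', ?_, hdist, Q, Set.toFinite _, hD', ?_, ?_, ?_⟩
    · exact ha.trans (PTerm.val_congr t (fun j _ => by rw [hζ'.1])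
        fun j hj => hζ'.2 j (by omega)).symm
    · rwa [ha]
    · rwa [ha, hw]
    · intro f' x v
      rw [h, ha, hw]
      rfl

theorem lExpr (r : Rule σ) : LExpr r := by
  induction r with
  | assign f t v => exact .assign f t v
  | cond φ r ih => exact .cond φ ih
  | forall_ x φ r ih => exact .forall_ x φ ih
  | choose x φ r ih => exact .choose x φ ih
  | par r₁ r₂ ih₁ ih₂ => exact .par ih₁ ih₂
  | seq r₁ r₂ ih₁ ih₂ => exact .seq ih₁ ih₂
  | letr f t ρ r ih => exact .letr f t ρ ih

end Let

section Assembly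

variable {I : Interp σ B} {ζ : Asg B} {Ξ : SOAsg σ B}

theorem exists_forall_big (k : ℕ) : ∃ N₀, ∀ N ≥ N₀, Big k N ∧ 2 ^ k ≤ N := by
  have h := (tendsto_pow_const_div_const_pow_of_one_lt k (one_lt_two (α := ℝ))).eventually
    (gt_mem_nhds one_pos)
  obtain ⟨N₁, h₁⟩ := Filter.eventually_atTop.1 h
  refine ⟨max N₁ (max (k + 10) (2 ^ k)), fun N hN => ⟨⟨by omega, ?_⟩, by omega⟩⟩
  have := h₁ N (by omega)
  rw [div_lt_one (by positivity)] at this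
  exact_mod_cast this

theorem tok_ne_zero_of_finite {X : Set (σ.F × B × B × B)} (hX : X.Finite) {u : Upd σ B} :
    tok X u ≠ 0 ↔ ∃ p, (u.1, u.2.1, u.2.2, p) ∈ X := by
  have : {p | (u.1, u.2.1, u.2.2, p) ∈ X}.Finite :=
    (hX.image fun q => q.2.2.2).subset fun p hp => ⟨_, hp, rfl⟩
  rw [tok, ne_eq, Set.ncard_eq_zero this, ← ne_eq, ← Set.nonempty_iff_ne_empty]; rfl

theorem exists_finite_tok {D : UMul σ B} (hD : (Function.support D).Finite)
    (h : ∀ u, ∃ s : Finset B, s.card = D u) :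
    ∃ X : Set (σ.F × B × B × B), X.Finite ∧ tok X = D := by
  choose s hs using h
  refine ⟨{q | q.2.2.2 ∈ s (q.1, q.2.1, q.2.2.1)}, ?_, funext fun u => ?_⟩
  · refine (hD.biUnion fun u _ =>
      ((s u).finite_toSet.image fun p => (u.1, u.2.1, u.2.2, p))).subset ?_
    rintro ⟨f, a, b, p⟩ hp
    refine Set.mem_biUnion (x := (f, a, b)) ?_ ⟨p, hp, rfl⟩
    rw [Function.mem_support, ← hs]
    exact Finset.card_ne_zero_of_mem hp
  · rw [← hs u, ← Set.ncard_coe_finset]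
    rfl

/-- `X_n` is the support of an update multiset yielded by `r`, represented by tokens. -/
noncomputable def directF (r : Rule σ) (n : ℕ) : Fml σ := .exXm 0 (.and (.upm r 0) (projEq n 0))

theorem fval_directF (r : Rule σ) (n : ℕ) : fval I ζ Ξ (directF r n) ↔
    ∃ P : Set (σ.F × B × B × B), P.Finite ∧ tok P ∈ updMuls r I ζ ∧ mulToSet (tok P) = Ξ.x n := by
  simp only [directF, fval_exXm, fval, fval_projEq]
  refine exists_congr fun P => and_congr_right fun hP => and_congr Iff.rfl ?_
  rw [Set.ext_iff, Prod.forall]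
  refine forall_congr' fun f => ?_
  rw [Prod.forall]
  refine forall_congr' fun a => forall_congr' fun b => ?_
  rw [mulToSet, Set.mem_ofPred_eq, tok_ne_zero_of_finite hP, SOAsg.uXm_xm, if_pos rfl]
  exact Iff.comm

/-- The base set has `s + 1` elements. -/
def cardF (s : ℕ) : Fml σ := .exA 0 (.and (elF s 0) (maxF 0 1))

theorem fval_cardF {N : ℕ} {e : B ≃ Fin N} (hO : Ξ.m 0 = ordRel e) (s : ℕ) :
    fval I ζ Ξ (cardF s) ↔ N = s + 1 := by
  simp only [cardF, fval_exA, fval, fval_elF hO, fval_maxF hO (show 0 ≠ 1 by decide),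
    Asg.updA_av, if_true]
  constructor
  · rintro ⟨a, h, h'⟩; omega
  · intro h
    exact ⟨e.symm ⟨s, by omega⟩, by simp, by simp [h]⟩

theorem finite_of_total {S : Set (B × B)} (hS : S.Finite) (h : ∀ a, (a, a) ∈ S) : Finite B :=
  have := hS.to_subtype
  .of_injective (fun a : B => (⟨(a, a), h a⟩ : S)) fun a b hab => by simpa using hab

theorem exists_enum {S : Set (B × B)} (hS : S.Finite) (h : fval I ζ (Ξ.uM 0 S) ordF) :
    ∃ (N : ℕ) (e : B ≃ Fin N), (Ξ.uM 0 S).m 0 = ordRel e := by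
  have : Finite B := finite_of_total hS fun a => by
    simpa using ((fval_ordF_iff.1 h) a a a).1
  exact exists_enum_of_ordF h

theorem exists_noUpd_atom (r : Rule σ) (n : ℕ) :
    ∃ ψ : Fml σ, FmlEquiv (.upd r n) ψ ∧ ¬ ψ.hasR true := by
  obtain ⟨N₀, hN₀⟩ := exists_forall_big r.deg
  obtain ⟨ψ, h1, h2⟩ := lExpr r 0
  choose χ h1' h2' using exists_small r n
  let large : Fml σ := .exM 0 (.and ordF (.and (.not (.bigOr ((List.range N₀).map cardF)))
    (.and (.exDb 0 (.exDb 1 (.not (.eq (.var 0) (.var 1))))) (.exXm 0 (.and ψ (projEq n 0))))))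
  let small : ℕ → Fml σ := fun s => .exM 0 (.and ordF (.and (cardF s) (χ (s + 1))))
  refine ⟨.bigOr (directF r n :: large :: (List.range N₀).map small), fun B I ζ Ξ _ => ?_, ?_⟩
  swap
  · simp [Fml.hasR, LTerm.hasR, directF, large, small, cardF, h1, h1']
  have hproj : ∀ {N : ℕ} (e : B ≃ Fin N) S P, fval I ζ ((Ξ.uM 0 S).uXm 0 P) (projEq n 0) ↔
      mulToSet (dec e P) = Ξ.x n := by
    intro N e S P
    rw [fval_projEq, Set.ext_iff]
    simp only [Prod.forall, mulToSet, Set.mem_ofPred_eq, ne_eq, dec_eq_zero]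
    simp [iff_comm]
  have hcard : 2 ≤ I.db.ncard ↔
      fval I ζ Ξ (.exDb 0 (.exDb 1 (.not (.eq (.var 0) (.var 1))))) := by
    simp [Nat.succ_le_iff, Set.one_lt_ncard I.db_fin, fval, lval]
  rw [fval, mem_updSets_iff, fval_bigOr]
  constructor
  · rintro ⟨D, hD, hsupp⟩
    have hB := finBound_of_mem_updMuls r (le_max_right _ _) (le_max_left _ _) hD
    have hdir : (∀ u, ∃ s : Finset B, s.card = D u) → fval I ζ Ξ (directF r n) := fun h => by
      obtain ⟨P, hP, rfl⟩ := exists_finite_tok hB.finite_support h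
      exact (fval_directF r n).2 ⟨P, hP, hD, hsupp⟩
    rcases finite_or_infinite B with hfin | hinf
    swap
    · exact ⟨_, List.mem_cons_self, hdir fun u => Infinite.exists_subset_card_eq B (D u)⟩
    obtain ⟨N, ⟨e⟩⟩ := Finite.exists_equiv_fin B
    have hO : (Ξ.uM 0 (ordRel e)).m 0 = ordRel e := by simp
    have hpos : 0 < N := (Nat.zero_le _).trans_lt (e (ζ.av 0)).2
    by_cases hN : N ≤ N₀
    · obtain ⟨s, rfl⟩ : ∃ s, N = s + 1 := ⟨N - 1, by omega⟩
      refine ⟨small s, by simp; right; right; exact ⟨s, by omega, rfl⟩, ?_⟩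
      simp only [small, fval_exM, fval]
      refine ⟨_, Set.toFinite (ordRel e), fval_ordF_of_eq hO, (fval_cardF hO s).2 rfl, ?_⟩
      exact (h2' (s + 1) B I ζ _ e hO).2 ((mem_updSets_iff _ _ _ _).2 ⟨D, hD, hsupp⟩)
    obtain ⟨hbig, hpow⟩ := hN₀ N (by omega)
    by_cases hd : 2 ≤ I.db.ncard
    · refine ⟨large, by simp, ?_⟩
      obtain ⟨P, rfl⟩ := exists_dec e (lt_two_pow_of_mem e hbig hD)
      simp only [large, fval_exM, fval, fval_exXm, fval_bigOr]
      refine ⟨_, Set.toFinite (ordRel e), fval_ordF_of_eq hO, ?_, ?_, P, Set.toFinite _,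
        (h2 B I ζ ((Ξ.uM 0 (ordRel e)).uXm 0 P) N e hO hbig hd).2 (by simpa using hD),
        (hproj e _ _).2 hsupp⟩
      · rintro ⟨φ, hφ, h⟩
        obtain ⟨s, hs, rfl⟩ := List.mem_map.1 hφ
        rw [fval_cardF hO] at h
        have := List.mem_range.1 hs
        omega
      · simpa [fval, lval] using hcard.1 hd
    · refine ⟨_, List.mem_cons_self, hdir fun u => ?_⟩
      have hle := hB.le u
      rw [max_eq_right (by omega)] at hle
      have := Fintype.ofEquiv _ e.symm
      obtain ⟨s, -, hs⟩ := Finset.exists_subset_card_eq (s := (Finset.univ : Finset B))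
        (n := D u) (by rw [Finset.card_univ, Fintype.card_congr e, Fintype.card_fin]; omega)
      exact ⟨s, hs⟩
  · rintro ⟨φ, hφ, h⟩
    simp only [List.mem_cons, List.mem_map, List.mem_range] at hφ
    rcases hφ with rfl | rfl | ⟨s, hs, rfl⟩
    · obtain ⟨P, -, hP, hsupp⟩ := (fval_directF r n).1 h
      exact ⟨_, hP, hsupp⟩
    · simp only [large, fval_exM, fval, fval_exXm, fval_bigOr] at h
      obtain ⟨S, hS, hord, hcd, hd, P, -, hP, hsupp⟩ := h
      obtain ⟨N, e, hO⟩ := exists_enum hS hord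
      have hpos : 0 < N := (Nat.zero_le _).trans_lt (e (ζ.av 0)).2
      have hN : N₀ ≤ N := by
        by_contra hlt
        refine hcd ⟨_, List.mem_map_of_mem (List.mem_range.2 (show N - 1 < N₀ by omega)), ?_⟩
        rw [fval_cardF hO]
        omega
      have hd' : 2 ≤ I.db.ncard := hcard.2 (by simpa [fval, lval] using hd)
      exact ⟨dec e P, by
        simpa using (h2 B I ζ ((Ξ.uM 0 S).uXm 0 P) N e hO (hN₀ N hN).1 hd').1 hP,
        (hproj e S P).1 hsupp⟩
    · simp only [small, fval_exM, fval] at h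
      obtain ⟨S, hS, hord, hcd, hχ⟩ := h
      obtain ⟨N, e, hO⟩ := exists_enum hS hord
      obtain rfl := (fval_cardF hO s).1 hcd
      exact (mem_updSets_iff _ _ _ _).1 ((h2' (s + 1) B I ζ _ e hO).1 hχ)

end Assembly

/-- Each formula in the logic for DB-ASMs can be replaced by
an equivalent formula not containing any subformula of the form `upd(r,X)`. -/
theorem upd_elimination {σ : Sig} (φ : Fml σ) :
    ∃ ψ : Fml σ, FmlEquiv φ ψ ∧ ¬ ψ.hasUpd := by
  exact exists_noUpd_of_atoms exists_noUpd_atom φ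

end DBASM
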